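/- arXiv:1712.07191 — 5 statements merged into one kernel-verified Lean document; each statement's English description precedes it below -/
import Mathlib

section
/- Suppose G₁ and G₂ are residually solvable groups with internal semidirect product decompositions G₁ = H₁ ⋉ N₁ and G₂ = H₂ ⋉ N₂ (i.e. N_i is a normal subgroup of G_i, H_i is a subgroup of G_i, H_i ∩ N_i = {1}, and H_i·N_i = G_i), and let φ: H₁ → H₂ be a group isomorphism. Then the amalgamated free product G₁ *_φ G₂ is residually solvable. -/
universe u v

/-- A group is residually solvable if every nonidentity element admits a homomorphism to a
solvable group with nonidentity image. -/
def ResiduallySolvable (G : Type u) [Group G] : Prop :=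
  ∀ x : G, x ≠ 1 → ∃ (H : Type u) (_ : Group H) (f : G →* H), IsSolvable H ∧ f x ≠ 1

section Amalgam

variable {G₁ : Type u} {G₂ : Type v} [Group G₁] [Group G₂]

/-- The relators identifying `H₁ ≤ G₁` with `H₂ ≤ G₂` via `φ` inside the free product. -/
def amalRels (H₁ : Subgroup G₁) (H₂ : Subgroup G₂) (φ : H₁ ≃* H₂) :
    Set (Monoid.Coprod G₁ G₂) :=
  ⋃ h : H₁, {Monoid.Coprod.inl (h : G₁) *
    (Monoid.Coprod.inr ((φ h : G₂)) : Monoid.Coprod G₁ G₂)⁻¹}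

/-- The amalgamated free product `G₁ ∗_φ G₂`: the quotient of the free product `G₁ ∗ G₂` by
the normal closure of `{h · φ(h)⁻¹ : h ∈ H₁}`. -/
def Amal (H₁ : Subgroup G₁) (H₂ : Subgroup G₂) (φ : H₁ ≃* H₂) : Type (max u v) :=
  Monoid.Coprod G₁ G₂ ⧸ Subgroup.normalClosure (amalRels H₁ H₂ φ)

instance (H₁ : Subgroup G₁) (H₂ : Subgroup G₂) (φ : H₁ ≃* H₂) : Group (Amal H₁ H₂ φ) :=
  inferInstanceAs (Group (Monoid.Coprod G₁ G₂ ⧸ Subgroup.normalClosure (amalRels H₁ H₂ φ)))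

end Amalgam

theorem resSolv_iff {G : Type u} [Group G] :
    ResiduallySolvable G ↔ ∀ x : G, x ≠ 1 → ∃ n, x ∉ derivedSeries G n := by
  constructor
  · intro h x hx
    obtain ⟨H, _, f, hs, hf⟩ := h x hx
    obtain ⟨n, hn⟩ := hs.solvable
    refine ⟨n, fun hxn => hf ?_⟩
    have := map_derivedSeries_le_derivedSeries f n (Subgroup.mem_map_of_mem f hxn)
    rw [hn] at this
    simpa using this
  · intro h x hx
    obtain ⟨n, hn⟩ := h x hx
    refine ⟨G ⧸ derivedSeries G n, inferInstance, QuotientGroup.mk' _, ⟨⟨n, ?_⟩⟩, ?_⟩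
    · rw [← map_derivedSeries_eq (QuotientGroup.mk'_surjective (derivedSeries G n)) n]
      simp
    · simpa using hn

section AmalAPI

variable {G₁ : Type u} {G₂ : Type v} [Group G₁] [Group G₂]
  {H₁ : Subgroup G₁} {H₂ : Subgroup G₂} (φ : H₁ ≃* H₂)

def Amal.inl : G₁ →* Amal H₁ H₂ φ :=
  (QuotientGroup.mk' (Subgroup.normalClosure (amalRels H₁ H₂ φ))).comp Monoid.Coprod.inl

def Amal.inr : G₂ →* Amal H₁ H₂ φ :=
  (QuotientGroup.mk' (Subgroup.normalClosure (amalRels H₁ H₂ φ))).comp Monoid.Coprod.inr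

theorem Amal.glue (h : H₁) : Amal.inl φ (h : G₁) = Amal.inr φ (φ h : G₂) := by
  have : (Monoid.Coprod.inl (h : G₁) * (Monoid.Coprod.inr ((φ h : G₂)) : Monoid.Coprod G₁ G₂)⁻¹)
      ∈ Subgroup.normalClosure (amalRels H₁ H₂ φ) :=
    Subgroup.subset_normalClosure (Set.mem_iUnion.2 ⟨h, rfl⟩)
  have h2 := (QuotientGroup.eq_one_iff _).2 this
  rw [← mul_inv_eq_one]
  exact h2

theorem Amal.exists_lift {K : Type*} [Group K] (f : G₁ →* K) (g : G₂ →* K)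
    (hfg : ∀ h : H₁, f h = g (φ h)) :
    ∃ F : Amal H₁ H₂ φ →* K, (∀ x, F (Amal.inl φ x) = f x) ∧ (∀ x, F (Amal.inr φ x) = g x) := by
  refine ⟨QuotientGroup.lift (Subgroup.normalClosure (amalRels H₁ H₂ φ))
    (Monoid.Coprod.lift f g) ?_, fun x => ?_, fun x => ?_⟩
  · intro x hx
    have : Subgroup.normalClosure (amalRels H₁ H₂ φ) ≤ (Monoid.Coprod.lift f g).ker := by
      apply Subgroup.normalClosure_le_normal
      intro y hy
      obtain ⟨h, rfl⟩ := Set.mem_iUnion.1 hy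
      simp [MonoidHom.mem_ker, hfg]
    exact this hx
  · exact Monoid.Coprod.lift_apply_inl f g x
  · exact Monoid.Coprod.lift_apply_inr f g x

theorem Amal.ind {p : Amal H₁ H₂ φ → Prop} (one : p 1)
    (hl : ∀ g x, p x → p (Amal.inl φ g * x)) (hr : ∀ g x, p x → p (Amal.inr φ g * x)) (x) :
    p x := by
  obtain ⟨y, rfl⟩ := QuotientGroup.mk_surjective x
  let q : Monoid.Coprod G₁ G₂ →* Amal H₁ H₂ φ :=
    QuotientGroup.mk' (Subgroup.normalClosure (amalRels H₁ H₂ φ))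
  change p (q y)
  have : ∀ z, p z → p (q y * z) := by
    induction y using Monoid.Coprod.induction_on with
    | inl m => exact fun z hz => hl m z hz
    | inr m => exact fun z hz => hr m z hz
    | mul a b ha hb =>
      intro z hz
      rw [map_mul, mul_assoc]
      exact ha _ (hb _ hz)
  simpa using this 1 one

/-- Reduced tails `b₁ a₁ ⋯ b_k a_k`. -/
inductive Tail (P : G₁ → Prop) (Q : G₂ → Prop) : Amal H₁ H₂ φ → Prop
  | single (b : G₂) (a : G₁) (hb : Q b) : Tail P Q (Amal.inr φ b * Amal.inl φ a)
  | cons (b : G₂) (a : G₁) (y : Amal H₁ H₂ φ) (hb : Q b) (ha : P a) (hy : Tail P Q y) :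
      Tail P Q (Amal.inr φ b * Amal.inl φ a * y)

theorem Tail.mono {P P' : G₁ → Prop} {Q Q' : G₂ → Prop} (hP : ∀ a, P a → P' a)
    (hQ : ∀ a, Q a → Q' a) {y : Amal H₁ H₂ φ} (h : Tail φ P Q y) : Tail φ P' Q' y := by
  induction h with
  | single b a hb => exact .single b a (hQ _ hb)
  | cons b a y hb ha hy ih => exact .cons b a y (hQ _ hb) (hP _ ha) ih

theorem exists_decomp {G : Type*} [Group G] {H N : Subgroup G} (hN : N.Normal) (ht : H ⊔ N = ⊤)
    (g : G) : ∃ h : H, ∃ n ∈ N, g = h * n := by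
  have : g ∈ H ⊔ N := ht ▸ Subgroup.mem_top g
  obtain ⟨h, hh, n, hn, rfl⟩ := Subgroup.mem_sup_of_normal_right.1 this
  exact ⟨⟨h, hh⟩, n, hn, rfl⟩

theorem exists_retract {G : Type*} [Group G] {H N : Subgroup G} (hN : N.Normal)
    (hd : H ⊓ N = ⊥) (ht : H ⊔ N = ⊤) :
    ∃ r : G →* H, (∀ h : H, r h = h) ∧ ∀ n ∈ N, r n = 1 := by
  let f : H →* G ⧸ N := (QuotientGroup.mk' N).comp H.subtype
  have hf : Function.Bijective f := by
    constructor
    · rw [injective_iff_map_eq_one]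
      intro h hh
      have h1 : (h : G) ∈ N := (QuotientGroup.eq_one_iff _).1 hh
      have : (h : G) ∈ H ⊓ N := ⟨h.2, h1⟩
      rw [hd] at this
      exact Subtype.ext (by simpa using this)
    · intro q
      obtain ⟨g, rfl⟩ := QuotientGroup.mk_surjective q
      obtain ⟨h, n, hn, rfl⟩ := exists_decomp hN ht g
      refine ⟨h, ?_⟩
      apply QuotientGroup.eq.2
      simpa using hn
  refine ⟨(MulEquiv.ofBijective f hf).symm.toMonoidHom.comp (QuotientGroup.mk' N), ?_, ?_⟩
  · intro h
    exact (MulEquiv.ofBijective f hf).symm_apply_apply h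
  · intro n hn
    have : QuotientGroup.mk' N n = 1 := (QuotientGroup.eq_one_iff _).2 hn
    simp only [MonoidHom.comp_apply, this, map_one]

theorem exists_form {N₁ : Subgroup G₁} {N₂ : Subgroup G₂} (hN₁ : N₁.Normal) (hN₂ : N₂.Normal)
    (ht₁ : H₁ ⊔ N₁ = ⊤) (ht₂ : H₂ ⊔ N₂ = ⊤) (x : Amal H₁ H₂ φ) :
    ∃ g y, x = Amal.inl φ g * y ∧
      (y = 1 ∨ Tail φ (fun a => a ∈ N₁ ∧ a ≠ 1) (fun b => b ∈ N₂ ∧ b ≠ 1) y) := by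
  have key : ∀ b ∈ N₂, ∀ g y,
      (y = 1 ∨ Tail φ (fun a => a ∈ N₁ ∧ a ≠ 1) (fun b => b ∈ N₂ ∧ b ≠ 1) y) →
      ∃ g' y', Amal.inr φ b * (Amal.inl φ g * y) = Amal.inl φ g' * y' ∧
      (y' = 1 ∨ Tail φ (fun a => a ∈ N₁ ∧ a ≠ 1) (fun b => b ∈ N₂ ∧ b ≠ 1) y') := by
    intro b hb g y hy
    obtain ⟨h, a, ha, rfl⟩ := exists_decomp hN₁ ht₁ g
    obtain ⟨c, hc⟩ : ∃ c, c = (φ h : G₂)⁻¹ * b * (φ h : G₂) := ⟨_, rfl⟩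
    have hcN : c ∈ N₂ := by
      have := hN₂.conj_mem b hb (φ h : G₂)⁻¹
      rw [hc]; simpa using this
    have e : Amal.inr φ b * (Amal.inl φ (h * a) * y)
        = Amal.inl φ (h : G₁) * (Amal.inr φ c * Amal.inl φ a * y) := by
      rw [map_mul, Amal.glue, hc]
      simp only [map_mul, map_inv]
      group
    rw [e]
    by_cases hc1 : c = 1
    · refine ⟨h * a, y, ?_, hy⟩
      simp [hc1, mul_assoc]
    rcases hy with rfl | hy
    · exact ⟨h, _, rfl, Or.inr (by rw [mul_one]; exact .single c a ⟨hcN, hc1⟩)⟩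
    by_cases ha1 : a = 1
    · subst ha1
      cases hy with
      | single b' a' hb' =>
        by_cases hcb : c * b' = 1
        · refine ⟨h * a', 1, ?_, Or.inl rfl⟩
          have : Amal.inr φ c * Amal.inr φ b' = 1 := by rw [← map_mul, hcb, map_one]
          simp only [map_one, mul_one, map_mul]
          rw [← mul_assoc (Amal.inr φ c), this, one_mul]
        · refine ⟨h, Amal.inr φ (c * b') * Amal.inl φ a', ?_, Or.inr (.single _ _
            ⟨N₂.mul_mem hcN hb'.1, hcb⟩)⟩
          simp [mul_assoc]
      | cons b' a' y hb' ha' hy =>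
        by_cases hcb : c * b' = 1
        · refine ⟨h * a', y, ?_, Or.inr hy⟩
          have : Amal.inr φ c * Amal.inr φ b' = 1 := by rw [← map_mul, hcb, map_one]
          simp only [map_one, mul_one, map_mul]
          rw [mul_assoc (Amal.inr φ b'), ← mul_assoc (Amal.inr φ c), this, one_mul, mul_assoc]
        · refine ⟨h, Amal.inr φ (c * b') * Amal.inl φ a' * y, ?_, Or.inr (.cons _ _ _
            ⟨N₂.mul_mem hcN hb'.1, hcb⟩ ha' hy)⟩
          simp [mul_assoc]
    · exact ⟨h, _, rfl, Or.inr (.cons c a y ⟨hcN, hc1⟩ ⟨ha, ha1⟩ hy)⟩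
  induction x using Amal.ind with
  | one => exact ⟨1, 1, by simp, Or.inl rfl⟩
  | hl g x ih =>
    obtain ⟨g', y, rfl, hy⟩ := ih
    exact ⟨g * g', y, by simp [mul_assoc], hy⟩
  | hr g x ih =>
    obtain ⟨g', y, rfl, hy⟩ := ih
    obtain ⟨h, n, hn, rfl⟩ := exists_decomp hN₂ ht₂ g
    obtain ⟨g'', y', e, hy'⟩ := key n hn g' y hy
    refine ⟨(φ.symm h : H₁) * g'', y', ?_, hy'⟩
    rw [map_mul, map_mul, mul_assoc, e, Amal.glue]
    simp [mul_assoc]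

theorem Tail.bound {N₁ : Subgroup G₁} {N₂ : Subgroup G₂}
    (h₁ : ∀ x : G₁, x ≠ 1 → ∃ n, x ∉ derivedSeries G₁ n)
    (h₂ : ∀ x : G₂, x ≠ 1 → ∃ n, x ∉ derivedSeries G₂ n) {y : Amal H₁ H₂ φ}
    (hy : Tail φ (fun a => a ∈ N₁ ∧ a ≠ 1) (fun b => b ∈ N₂ ∧ b ≠ 1) y) :
    ∃ d, Tail φ (fun a => a ∈ N₁ ∧ a ∉ derivedSeries G₁ d)
      (fun b => b ∈ N₂ ∧ b ∉ derivedSeries G₂ d) y := by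
  induction hy with
  | single b a hb =>
    obtain ⟨n, hn⟩ := h₂ b hb.2
    exact ⟨n, .single b a ⟨hb.1, hn⟩⟩
  | cons b a y hb ha hy ih =>
    obtain ⟨n, hn⟩ := h₂ b hb.2
    obtain ⟨m, hm⟩ := h₁ a ha.2
    obtain ⟨d, hd⟩ := ih
    refine ⟨max n (max m d), .cons b a y ⟨hb.1, fun h => hn ?_⟩ ⟨ha.1, fun h => hm ?_⟩
      (hd.mono φ (fun a ha => ⟨ha.1, fun h => ha.2 ?_⟩) (fun a ha => ⟨ha.1, fun h => ha.2 ?_⟩))⟩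
    · exact derivedSeries_antitone (G := G₂) (le_max_left _ _) h
    · exact derivedSeries_antitone (G := G₁) (le_trans (le_max_left _ _) (le_max_right _ _)) h
    · exact derivedSeries_antitone (G := G₁) (le_trans (le_max_right _ _) (le_max_right _ _)) h
    · exact derivedSeries_antitone (G := G₂) (le_trans (le_max_right _ _) (le_max_right _ _)) h

end AmalAPI

section Rep

open scoped commutatorElement

open Polynomial

/-- If a group maps to units of a polynomial ring with the `c`-th derived subgroup
congruent to one modulo `X`, then the further terms are congruent to one modulo powers of `X`. -/
theorem derived_dvd {A : Type*} [Group A] {E : Type*} [Ring E] (ρ : A →* (E[X])ˣ) (c : ℕ)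
    (h : ∀ g ∈ derivedSeries A c, (X : E[X]) ∣ (ρ g : E[X]) - 1) (j : ℕ) :
    ∀ g ∈ derivedSeries A (c + j), (X : E[X]) ^ (j + 1) ∣ (ρ g : E[X]) - 1 := by
  induction j with
  | zero => simpa using h
  | succ j ih =>
    let K : Subgroup A :=
      { carrier := {g | (X : E[X]) ^ (j + 1 + 1) ∣ (ρ g : E[X]) - 1}
        one_mem' := by simp
        mul_mem' := by
          intro a b ha hb
          have e : (ρ (a * b) : E[X]) - 1 = ((ρ a : E[X]) - 1) * ρ b + ((ρ b : E[X]) - 1) := by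
            rw [map_mul, Units.val_mul]; noncomm_ring
          change (X : E[X]) ^ (j + 1 + 1) ∣ (ρ (a * b) : E[X]) - 1
          rw [e]
          exact dvd_add (Dvd.dvd.mul_right ha _) hb
        inv_mem' := by
          intro a ha
          have e : (ρ a⁻¹ : E[X]) - 1 = ((ρ a : E[X]) - 1) * (-(ρ a⁻¹ : E[X])) := by
            have : (ρ a : E[X]) * (ρ a⁻¹ : E[X]) = 1 := by
              rw [← Units.val_mul, ← map_mul]; simp
            rw [sub_mul, mul_neg, this]; noncomm_ring
          change (X : E[X]) ^ (j + 1 + 1) ∣ (ρ a⁻¹ : E[X]) - 1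
          rw [e]
          exact Dvd.dvd.mul_right ha _ }
    have : derivedSeries A (c + (j + 1)) ≤ K := by
      rw [← add_assoc, derivedSeries_succ, Subgroup.commutator_le]
      intro a ha b hb
      obtain ⟨p, hp⟩ := ih a ha
      obtain ⟨q, hq⟩ := ih b hb
      change (X : E[X]) ^ (j + 1 + 1) ∣ (ρ ⁅a, b⁆ : E[X]) - 1
      have e : (ρ ⁅a, b⁆ : E[X]) - 1 =
          (((ρ a : E[X]) - 1) * ((ρ b : E[X]) - 1) - ((ρ b : E[X]) - 1) * ((ρ a : E[X]) - 1))
            * ((ρ a⁻¹ : E[X]) * (ρ b⁻¹ : E[X])) := by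
        have h1 : (ρ b : E[X]) * ρ a * ((ρ a⁻¹ : E[X]) * (ρ b⁻¹ : E[X])) = 1 := by
          simp only [← Units.val_mul, ← map_mul]; simp [mul_assoc]
        have h2 : ((ρ a : E[X]) - 1) * ((ρ b : E[X]) - 1)
            - ((ρ b : E[X]) - 1) * ((ρ a : E[X]) - 1) = (ρ a : E[X]) * ρ b - ρ b * ρ a := by
          noncomm_ring
        rw [h2, sub_mul, h1, commutatorElement_def]
        simp only [map_mul, Units.val_mul, mul_assoc]
      rw [e]
      apply Dvd.dvd.mul_right
      have hX : ∀ p q : E[X], (X : E[X]) ^ (j + 1 + 1) ∣ (X ^ (j + 1) * p) * (X ^ (j + 1) * q) := by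
        intro p q
        refine ⟨X ^ j * (p * q), ?_⟩
        have : p * X ^ (j + 1) = X ^ (j + 1) * p := (X_pow_mul).symm
        rw [mul_assoc, ← mul_assoc p, this, ← mul_assoc, ← mul_assoc, ← mul_assoc, ← pow_add,
          ← pow_add, mul_assoc]
        congr 2
        ring
      rw [hp, hq]
      exact dvd_sub (hX _ _) (hX _ _)
    exact fun g hg => this hg

variable {A S : Type*} [Group A] [MulAction A S]

/-- permutation representation on functions -/
noncomputable def lam (A S : Type*) [Group A] [MulAction A S] : A →* Module.End ℤ (S → ℤ) where
  toFun g := LinearMap.funLeft ℤ ℤ (fun s => g⁻¹ • s)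
  map_one' := by ext; simp [LinearMap.funLeft]
  map_mul' a b := by
    apply LinearMap.ext
    intro f
    funext s
    simp [LinearMap.funLeft, mul_smul]

theorem lam_apply (g : A) (f : S → ℤ) (s : S) : lam A S g f s = f (g⁻¹ • s) := rfl

open Classical in
noncomputable def opT (s₀ : S) : Module.End ℤ (S → ℤ) where
  toFun f := fun s => if s = s₀ then 0 else f s₀
  map_add' f g := by funext s; by_cases h : s = s₀ <;> simp [h]
  map_smul' f g := by funext s; by_cases h : s = s₀ <;> simp [h]

open Classical in
theorem opT_apply (s₀ : S) (f : S → ℤ) (s : S) :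
    opT s₀ f s = if s = s₀ then 0 else f s₀ := rfl

theorem opT_sq (s₀ : S) : opT s₀ * opT s₀ = 0 := by
  apply LinearMap.ext
  intro f
  funext s
  simp [opT_apply]

theorem opT_comm (s₀ : S) (h : A) (hh : h • s₀ = s₀) : opT s₀ * lam A S h = lam A S h * opT s₀ := by
  have hh' : h⁻¹ • s₀ = s₀ := by rw [inv_smul_eq_iff, hh]
  apply LinearMap.ext
  intro f
  funext s
  have : h⁻¹ • s = s₀ ↔ s = s₀ := by rw [inv_smul_eq_iff, hh]
  by_cases hs : s = s₀
  · simp [opT_apply, lam_apply, hs, hh']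
  · simp [opT_apply, lam_apply, hs, hh', mt this.1 hs]

theorem opT_move (s₀ : S) (a : A) (ha : a • s₀ ≠ s₀) :
    opT s₀ * lam A S a * opT s₀ = opT s₀ := by
  have : ¬ (a⁻¹ • s₀ = s₀) := by rw [inv_smul_eq_iff]; exact fun h => ha h.symm
  apply LinearMap.ext
  intro f
  funext s
  simp [opT_apply, lam_apply, this]

theorem opT_ne (s₀ : S) (a : A) (ha : a • s₀ ≠ s₀) : opT s₀ ≠ 0 := by
  intro h
  have := congrFun (LinearMap.congr_fun h (fun _ => 1)) (a • s₀)
  simp [opT_apply, ha] at this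

noncomputable def unitT (s₀ : S) : ((Module.End ℤ (S → ℤ))[X])ˣ where
  val := 1 + C (opT s₀) * X
  inv := 1 - C (opT s₀) * X
  val_inv := by
    have : (C (opT s₀) * X) * (C (opT s₀) * X) = 0 := by
      rw [mul_assoc, ← mul_assoc X, X_mul_C, mul_assoc, ← mul_assoc, ← C_mul, opT_sq]; simp
    rw [add_mul, mul_sub, mul_sub, this]; simp
  inv_val := by
    have : (C (opT s₀) * X) * (C (opT s₀) * X) = 0 := by
      rw [mul_assoc, ← mul_assoc X, X_mul_C, mul_assoc, ← mul_assoc, ← C_mul, opT_sq]; simp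
    rw [sub_mul, mul_add, mul_add, this]; simp

noncomputable def rhoOne (A S : Type*) [Group A] [MulAction A S] :
    A →* ((Module.End ℤ (S → ℤ))[X])ˣ :=
  (Units.map (C : _ →+* (Module.End ℤ (S → ℤ))[X]).toMonoidHom).comp (lam A S).toHomUnits

theorem rhoOne_val (a : A) : (rhoOne A S a : (Module.End ℤ (S → ℤ))[X]) = C (lam A S a) := rfl

noncomputable def rhoTwo (A : Type*) {S : Type*} [Group A] [MulAction A S] (s₀ : S) :
    A →* ((Module.End ℤ (S → ℤ))[X])ˣ :=
  (MulAut.conj (unitT s₀)).toMonoidHom.comp (rhoOne A S)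

theorem rhoTwo_val (s₀ : S) (a : A) : (rhoTwo A s₀ a : (Module.End ℤ (S → ℤ))[X]) =
    (1 + C (opT s₀) * X) * C (lam A S a) * (1 - C (opT s₀) * X) := rfl

theorem conj_expand {E : Type*} [Ring E] (T L : E) :
    (1 + C T * X) * C L * (1 - C T * X) =
    C L + C (T * L - L * T) * X + C (-(T * L * T)) * X ^ 2 := by
  have hX : ∀ p : E[X], X * p = p * X := fun p => X_mul
  have e1 : C T * X * C L = C T * C L * X := by
    rw [mul_assoc, hX, ← mul_assoc]
  have e2 : C T * C L * X * (C T * X) = C T * C L * C T * (X * X) := by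
    rw [mul_assoc _ X, ← mul_assoc X, hX]; simp only [mul_assoc]
  simp only [add_mul, mul_sub, one_mul, mul_one, C_sub, C_neg, C_mul, sub_mul, neg_mul, pow_two]
  rw [e1, e2]
  simp only [mul_assoc]
  abel

theorem coeff_two_expand {E : Type*} [Ring E] (p q r : E) :
    (C p + C q * X + C r * X ^ 2 : E[X]).coeff 2 = r := by
  simp [coeff_C, coeff_X]

theorem rhoTwo_eq (s₀ : S) (a : A) : (rhoTwo A s₀ a : (Module.End ℤ (S → ℤ))[X]) =
    C (lam A S a) + C (opT s₀ * lam A S a - lam A S a * opT s₀) * X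
      + C (-(opT s₀ * lam A S a * opT s₀)) * X ^ 2 := by
  rw [rhoTwo_val]
  exact conj_expand _ _

theorem rhoTwo_deg (s₀ : S) (a : A) :
    (rhoTwo A s₀ a : (Module.End ℤ (S → ℤ))[X]).natDegree ≤ 2 := by
  rw [rhoTwo_eq]
  compute_degree

theorem rhoTwo_coeff (s₀ : S) (a : A) (ha : a • s₀ ≠ s₀) :
    (rhoTwo A s₀ a : (Module.End ℤ (S → ℤ))[X]).coeff 2 = - opT s₀ := by
  rw [rhoTwo_eq, opT_move s₀ a ha]
  exact coeff_two_expand _ _ _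

theorem rhoTwo_coeff_zero (s₀ : S) (a : A) :
    (rhoTwo A s₀ a : (Module.End ℤ (S → ℤ))[X]).coeff 0 = lam A S a := by
  rw [rhoTwo_eq]
  simp

theorem rhoTwo_fix (s₀ : S) (a : A) (ha : a • s₀ = s₀) : rhoTwo A s₀ a = rhoOne A S a := by
  apply Units.ext
  rw [rhoTwo_eq, opT_comm s₀ a ha, mul_assoc, opT_sq, rhoOne_val]
  simp

end Rep

section Main

open Polynomial

variable {G₁ : Type u} {G₂ : Type v} [Group G₁] [Group G₂]
  {H₁ : Subgroup G₁} {H₂ : Subgroup G₂} (φ : H₁ ≃* H₂)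

theorem Tail.lead {S : Type*} [MulAction (Amal H₁ H₂ φ) S] (s₀ : S)
    (ρ : Amal H₁ H₂ φ →* ((Module.End ℤ (S → ℤ))[X])ˣ)
    (hρ₁ : ∀ g, ρ (Amal.inl φ g) = rhoOne _ S (Amal.inl φ g))
    (hρ₂ : ∀ g, ρ (Amal.inr φ g) = rhoTwo _ s₀ (Amal.inr φ g)) {y : Amal H₁ H₂ φ}
    (hy : Tail φ (fun a => Amal.inl φ a • s₀ ≠ s₀) (fun b => Amal.inr φ b • s₀ ≠ s₀) y) :
    opT s₀ ≠ 0 ∧ ∃ m > 0, ∃ w : (Module.End ℤ (S → ℤ))ˣ,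
      (ρ y : (Module.End ℤ (S → ℤ))[X]).natDegree ≤ m ∧
      (ρ y : (Module.End ℤ (S → ℤ))[X]).coeff m = opT s₀ * w := by
  have aux : ∀ b a, Amal.inr φ b • s₀ ≠ s₀ →
      (ρ (Amal.inr φ b * Amal.inl φ a) : (Module.End ℤ (S → ℤ))[X]).natDegree ≤ 2 ∧
      (ρ (Amal.inr φ b * Amal.inl φ a) : (Module.End ℤ (S → ℤ))[X]).coeff 2 =
        - (opT s₀ * lam _ S (Amal.inl φ a)) := by
    intro b a hb
    rw [map_mul, Units.val_mul, hρ₁, hρ₂, rhoOne_val]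
    refine ⟨(natDegree_mul_C_le _ _).trans (rhoTwo_deg _ _), ?_⟩
    rw [coeff_mul_C, rhoTwo_coeff _ _ hb, neg_mul]
  induction hy with
  | single b a hb =>
    refine ⟨opT_ne s₀ _ hb, 2, by norm_num, -(lam _ S).toHomUnits (Amal.inl φ a),
      (aux b a hb).1, ?_⟩
    rw [(aux b a hb).2]
    simp
  | cons b a y hb ha hy ih =>
    obtain ⟨hT, m, hm, w, hdeg, hco⟩ := ih
    refine ⟨hT, 2 + m, by omega, -w, ?_, ?_⟩
    · rw [map_mul, Units.val_mul]
      exact natDegree_mul_le_of_le (aux b a hb).1 hdeg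
    · rw [map_mul, Units.val_mul, coeff_mul_add_eq_of_natDegree_le (aux b a hb).1 hdeg,
        (aux b a hb).2, hco, neg_mul, ← mul_assoc, opT_move s₀ _ ha]
      simp

theorem not_mem_derived {N₁ : Subgroup G₁} {N₂ : Subgroup G₂} (d : ℕ)
    (L : Subgroup (Amal H₁ H₂ φ)) (hdL : derivedSeries (Amal H₁ H₂ φ) d ≤ L)
    (hHL : ∀ h : H₁, Amal.inl φ h ∈ L)
    (hL₁ : ∀ a ∈ N₁, Amal.inl φ a ∈ L → a ∈ derivedSeries G₁ d)
    (hL₂ : ∀ b ∈ N₂, Amal.inr φ b ∈ L → b ∈ derivedSeries G₂ d)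
    (g : G₁) {y : Amal H₁ H₂ φ}
    (hy : Tail φ (fun a => a ∈ N₁ ∧ a ∉ derivedSeries G₁ d)
      (fun b => b ∈ N₂ ∧ b ∉ derivedSeries G₂ d) y) :
    ∃ n, Amal.inl φ g * y ∉ derivedSeries (Amal H₁ H₂ φ) n := by
  let S := Amal H₁ H₂ φ ⧸ L
  let s₀ : S := ((1 : Amal H₁ H₂ φ) : Amal H₁ H₂ φ ⧸ L)
  have hfix : ∀ a : Amal H₁ H₂ φ, a • s₀ = s₀ ↔ a ∈ L := by
    intro a
    change ((a * 1 : Amal H₁ H₂ φ) : Amal H₁ H₂ φ ⧸ L) = ((1 : Amal H₁ H₂ φ) : _ ⧸ L) ↔ _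
    rw [QuotientGroup.eq]
    simp
  have htriv : ∀ a ∈ derivedSeries (Amal H₁ H₂ φ) d, ∀ s : S, a • s = s := by
    intro a ha s
    obtain ⟨z, rfl⟩ := QuotientGroup.mk_surjective s
    change ((a * z : Amal H₁ H₂ φ) : Amal H₁ H₂ φ ⧸ L) = (z : _ ⧸ L)
    rw [QuotientGroup.eq]
    apply hdL
    have := (derivedSeries_normal (Amal H₁ H₂ φ) d).conj_mem a⁻¹ (inv_mem ha) z⁻¹
    simpa [mul_assoc] using this
  obtain ⟨ρ, hρ₁, hρ₂⟩ := Amal.exists_lift φ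
    ((rhoOne (Amal H₁ H₂ φ) S).comp (Amal.inl φ)) ((rhoTwo (Amal H₁ H₂ φ) s₀).comp (Amal.inr φ))
    (by
      intro h
      simp only [MonoidHom.comp_apply]
      rw [← Amal.glue, rhoTwo_fix _ _ ((hfix _).2 (hHL h))])
  have hy' : Tail φ (fun a => Amal.inl φ a • s₀ ≠ s₀) (fun b => Amal.inr φ b • s₀ ≠ s₀) y :=
    hy.mono φ (fun a ha h => ha.2 (hL₁ a ha.1 ((hfix _).1 h)))
      (fun a ha h => ha.2 (hL₂ a ha.1 ((hfix _).1 h)))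
  obtain ⟨hT, m, hm, w, hdeg, hco⟩ := hy'.lead φ s₀ ρ hρ₁ hρ₂
  have hzero : ∀ x, (ρ x : (Module.End ℤ (S → ℤ))[X]).coeff 0 = lam _ S x := by
    intro x
    induction x using Amal.ind with
    | one => simp
    | hl g x ih =>
      rw [map_mul, Units.val_mul, mul_coeff_zero, ih, hρ₁, map_mul, MonoidHom.comp_apply,
        rhoOne_val, coeff_C_zero]
    | hr g x ih =>
      rw [map_mul, Units.val_mul, mul_coeff_zero, ih, hρ₂, map_mul, MonoidHom.comp_apply,
        rhoTwo_coeff_zero]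
  refine ⟨d + m, fun hx => ?_⟩
  have hdvd := derived_dvd ρ d (by
    intro a ha
    rw [X_dvd_iff, coeff_sub, hzero, coeff_one_zero, sub_eq_zero]
    apply LinearMap.ext
    intro f
    funext s
    rw [lam_apply, htriv _ (inv_mem ha)]
    rfl) m _ hx
  rw [X_pow_dvd_iff] at hdvd
  have h0 := hdvd m (by omega)
  rw [coeff_sub, coeff_one, if_neg hm.ne', sub_zero, map_mul, Units.val_mul, hρ₁,
    MonoidHom.comp_apply, rhoOne_val, coeff_C_mul, hco] at h0
  apply hT
  have h1 : IsUnit (lam _ S (Amal.inl φ g)) := ((lam _ S).toHomUnits (Amal.inl φ g)).isUnit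
  rw [h1.mul_right_eq_zero, w.isUnit.mul_left_eq_zero] at h0
  exact h0

end Main

/-- **Corollary.** If `G₁ = H₁ ⋉ N₁` and `G₂ = H₂ ⋉ N₂` are residually solvable groups with
internal semidirect product decompositions and `φ : H₁ ≅ H₂`, then the amalgamated free
product `G₁ ∗_φ G₂` is residually solvable. -/
theorem residuallySolvable_amalgam {G₁ : Type u} {G₂ : Type u}
    [Group G₁] [Group G₂]
    (hG₁ : ResiduallySolvable G₁) (hG₂ : ResiduallySolvable G₂)
    (H₁ : Subgroup G₁) (H₂ : Subgroup G₂)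
    (N₁ : Subgroup G₁) (N₂ : Subgroup G₂) (hN₁ : N₁.Normal) (hN₂ : N₂.Normal)
    (hd₁ : H₁ ⊓ N₁ = ⊥) (hd₂ : H₂ ⊓ N₂ = ⊥)
    (ht₁ : H₁ ⊔ N₁ = ⊤) (ht₂ : H₂ ⊔ N₂ = ⊤)
    (φ : H₁ ≃* H₂) :
    ResiduallySolvable (Amal H₁ H₂ φ) := by

  rw [resSolv_iff] at hG₁ hG₂ ⊢
  obtain ⟨r₁, hr₁, hr₁'⟩ := exists_retract hN₁ hd₁ ht₁
  obtain ⟨r₂, hr₂, hr₂'⟩ := exists_retract hN₂ hd₂ ht₂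
  obtain ⟨π₁, hπ₁l, hπ₁r⟩ := Amal.exists_lift φ (MonoidHom.id G₁)
    (H₁.subtype.comp (φ.symm.toMonoidHom.comp r₂)) (by intro h; simp [hr₂])
  obtain ⟨π₂, hπ₂l, hπ₂r⟩ := Amal.exists_lift φ
    (H₂.subtype.comp (φ.toMonoidHom.comp r₁)) (MonoidHom.id G₂) (by intro h; simp [hr₁])
  have hmap : ∀ {K K' : Type u} [Group K] [Group K'] (f : K →* K') (n : ℕ) (x : K),
      x ∈ derivedSeries K n → f x ∈ derivedSeries K' n := fun f n x hx =>
    map_derivedSeries_le_derivedSeries f n (Subgroup.mem_map_of_mem f hx)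
  intro x hx
  obtain ⟨g, y, rfl, hy⟩ := exists_form φ hN₁ hN₂ ht₁ ht₂ x
  rcases hy with rfl | hy
  · have hg : g ≠ 1 := by rintro rfl; simp at hx
    obtain ⟨n, hn⟩ := hG₁ g hg
    refine ⟨n, fun h => hn ?_⟩
    have := hmap π₁ n _ h
    simpa [hπ₁l] using this
  · obtain ⟨d, hd⟩ := hy.bound φ hG₁ hG₂
    -- an element of the base times a derived element, killed by the retraction, is derived
    have key : ∀ z ∈ H₁.map (Amal.inl φ) ⊔ derivedSeries (Amal H₁ H₂ φ) d,
        r₁ (π₁ z) = 1 → z ∈ derivedSeries (Amal H₁ H₂ φ) d := by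
      intro z hz hz1
      have := derivedSeries_normal (Amal H₁ H₂ φ) d
      obtain ⟨u, hu, v, hv, rfl⟩ := Subgroup.mem_sup_of_normal_right.1 hz
      obtain ⟨h, hh, rfl⟩ := hu
      refine mul_mem ?_ hv
      rw [map_mul, map_mul, hπ₁l] at hz1
      have e : r₁ (MonoidHom.id G₁ h) = ⟨h, hh⟩ := hr₁ ⟨h, hh⟩
      rw [e] at hz1
      have h2 : (⟨h, hh⟩ : H₁) ∈ derivedSeries H₁ d := by
        rw [eq_inv_of_mul_eq_one_left hz1]
        exact inv_mem (hmap r₁ d _ (hmap π₁ d _ hv))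
      exact hmap ((Amal.inl φ).comp H₁.subtype) d _ h2
    refine not_mem_derived (N₁ := N₁) (N₂ := N₂) φ d
      (H₁.map (Amal.inl φ) ⊔ derivedSeries (Amal H₁ H₂ φ) d) le_sup_right
      (fun h => Subgroup.mem_sup_left (Subgroup.mem_map_of_mem _ h.2)) ?_ ?_ g hd
    · intro a ha haL
      have := hmap π₁ d _ (key _ haL (by rw [hπ₁l]; exact hr₁' a ha))
      simpa [hπ₁l] using this
    · intro b hb hbL
      have := hmap π₂ d _ (key _ hbL (by rw [hπ₁r]; simp [hr₂' b hb]))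
      simpa [hπ₂r] using this
end

section
/- For every integer k ≥ 2 and every ε > 0 there exists C > 0 such that for all positive integers n, p, q with n ≥ Cp and p ≥ Cq there exists a permutation f of ℤ/nℤ with f^k = id and f(x+p) = f(x) + q for at least (1−ε)n elements x ∈ ℤ/nℤ. -/
/-- Rotation of the coordinates of a vector. -/
def rotVec (t : ℕ) (T : Type) : Equiv.Perm (Fin (t + 2) → T) where
  toFun v := fun i => v (i - 1)
  invFun v := fun i => v (i + 1)
  left_inv v := by funext i; simp
  right_inv v := by funext i; simp

theorem rotVec_pow_apply (t : ℕ) (T : Type) (m : ℕ) (v : Fin (t + 2) → T) (i : Fin (t + 2)) :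
    ((rotVec t T) ^ m) v i = v (i - m • (1 : Fin (t + 2))) := by
  induction m generalizing i with
  | zero => simp
  | succ m ih =>
    rw [pow_succ', Equiv.Perm.mul_apply]
    change ((rotVec t T) ^ m) v (i - 1) = _
    rw [ih]
    congr 1
    rw [succ_nsmul', sub_sub]

theorem rotVec_pow (t : ℕ) (T : Type) : (rotVec t T) ^ (t + 2) = 1 := by
  ext v i
  rw [rotVec_pow_apply]
  have : (t + 2) • (1 : Fin (t + 2)) = 0 := by
    have h := card_nsmul_eq_zero (x := (1 : Fin (t + 2)))
    rwa [Fintype.card_fin] at h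
  rw [this]; simp

/-- The rotation on the last factor of a product. -/
def rotProd (J : Type) (t : ℕ) (T : Type) : Equiv.Perm (J × (Fin (t + 2) → T)) :=
  Equiv.prodCongr (Equiv.refl J) (rotVec t T)

theorem rotProd_pow_apply (J : Type) (t : ℕ) (T : Type) (m : ℕ) (x : J × (Fin (t + 2) → T)) :
    ((rotProd J t T) ^ m) x = (x.1, ((rotVec t T) ^ m) x.2) := by
  induction m generalizing x with
  | zero => simp
  | succ m ih =>
    rw [pow_succ', pow_succ', Equiv.Perm.mul_apply, ih]
    rfl

theorem rotProd_pow (J : Type) (t : ℕ) (T : Type) : (rotProd J t T) ^ (t + 2) = 1 := by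
  ext1 x
  rw [rotProd_pow_apply, rotVec_pow]
  rfl

/-- The position of a point of a box. -/
def boxPos (p q A B t l : ℕ)
    (x : (Fin A × Fin B × Fin q) × (Fin (t + 2) → Fin (l + 1))) : ℕ :=
  ((x.1.1.val * (l + 1) ^ t + (finFunctionFinEquiv (fun i : Fin t => x.2 i.succ.succ)).val)
      * (l + 1) + (x.2 0).val) * p
    + ((x.1.2.1.val * (l + 1) + (x.2 1).val) * q + x.1.2.2.val)

theorem mixed_lt {x X y r : ℕ} (hx : x < X) (hy : y < r) : x * r + y < X * r := by
  calc x * r + y < x * r + r := by omega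
    _ = (x + 1) * r := by ring
    _ ≤ X * r := Nat.mul_le_mul_right _ hx

theorem mixed_inj {x x' y y' r : ℕ} (hy : y < r) (hy' : y' < r)
    (h : x * r + y = x' * r + y') : x = x' ∧ y = y' := by
  have hr : 0 < r := by omega
  have h1 := congrArg (· / r) h
  have h2 := congrArg (· % r) h
  simp only [mul_comm _ r, Nat.mul_add_div hr, Nat.mul_add_mod, Nat.div_eq_of_lt hy,
    Nat.div_eq_of_lt hy', Nat.mod_eq_of_lt hy, Nat.mod_eq_of_lt hy'] at h1 h2
  exact ⟨by simpa using h1, h2⟩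

theorem boxLow_lt {p q A B t l : ℕ} (hB : B * (l + 1) * q ≤ p)
    (x : (Fin A × Fin B × Fin q) × (Fin (t + 2) → Fin (l + 1))) :
    (x.1.2.1.val * (l + 1) + (x.2 1).val) * q + x.1.2.2.val < p :=
  lt_of_lt_of_le (mixed_lt (mixed_lt x.1.2.1.isLt (x.2 1).isLt) x.1.2.2.isLt) hB

theorem boxPos_lt {n p q A B t l : ℕ} (hB : B * (l + 1) * q ≤ p)
    (hA : A * (l + 1) ^ t * (l + 1) * p ≤ n)
    (x : (Fin A × Fin B × Fin q) × (Fin (t + 2) → Fin (l + 1))) :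
    boxPos p q A B t l x < n :=
  lt_of_lt_of_le (mixed_lt (mixed_lt (mixed_lt x.1.1.isLt (Fin.isLt _)) (x.2 0).isLt)
    (boxLow_lt hB x)) hA

theorem boxPos_inj {p q A B t l : ℕ} (hB : B * (l + 1) * q ≤ p) :
    Function.Injective (boxPos p q A B t l) := by
  intro x y h
  obtain ⟨h1, h2⟩ := mixed_inj (boxLow_lt hB x) (boxLow_lt hB y) h
  obtain ⟨h3, h4⟩ := mixed_inj (x.2 0).isLt (y.2 0).isLt h1
  obtain ⟨h5, h6⟩ := mixed_inj (Fin.isLt _) (Fin.isLt _) h3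
  obtain ⟨h7, h8⟩ := mixed_inj x.1.2.2.isLt y.1.2.2.isLt h2
  obtain ⟨h9, h10⟩ := mixed_inj (x.2 1).isLt (y.2 1).isLt h7
  have h11 := finFunctionFinEquiv.injective (Fin.ext h6)
  obtain ⟨⟨a, b, c⟩, v⟩ := x
  obtain ⟨⟨a', b', c'⟩, v'⟩ := y
  have hv : v = v' := by
    funext i
    refine Fin.cases (Fin.ext h4) (fun j => ?_) i
    refine Fin.cases (Fin.ext h10) (fun j => congrFun h11 j) j
  have ha : a = a' := Fin.ext h5
  have hb : b = b' := Fin.ext h9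
  have hc : c = c' := Fin.ext h8
  rw [hv, ha, hb, hc]

theorem boxPos_step_p {p q A B t l : ℕ} (j : Fin A × Fin B × Fin q) (a : Fin l)
    (w : Fin (t + 1) → Fin (l + 1)) :
    boxPos p q A B t l (j, Fin.cons a.succ w)
      = boxPos p q A B t l (j, Fin.cons a.castSucc w) + p := by
  have h1 : ∀ b : Fin (l + 1), (Fin.cons b w : Fin (t + 2) → Fin (l + 1)) 1 = w 0 := fun b => rfl
  simp only [boxPos, Fin.cons_zero, Fin.cons_succ, h1, Fin.val_succ, Fin.val_castSucc]
  ring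

theorem boxPos_step_q {p q A B t l : ℕ} (j : Fin A × Fin B × Fin q) (a : Fin l)
    (w : Fin (t + 1) → Fin (l + 1)) :
    boxPos p q A B t l (rotProd _ t _ (j, Fin.cons a.succ w))
      = boxPos p q A B t l (rotProd _ t _ (j, Fin.cons a.castSucc w)) + q := by
  have h0 : ∀ b : Fin (l + 1),
      rotVec t (Fin (l + 1)) (Fin.cons b w) 0 = w (Fin.last t) := by
    intro b
    change (Fin.cons b w : Fin (t + 2) → Fin (l + 1)) (0 - 1) = _
    have : (0 - 1 : Fin (t + 2)) = (Fin.last t).succ := by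
      rw [sub_eq_iff_eq_add, Fin.succ_last]; simp
    rw [this, Fin.cons_succ]
  have h1 : ∀ b : Fin (l + 1), rotVec t (Fin (l + 1)) (Fin.cons b w) 1 = b := by
    intro b
    change (Fin.cons b w : Fin (t + 2) → Fin (l + 1)) (1 - 1) = _
    rw [sub_self, Fin.cons_zero]
  have h2 : ∀ (b : Fin (l + 1)) (i : Fin t),
      rotVec t (Fin (l + 1)) (Fin.cons b w) i.succ.succ = w i.castSucc := by
    intro b i
    change (Fin.cons b w : Fin (t + 2) → Fin (l + 1)) (i.succ.succ - 1) = _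
    have : (i.succ.succ - 1 : Fin (t + 2)) = i.castSucc.succ := by
      rw [sub_eq_iff_eq_add, Fin.succ_castSucc, Fin.coeSucc_eq_succ]
    rw [this, Fin.cons_succ]
  change boxPos p q A B t l (j, rotVec t _ (Fin.cons a.succ w))
      = boxPos p q A B t l (j, rotVec t _ (Fin.cons a.castSucc w)) + q
  simp only [boxPos, h0, h1, h2, Fin.val_succ, Fin.val_castSucc]
  ring

theorem exists_perm_box (n p q A B t l : ℕ) (hn : 0 < n) (hB : B * (l + 1) * q ≤ p)
    (hA : A * (l + 1) ^ t * (l + 1) * p ≤ n) :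
    ∃ f : Equiv.Perm (ZMod n), f ^ (t + 2) = 1 ∧
      A * (B * q) * (l * (l + 1) ^ (t + 1)) ≤
        ({x : ZMod n | f (x + (p : ZMod n)) = f x + (q : ZMod n)}).ncard := by
  have : NeZero n := ⟨hn.ne'⟩
  have hinj : Function.Injective (fun x => ((boxPos p q A B t l x : ℕ) : ZMod n)) := by
    intro x y h
    apply boxPos_inj hB
    have h' := (ZMod.natCast_eq_natCast_iff' _ _ _).1 h
    rwa [Nat.mod_eq_of_lt (boxPos_lt hB hA x), Nat.mod_eq_of_lt (boxPos_lt hB hA y)] at h'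
  let e : ((Fin A × Fin B × Fin q) × (Fin (t + 2) → Fin (l + 1))) ↪ ZMod n := ⟨_, hinj⟩
  have he : ∀ x, e x = ((boxPos p q A B t l x : ℕ) : ZMod n) := fun x => rfl
  let g := rotProd (Fin A × Fin B × Fin q) t (Fin (l + 1))
  refine ⟨Equiv.Perm.viaEmbeddingHom e g, ?_, ?_⟩
  · rw [← map_pow, rotProd_pow, map_one]
  · let s : ((Fin A × Fin B × Fin q) × (Fin l × (Fin (t + 1) → Fin (l + 1)))) → ZMod n :=
      fun y => e (y.1, Fin.cons y.2.1.castSucc y.2.2)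
    have hs : Function.Injective s := by
      rintro ⟨j, a, w⟩ ⟨j', a', w'⟩ h
      have h1 := e.injective h
      simp only [Prod.mk.injEq] at h1
      obtain ⟨h1, h2⟩ := h1
      obtain ⟨h3, h4⟩ := Fin.cons_inj.1 h2
      rw [h1, h4, Fin.castSucc_injective _ h3]
    have hcard : (Set.range s).ncard = A * (B * q) * (l * (l + 1) ^ (t + 1)) := by
      rw [← Set.image_univ, Set.ncard_image_of_injective _ hs, Set.ncard_univ]
      simp
    rw [← hcard]
    apply Set.ncard_le_ncard _ (Set.toFinite _)
    rintro _ ⟨⟨j, a, w⟩, rfl⟩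
    have hp : s (j, a, w) + (p : ZMod n) = e (j, Fin.cons a.succ w) := by
      simp only [s, he, boxPos_step_p]
      push_cast
      rfl
    change Equiv.Perm.viaEmbedding g e (s (j, a, w) + (p : ZMod n))
      = Equiv.Perm.viaEmbedding g e (e (j, Fin.cons a.castSucc w)) + (q : ZMod n)
    rw [hp, Equiv.Perm.viaEmbedding_apply, Equiv.Perm.viaEmbedding_apply, he, he,
      boxPos_step_q]
    push_cast
    rfl

/-- **Theorem.** For every `k ≥ 2` and `ε > 0` there is `C > 0` such that for all positive
integers `n, p, q` with `n ≥ Cp` and `p ≥ Cq` there is a permutation `f` of `ℤ/nℤ` of order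
dividing `k` with `f(x+p) = f(x) + q` for at least `(1-ε)n` elements `x ∈ ℤ/nℤ`. -/
theorem exists_perm_translating (k : ℕ) (hk : 2 ≤ k) (ε : ℝ) (hε : 0 < ε) :
    ∃ C : ℝ, 0 < C ∧ ∀ n p q : ℕ, 0 < n → 0 < p → 0 < q →
      (n : ℝ) ≥ C * p → (p : ℝ) ≥ C * q →
      ∃ f : Equiv.Perm (ZMod n), f ^ k = 1 ∧
        (1 - ε) * n ≤
          (({x : ZMod n | f (x + (p : ZMod n)) = f x + (q : ZMod n)}).ncard : ℝ) := by
  obtain ⟨t, rfl⟩ : ∃ t, k = t + 2 := ⟨k - 2, by omega⟩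
  obtain ⟨l, hl⟩ := exists_nat_ge (3 / ε)
  have hL : (0 : ℝ) < (l : ℝ) + 1 := by positivity
  refine ⟨((l : ℝ) + 1) ^ t * ((l : ℝ) + 1) ^ 2, by positivity, ?_⟩
  intro n p q hn hp hq hnp hpq
  have hR1 : (1 : ℝ) ≤ ((l : ℝ) + 1) ^ t := one_le_pow₀ (by linarith [Nat.cast_nonneg (α := ℝ) l])
  have hM : 0 < (l + 1) ^ t * (l + 1) * p := by positivity
  have hN : 0 < (l + 1) * q := by positivity
  obtain ⟨f, hf, hc⟩ := exists_perm_box n p q (n / ((l + 1) ^ t * (l + 1) * p))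
    (p / ((l + 1) * q)) t l hn
    (by rw [mul_assoc]; exact Nat.div_mul_le_self _ _)
    (by
      have := Nat.div_mul_le_self n ((l + 1) ^ t * (l + 1) * p)
      simpa only [mul_assoc] using this)
  refine ⟨f, hf, ?_⟩
  have hA := (Nat.lt_div_mul_add hM (a := n)).le
  have hB := (Nat.lt_div_mul_add hN (a := p)).le
  generalize n / ((l + 1) ^ t * (l + 1) * p) = A at *
  generalize p / ((l + 1) * q) = B at *
  have hc' := (Nat.cast_le (α := ℝ)).2 hc
  refine le_trans ?_ hc'
  have hA' := (Nat.cast_le (α := ℝ)).2 hA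
  have hB' := (Nat.cast_le (α := ℝ)).2 hB
  push_cast at hA' hB' ⊢
  rw [pow_succ]
  have hl0 : (0 : ℝ) ≤ l := Nat.cast_nonneg l
  have hp0 : (0 : ℝ) < p := Nat.cast_pos.2 hp
  have hq0 : (0 : ℝ) < q := Nat.cast_pos.2 hq
  have hn0 : (0 : ℝ) < n := Nat.cast_pos.2 hn
  have hεL : 3 ≤ ε * ((l : ℝ) + 1) := by
    rw [div_le_iff₀ hε] at hl
    nlinarith
  generalize ((l : ℝ) + 1) ^ t = R at *
  obtain ⟨L, hLdef⟩ : ∃ L : ℝ, L = (l : ℝ) + 1 := ⟨_, rfl⟩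
  have hll : (l : ℝ) = L - 1 := by linarith
  rw [← hLdef] at hL hεL hnp hpq hA' hB' ⊢
  rw [hll]
  have hL1 : 1 ≤ L := by linarith
  have hA0 : (0 : ℝ) ≤ A := Nat.cast_nonneg A
  obtain ⟨X, hX⟩ : ∃ X : ℝ, X = A * R * L := ⟨_, rfl⟩
  obtain ⟨Y, hY⟩ : ∃ Y : ℝ, Y = B * L * q := ⟨_, rfl⟩
  have hX0 : 0 ≤ X := by rw [hX]; positivity
  -- `Y * L ≥ p * (L - 1)`
  have hY1 : p * (L - 1) ≤ Y * L := by
    have h1 : (p : ℝ) ≤ Y + L * q := by rw [hY]; linarith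
    have h2 : L ^ 2 * q ≤ p := by
      have : 1 * (L ^ 2 * q) ≤ R * (L ^ 2 * q) :=
        mul_le_mul_of_nonneg_right hR1 (by positivity)
      linarith
    nlinarith
  have hX1 : n * (L - 1) ≤ X * p * L := by
    have h1 : (n : ℝ) ≤ X * p + R * L * p := by rw [hX]; linarith
    nlinarith
  have h3 : n * (L - 1) ^ 2 ≤ X * Y * L ^ 2 := by
    calc n * (L - 1) ^ 2 = (n * (L - 1)) * (L - 1) := by ring
      _ ≤ (X * p * L) * (L - 1) := mul_le_mul_of_nonneg_right hX1 (by linarith)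
      _ = (X * L) * (p * (L - 1)) := by ring
      _ ≤ (X * L) * (Y * L) := mul_le_mul_of_nonneg_left hY1 (by positivity)
      _ = _ := by ring
  have h4 : n * (L - 1) ^ 3 ≤ X * Y * (L - 1) * L ^ 2 := by
    have := mul_le_mul_of_nonneg_right h3 (show 0 ≤ L - 1 by linarith)
    nlinarith
  have h5 : (1 - ε) * L ^ 3 ≤ (L - 1) ^ 3 := by
    nlinarith [mul_le_mul_of_nonneg_right hεL (sq_nonneg L)]
  have h6 : (1 - ε) * n * L ^ 3 ≤ X * Y * (L - 1) * L ^ 2 := by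
    have := mul_le_mul_of_nonneg_left h5 hn0.le
    linarith
  have h7 : X * Y * (L - 1) * L ^ 2 = (A * (B * q) * ((L - 1) * (R * L))) * L ^ 3 := by
    rw [hX, hY]; ring
  rw [h7] at h6
  exact le_of_mul_le_mul_right h6 (by positivity)
end

section
/- For every ε > 0 and every integer k ≥ 2 there exists an integer C such that for every integer n > C there exists a permutation f of (ℤ/nℤ)² with f^k = id whose coordinate functions f₁, f₂: (ℤ/nℤ)² → ℤ/nℤ, defined by f(x,y) = (f₁(x,y), f₂(x,y)), satisfy both f₁(x, y+1) = f₁(x,y) + f₂(x,y) and f₂(x, y+1) = f₂(x,y) for at least (1−ε)n² pairs (x,y) ∈ (ℤ/nℤ)². -/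
theorem heis_shift_pow (d m M : ℕ) :
    ∃ σ : Equiv.Perm ((Fin (d+2) → Fin m) × ZMod M), σ ^ (d+2) = 1 ∧
      ∀ u l, σ (u, l) = (fun t => u (t - 1), l) := by
  let σ : Equiv.Perm ((Fin (d+2) → Fin m) × ZMod M) :=
    { toFun := fun p => (fun t => p.1 (t - 1), p.2)
      invFun := fun p => (fun t => p.1 (t + 1), p.2)
      left_inv := by intro p; ext <;> simp
      right_inv := by intro p; ext <;> simp }
  have hσ : ∀ u l, σ (u, l) = (fun t => u (t - 1), l) := fun u l => rfl
  refine ⟨σ, ?_, hσ⟩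
  have key : ∀ (j : ℕ) u l, (σ ^ j) (u, l) = (fun t => u (t - j • (1 : Fin (d+2))), l) := by
    intro j
    induction j with
    | zero => intro u l; simp
    | succ j ih =>
      intro u l
      rw [pow_succ', Equiv.Perm.mul_apply, ih, hσ]
      refine Prod.ext ?_ rfl
      funext t
      simp only
      congr 1
      rw [succ_nsmul]
      abel
  ext1 ⟨u, l⟩
  rw [key]
  have h0 : (d+2) • (1 : Fin (d+2)) = 0 := by
    simpa using card_nsmul_eq_zero' (x := (1 : Fin (d+2)))
  simp [h0]

theorem heis_model (d m M : ℕ) :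
    ∃ F : Equiv.Perm ((Fin (d+2) → Fin m) × ZMod M), F ^ (d+2) = 1 ∧
      (∀ u l, (F (u, l)).1 = fun t => u (t - 1)) ∧
      ∀ u l (v : Fin m), (v : ℕ) = (u 0 : ℕ) + 1 →
        (F (Function.update u 0 v, l)).2 = (F (u, l)).2 + ((u (-1) : ℕ) : ZMod M) := by
  rcases Nat.eq_zero_or_pos d with rfl | hd
  · let F : Equiv.Perm ((Fin (0+2) → Fin m) × ZMod M) :=
      Function.Involutive.toPerm
        (fun p => (fun t => p.1 (t - 1), ((p.1 0 : ℕ) : ZMod M) * ((p.1 1 : ℕ) : ZMod M) - p.2))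
        (by
          rintro ⟨u, l⟩
          refine Prod.ext ?_ ?_
          · funext t
            simp only
            congr 1
            fin_cases t <;> rfl
          · have h0 : ((0 : Fin (0+2)) - 1) = 1 := rfl
            simp [h0]
            ring)
    have hF : ∀ u l, F (u, l) = (fun t => u (t - 1),
      ((u 0 : ℕ) : ZMod M) * ((u 1 : ℕ) : ZMod M) - l) := fun u l => rfl
    refine ⟨F, ?_, fun u l => by rw [hF], ?_⟩
    · ext1 p
      exact Function.Involutive.toPerm_involutive _ p
    · intro u l v hv
      rw [hF, hF]
      have h1 : (-1 : Fin (0+2)) = 1 := rfl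
      have h2 : (1 : Fin (0+2)) ≠ 0 := by decide
      simp only [Function.update_self, Function.update_of_ne h2, hv, h1]
      push_cast
      ring
  · obtain ⟨σ, hσ, hσa⟩ := heis_shift_pow d m M
    let h : (Fin (d+2) → Fin m) → ZMod M := fun u =>
      ((u 0 : ℕ) : ZMod M) * ((u 1 : ℕ) : ZMod M) + ((u 1 : ℕ) : ZMod M) * ((u 2 : ℕ) : ZMod M)
    let H : Equiv.Perm ((Fin (d+2) → Fin m) × ZMod M) :=
      { toFun := fun p => (p.1, p.2 + h p.1)
        invFun := fun p => (p.1, p.2 - h p.1)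
        left_inv := by intro p; simp
        right_inv := by intro p; simp }
    have hF : ∀ u l, (H * σ * H⁻¹) (u, l) = (fun t => u (t - 1), l - h u + h (fun t => u (t-1))) := by
      intro u l
      have : H⁻¹ (u, l) = (u, l - h u) := rfl
      rw [Equiv.Perm.mul_apply, this, Equiv.Perm.mul_apply, hσa]
      rfl
    refine ⟨H * σ * H⁻¹, ?_, fun u l => by rw [hF], ?_⟩
    · rw [conj_pow, hσ]; simp
    · intro u l v hv
      rw [hF, hF]
      have e1 : (1 : Fin (d+2)) ≠ 0 := by simp
      have e2 : (2 : Fin (d+2)) ≠ 0 := by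
        intro h
        have h2 := congrArg Fin.val h
        change 2 % (d + 2) = 0 % (d + 2) at h2
        rw [Nat.mod_eq_of_lt (show 2 < d + 2 by omega)] at h2
        simp at h2
      have e3 : (-1 : Fin (d+2)) ≠ 0 := by simp
      have e4 : (2 - 1 : Fin (d+2)) = 1 := by
        rw [sub_eq_iff_eq_add]
        apply Fin.ext
        change 2 % (d + 2) = (1 % (d+2) + 1 % (d+2)) % (d + 2)
        rw [← Nat.add_mod]
      simp only [h, zero_sub, sub_self, e4, Function.update_self, Function.update_of_ne e1,
        Function.update_of_ne e2, Function.update_of_ne e3, hv]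
      push_cast
      ring

/-- Assembling the permutation from a family of disjoint Heisenberg boxes. -/
theorem heis_assemble (d m n : ℕ) [NeZero n] (hm : 0 < m) (𝒯 : Finset (ZMod n × ZMod n))
    (hinj : ∀ b ∈ 𝒯, ∀ b' ∈ 𝒯, ∀ i < m, ∀ i' < m, ∀ j < m, ∀ j' < m, ∀ l < m^2, ∀ l' < m^2,
      ((b.1 + (j : ℕ) * b.2 + (l : ℕ), b.2 + (i : ℕ)) : ZMod n × ZMod n)
        = (b'.1 + (j' : ℕ) * b'.2 + (l' : ℕ), b'.2 + (i' : ℕ)) →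
      b = b' ∧ i = i' ∧ j = j' ∧ l = l') :
    ∃ f : Equiv.Perm (ZMod n × ZMod n), f ^ (d+2) = 1 ∧
      (𝒯.card / m^d) * (m^(d+2) * m^2) ≤ ({p : ZMod n × ZMod n |
              (f (p.1, p.2 + 1)).1 = (f p).1 + (f p).2 ∧
              (f (p.1, p.2 + 1)).2 = (f p).2}).ncard
              + (𝒯.card / m^d) * (m^(d+1) * m^2 + m^(d+2) * m) := by
  classical
  have : NeZero (m^2) := ⟨by positivity⟩
  obtain ⟨F, hFk, hF1, hF2⟩ := heis_model d m (m^2)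
  set K := 𝒯.card / m^d with hK
  obtain ⟨idx⟩ : Nonempty ((Fin K × (Fin d → Fin m)) ↪ 𝒯) := by
    apply Function.Embedding.nonempty_of_card_le
    simp
    exact Nat.div_mul_le_self _ _
  let U := (Fin (d+2) → Fin m) × ZMod (m^2)
  let ι₀ : Fin K × U → ZMod n × ZMod n := fun q =>
    let b := (idx (q.1, fun t => q.2.1 t.succ.succ)).1
    (b.1 + ((q.2.1 1 : ℕ) : ZMod n) * b.2 + ((q.2.2.val : ℕ) : ZMod n), b.2 + ((q.2.1 0 : ℕ) : ZMod n))
  have hι : Function.Injective ι₀ := by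
    rintro ⟨κ, u, l⟩ ⟨κ', u', l'⟩ h
    obtain ⟨h1, h2, h3, h4⟩ := hinj _ (idx (κ, fun t => u t.succ.succ)).2
      _ (idx (κ', fun t => u' t.succ.succ)).2 _ (u 0).2 _ (u' 0).2 _ (u 1).2 _ (u' 1).2
      _ (ZMod.val_lt l) _ (ZMod.val_lt l') h
    have h5 := idx.injective (Subtype.ext h1)
    rw [Prod.mk.injEq] at h5
    obtain ⟨rfl, h6⟩ := h5
    have h7 : u = u' := by
      funext t
      refine Fin.cases (Fin.ext h2) (fun t => ?_) t
      refine Fin.cases (Fin.ext h3) (fun t => ?_) t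
      exact congrFun h6 t
    have h8 : l = l' := ZMod.val_injective _ h4
    rw [h7, h8]
  let ι : Fin K × U ↪ ZMod n × ZMod n := ⟨ι₀, hι⟩
  let F' : Equiv.Perm (Fin K × U) := Equiv.prodCongrRight (fun _ => F)
  have hF' : ∀ κ p, F' (κ, p) = (κ, F p) := fun κ p => rfl
  have hFpow : ∀ (j : ℕ) κ p, (F' ^ j) (κ, p) = (κ, (F ^ j) p) := by
    intro j
    induction j with
    | zero => intro κ p; rfl
    | succ j ih => intro κ p; rw [pow_succ', Equiv.Perm.mul_apply, ih, hF', pow_succ' F,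
        Equiv.Perm.mul_apply]
  let f := F'.viaEmbedding ι
  have hf : ∀ q, f (ι q) = ι (F' q) := fun q => Equiv.Perm.viaEmbedding_apply F' ι q
  refine ⟨f, ?_, ?_⟩
  · have : f = Equiv.Perm.viaEmbeddingHom ι F' := rfl
    rw [this, ← map_pow]
    have : F' ^ (d+2) = 1 := by
      ext1 ⟨κ, p⟩
      rw [hFpow, hFk]; rfl
    rw [this, map_one]
  · let bad1 : Finset U := Finset.univ.filter (fun p => ¬ (p.1 0 : ℕ) + 1 < m)
    let bad2 : Finset U := Finset.univ.filter
      (fun p => ¬ (F p).2.val + (p.1 (-1) : ℕ) < m^2)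
    have c1 : bad1.card ≤ m^(d+1) * m^2 := by
      have : bad1.card ≤ (Finset.univ : Finset ((Fin (d+1) → Fin m) × ZMod (m^2))).card := by
        refine Finset.card_le_card_of_injOn (fun p => (fun t => p.1 t.succ, p.2)) (by simp) ?_
        rintro ⟨u, l⟩ hp ⟨u', l'⟩ hp' h
        simp only [bad1, Finset.coe_filter, Finset.mem_univ, true_and, Set.mem_ofPred_eq] at hp hp'
        rw [Prod.mk.injEq] at h
        refine Prod.ext ?_ h.2
        funext t
        refine Fin.cases (Fin.ext ?_) (fun t => congrFun h.1 t) t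
        have := (u 0).2
        have := (u' 0).2
        change (u 0 : ℕ) = u' 0
        omega
      simpa [ZMod.card] using this
    have c2 : bad2.card ≤ m^(d+2) * m := by
      have : bad2.card ≤ (Finset.univ ×ˢ Finset.range m : Finset ((Fin (d+2) → Fin m) × ℕ)).card := by
        refine Finset.card_le_card_of_injOn (fun p => ((F p).1, m^2 - 1 - (F p).2.val)) ?_ ?_
        · rintro p hp
          simp only [bad2, Finset.coe_filter, Finset.mem_univ, true_and, Set.mem_ofPred_eq] at hp
          simp
          have := (p.1 (-1)).2
          omega
        · intro p hp p' hp' h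
          rw [Prod.mk.injEq] at h
          apply F.injective
          refine Prod.ext h.1 (ZMod.val_injective _ ?_)
          have h1 := ZMod.val_lt (F p).2
          have h2 := ZMod.val_lt (F p').2
          have h3 := h.2
          omega
      simpa [Finset.card_product] using this
    let good : Finset U := Finset.univ.filter
      (fun p => (p.1 0 : ℕ) + 1 < m ∧ (F p).2.val + (p.1 (-1) : ℕ) < m^2)
    have c3 : m^(d+2) * m^2 ≤ good.card + (m^(d+1) * m^2 + m^(d+2) * m) := by
      have hcov : (Finset.univ : Finset U) ⊆ good ∪ (bad1 ∪ bad2) := by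
        intro p _
        simp only [good, bad1, bad2, Finset.mem_union, Finset.mem_filter, Finset.mem_univ, true_and]
        tauto
      have h0 := Finset.card_le_card hcov
      have hU : (Finset.univ : Finset U).card = m^(d+2) * m^2 := by
        simp [U, ZMod.card]
      rw [hU] at h0
      have h1 := Finset.card_union_le good (bad1 ∪ bad2)
      have h2 := Finset.card_union_le bad1 bad2
      omega
    have c4 : K * good.card ≤ ({p : ZMod n × ZMod n |
              (f (p.1, p.2 + 1)).1 = (f p).1 + (f p).2 ∧
              (f (p.1, p.2 + 1)).2 = (f p).2}).ncard := by
      have hc : (((Finset.univ : Finset (Fin K)) ×ˢ good).map ι).card = K * good.card := by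
        rw [Finset.card_map, Finset.card_product]; simp
      rw [← hc, ← Set.ncard_coe_finset]
      refine Set.ncard_le_ncard ?_ (Set.toFinite _)
      intro p hp
      rw [Finset.mem_coe, Finset.mem_map] at hp
      obtain ⟨⟨κ, u, l⟩, hq, rfl⟩ := hp
      simp only [good, Finset.mem_product, Finset.mem_filter, Finset.mem_univ, true_and] at hq
      obtain ⟨hq1, hq2⟩ := hq
      let v : Fin m := ⟨(u 0 : ℕ) + 1, hq1⟩
      let u' := Function.update u 0 v
      have e1 : (1 : Fin (d+2)) ≠ 0 := by simp
      have e3 : (-1 : Fin (d+2)) ≠ 0 := by simp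
      have hss : ∀ t : Fin d, t.succ.succ - 1 ≠ (0 : Fin (d+2)) := by
        intro t h
        rw [sub_eq_zero] at h
        have h2 : t.succ.succ = (Fin.succ 0 : Fin (d+2)) := h
        exact Fin.succ_ne_zero _ (Fin.succ_injective _ h2)
      have hS : ((ι (κ, u, l)).1, (ι (κ, u, l)).2 + 1) = ι (κ, u', l) := by
        change ((ι₀ (κ, u, l)).1, (ι₀ (κ, u, l)).2 + 1) = ι₀ (κ, u', l)
        have : (fun t : Fin d => u' t.succ.succ) = fun t => u t.succ.succ := by
          funext t
          exact Function.update_of_ne (Fin.succ_ne_zero _) _ _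
        simp only [ι₀, this]
        simp only [u', Function.update_self, Function.update_of_ne e1, v]
        refine Prod.ext rfl ?_
        push_cast
        exact add_assoc _ _ _
      have hT : ι (κ, F (u', l)) = ((ι (κ, F (u, l))).1 + (ι (κ, F (u, l))).2, (ι (κ, F (u, l))).2) := by
        change ι₀ (κ, F (u', l)) = ((ι₀ (κ, F (u, l))).1 + (ι₀ (κ, F (u, l))).2, (ι₀ (κ, F (u, l))).2)
        have hval : (F (u', l)).2.val = (F (u, l)).2.val + (u (-1) : ℕ) := by
          rw [hF2 u l v rfl, ← ZMod.natCast_zmod_val (F (u, l)).2, ← Nat.cast_add,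
            ZMod.val_natCast_of_lt hq2, ZMod.natCast_zmod_val]
        have : (fun t : Fin d => u' (t.succ.succ - 1)) = fun t => u (t.succ.succ - 1) := by
          funext t
          exact Function.update_of_ne (hss t) _ _
        simp only [ι₀, hF1, hval, this]
        simp only [u', sub_self, zero_sub, Function.update_self, Function.update_of_ne e3, v]
        refine Prod.ext ?_ rfl
        push_cast
        ring
      simp only [Set.mem_ofPred_eq]
      rw [hS, hf, hf, hF', hF', hT]
      exact ⟨rfl, rfl⟩
    have := Nat.mul_le_mul_left K c3
    rw [mul_add] at this
    omega

/-- Row packing: if every orbit hits the interval `I` quickly, most of the row is tiled. -/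
theorem heis_row (n : ℕ) [NeZero n] (y : ZMod n) (m M B H : ℕ) (hm : 0 < m) (hM : 0 < M)
    (hB : B * M ≤ n)
    (hit : ∀ x : ZMod n, ∃ s ≤ H, ∃ v < B * M, x - (s : ZMod n) * y = ((v : ℕ) : ZMod n)) :
    ∃ E : Finset (ZMod n),
      (∀ x ∈ E, ∀ x' ∈ E, ∀ j < m, ∀ j' < m, ∀ l < M, ∀ l' < M,
        x + (j : ℕ) * y + (l : ℕ) = x' + (j' : ℕ) * y + (l' : ℕ) → x = x' ∧ j = j' ∧ l = l') ∧
      n ≤ E.card * (m * M) + (B * M * m + 2 * M * (H + m + 1)) := by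
  classical
  -- good pairs
  let good : ℕ → ℕ → Prop := fun β τ => ∀ l < M, ∀ t, 1 ≤ t → t < (τ + 1) * m →
    ∀ v < B * M, ((β * M + l : ℕ) : ZMod n) + (t : ZMod n) * y ≠ ((v : ℕ) : ZMod n)
  let P : Finset (ℕ × ℕ) := (Finset.range B ×ˢ Finset.range (H + 1)).filter
    (fun p => good p.1 p.2)
  let base : ℕ × ℕ → ZMod n := fun p => ((p.1 * M : ℕ) : ZMod n) + ((p.2 * m : ℕ) : ZMod n) * y
  have hlt : ∀ β < B, ∀ l < M, β * M + l < B * M := by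
    intro β hβ l hl
    calc β * M + l < β * M + M := by omega
      _ = (β + 1) * M := by ring
      _ ≤ B * M := Nat.mul_le_mul_right _ hβ
  -- one-sided uniqueness
  have time_le : ∀ b < B * M, ∀ β τ l, l < M → good β τ → ∀ t t' : ℕ, t' < (τ + 1) * m →
      ((b : ℕ) : ZMod n) + (t : ZMod n) * y = ((β * M + l : ℕ) : ZMod n) + (t' : ZMod n) * y →
      t' ≤ t := by
    intro b hb β τ l hl hg t t' ht' heq
    by_contra hlt'
    push Not at hlt'
    obtain ⟨r, rfl⟩ := Nat.exists_eq_add_of_lt hlt'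
    refine hg l hl (r + 1) (by omega) (by omega) b hb ?_
    push_cast at heq ⊢
    linear_combination -heq
  have uniq : ∀ p ∈ P, ∀ p' ∈ P, ∀ j < m, ∀ j' < m, ∀ l < M, ∀ l' < M,
      base p + (j : ℕ) * y + (l : ℕ) = base p' + (j' : ℕ) * y + (l' : ℕ) →
      p = p' ∧ j = j' ∧ l = l' := by
    rintro ⟨β, τ⟩ hp ⟨β', τ'⟩ hp' j hj j' hj' l hl l' hl' heq
    simp only [P, Finset.mem_filter, Finset.mem_product, Finset.mem_range] at hp hp'
    have h1 : ((β * M + l : ℕ) : ZMod n) + ((τ * m + j : ℕ) : ZMod n) * y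
        = ((β' * M + l' : ℕ) : ZMod n) + ((τ' * m + j' : ℕ) : ZMod n) * y := by
      simp only [base] at heq
      push_cast at heq ⊢
      linear_combination heq
    have b1 : τ * m + j < (τ + 1) * m := by rw [add_mul]; omega
    have b2 : τ' * m + j' < (τ' + 1) * m := by rw [add_mul]; omega
    have t1 := time_le _ (hlt β hp.1.1 l hl) β' τ' l' hl' hp'.2 _ _ b2 h1
    have t2 := time_le _ (hlt β' hp'.1.1 l' hl') β τ l hl hp.2 _ _ b1 h1.symm
    have t3 : τ * m + j = τ' * m + j' := le_antisymm t2 t1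
    rw [t3] at h1
    have h2 := add_right_cancel h1
    have h3 : β * M + l = β' * M + l' := by
      rw [ZMod.natCast_eq_natCast_iff'] at h2
      rwa [Nat.mod_eq_of_lt ((hlt β hp.1.1 l hl).trans_le hB),
        Nat.mod_eq_of_lt ((hlt β' hp'.1.1 l' hl').trans_le hB)] at h2
    have q1 : β = β' := by
      have := congrArg (· / M) h3
      simpa [Nat.add_div_of_dvd_right, Nat.div_eq_of_lt hl, Nat.div_eq_of_lt hl', hM] using this
    have q2 : τ = τ' := by
      have := congrArg (· / m) t3
      simpa [Nat.add_div_of_dvd_right, Nat.div_eq_of_lt hj, Nat.div_eq_of_lt hj', hm] using this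
    subst q1 q2
    exact ⟨rfl, by omega, by omega⟩
  have binj : Set.InjOn base P := by
    intro p hp p' hp' heq
    exact (uniq p hp p' hp' 0 hm 0 hm 0 hM 0 hM (by rw [heq])).1
  refine ⟨P.image base, ?_, ?_⟩
  · intro x hx x' hx' j hj j' hj' l hl l' hl' heq
    obtain ⟨p, hp, rfl⟩ := Finset.mem_image.1 hx
    obtain ⟨p', hp', rfl⟩ := Finset.mem_image.1 hx'
    obtain ⟨rfl, h⟩ := uniq p hp p' hp' j hj j' hj' l hl l' hl' heq
    exact ⟨rfl, h⟩
  · rw [Finset.card_image_of_injOn binj]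
    let C1 : Finset (ZMod n) := (P ×ˢ (Finset.range m ×ˢ Finset.range M)).image
      (fun q => base q.1 + (q.2.1 : ℕ) * y + (q.2.2 : ℕ))
    let C2 : Finset (ZMod n) := (Finset.range (B * M) ×ˢ Finset.range m).image
      (fun q => ((q.1 : ℕ) : ZMod n) - (q.2 : ℕ) * y)
    let C3 : Finset (ZMod n) :=
      ((Finset.Ico (-(M : ℤ)) 0 ∪ Finset.Ico ((B * M : ℕ) : ℤ) ((B * M : ℕ) + (M : ℤ))) ×ˢ
        Finset.Icc (-(m : ℤ)) (H : ℤ)).image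
      (fun q => ((q.1 : ℤ) : ZMod n) + ((q.2 : ℤ) : ZMod n) * y)
    have c1 : C1.card ≤ P.card * (m * M) := by
      refine Finset.card_image_le.trans ?_
      simp [Finset.card_product]
    have c2 : C2.card ≤ B * M * m := by
      refine Finset.card_image_le.trans ?_
      simp [Finset.card_product]
    have c3 : C3.card ≤ 2 * M * (H + m + 1) := by
      refine Finset.card_image_le.trans ?_
      rw [Finset.card_product]
      refine Nat.mul_le_mul ((Finset.card_union_le _ _).trans ?_) ?_
      · simp; omega
      · simp; omega
    have cover : (Finset.univ : Finset (ZMod n)) ⊆ C1 ∪ (C2 ∪ C3) := by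
      intro x _
      have hx := hit x
      let s := Nat.find hx
      obtain ⟨hsH, b, hb, hxb⟩ := Nat.find_spec hx
      have hmin : ∀ s' < s, ∀ v < B * M, x - (s' : ZMod n) * y ≠ ((v : ℕ) : ZMod n) := by
        intro s' hs' v hv heq
        exact Nat.find_min hx hs' ⟨by omega, v, hv, heq⟩
      change s ≤ H at hsH
      change x - (s : ZMod n) * y = _ at hxb
      clear_value s
      have hbB : b / M < B := Nat.div_lt_of_lt_mul (by rwa [mul_comm])
      have hbd : b / M * M + b % M = b := by rw [mul_comm]; exact Nat.div_add_mod b M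
      have hsd : s / m * m + s % m = s := by rw [mul_comm]; exact Nat.div_add_mod s m
      by_cases hg : good (b / M) (s / m)
      · refine Finset.mem_union_left _ (Finset.mem_image.2
          ⟨((b / M, s / m), (s % m, b % M)), ?_, ?_⟩)
        · simp only [P, Finset.mem_filter, Finset.mem_product, Finset.mem_range]
          exact ⟨⟨⟨hbB, lt_of_le_of_lt (Nat.div_le_self _ _) (by omega)⟩, hg⟩, Nat.mod_lt _ hm,
            Nat.mod_lt _ hM⟩
        · simp only [base]
          have e1 := congrArg (Nat.cast (R := ZMod n)) hbd
          have e2 := congrArg (Nat.cast (R := ZMod n)) hsd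
          push_cast at e1 e2 ⊢
          linear_combination e1 + y * e2 - hxb
      · refine Finset.mem_union_right _ ?_
        simp only [good] at hg
        push Not at hg
        obtain ⟨l, hl, t, ht1, ht2, v, hv, heq⟩ := hg
        have hts : t < s + m := by
          rw [add_mul, one_mul] at ht2
          have := Nat.div_mul_le_self s m
          omega
        obtain ⟨ρ, hρ⟩ : ∃ ρ, ρ = b % M := ⟨_, rfl⟩
        have hbM : ρ < M := hρ ▸ Nat.mod_lt _ hM
        rw [← hρ] at hbd
        -- b + t y as an integer
        have key : ((b : ℕ) : ZMod n) + (t : ZMod n) * y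
            = (((v : ℤ) + (ρ : ℤ) - (l : ℤ) : ℤ) : ZMod n) := by
          have e1 := congrArg (Nat.cast (R := ZMod n)) hbd
          push_cast at e1 heq ⊢
          linear_combination heq - e1
        set w : ℤ := (v : ℤ) + (ρ : ℤ) - (l : ℤ) with hw
        by_cases hwI : 0 ≤ w ∧ w < ((B * M : ℕ) : ℤ)
        · refine Finset.mem_union_left _ ?_
          obtain ⟨w', hw'⟩ := Int.eq_ofNat_of_zero_le hwI.1
          rw [hw'] at key hwI
          have hw'B : w' < B * M := by exact_mod_cast hwI.2
          have hst : s < t := by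
            by_contra hc
            push Not at hc
            refine hmin (s - t) (by omega) w' hw'B ?_
            rw [Nat.cast_sub hc]
            push_cast at key
            linear_combination hxb + key
          refine Finset.mem_image.2 ⟨(w', t - s), ?_, ?_⟩
          · simp only [Finset.mem_product, Finset.mem_range]
            exact ⟨hw'B, by omega⟩
          · simp only
            rw [Nat.cast_sub hst.le]
            push_cast at key
            linear_combination -hxb - key
        · refine Finset.mem_union_right _ ?_
          refine Finset.mem_image.2 ⟨(w, (s : ℤ) - t), ?_, ?_⟩
          · simp only [Finset.mem_product, Finset.mem_union, Finset.mem_Ico, Finset.mem_Icc]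
            have : (v : ℤ) < ((B * M : ℕ) : ℤ) := by exact_mod_cast hv
            refine ⟨?_, by omega, by omega⟩
            by_cases h0 : w < 0
            · left; omega
            · right; push Not at hwI; exact ⟨hwI (by omega), by omega⟩
          · simp only
            rw [← key]
            push_cast
            linear_combination -hxb
    have := Finset.card_le_card cover
    rw [Finset.card_univ, ZMod.card] at this
    have h1 := Finset.card_union_le C1 (C2 ∪ C3)
    have h2 := Finset.card_union_le C2 C3
    omega

def HeisGood (n Q D : ℕ) (y : ZMod n) : Prop :=
  ∀ t : ℕ, 1 ≤ t → t ≤ Q → ∀ z : ℤ, |z| < D → (t : ZMod n) * y ≠ (z : ZMod n)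

theorem heis_hit (n : ℕ) [NeZero n] (y : ZMod n) (L Q D : ℕ) (hL : 0 < L) (hD : 0 < D)
    (hQ : n < Q * L) (hy : HeisGood n Q D y) (x : ZMod n) :
    ∃ s ≤ Q * (n / D + 1), ∃ v < L, x - (s : ZMod n) * y = ((v : ℕ) : ZMod n) := by
  -- pigeonhole
  have hbox : ∀ z : ZMod n, z.val / L < Q := fun z =>
    Nat.div_lt_of_lt_mul (by rw [mul_comm]; exact (ZMod.val_lt z).trans hQ)
  obtain ⟨a, b, hab, heq⟩ := Fintype.exists_ne_map_eq_of_card_lt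
    (fun t : Fin (Q + 1) => (⟨(((t : ℕ) : ZMod n) * y).val / L, hbox _⟩ : Fin Q)) (by simp)
  wlog hlt : a < b generalizing a b
  · exact this b a hab.symm heq.symm (lt_of_le_of_ne (not_lt.1 hlt) hab.symm)
  have heq' : (((a : ℕ) : ZMod n) * y).val / L = (((b : ℕ) : ZMod n) * y).val / L :=
    congrArg Fin.val heq
  obtain ⟨p, hp⟩ : ∃ p, p = (((a : ℕ) : ZMod n) * y).val := ⟨_, rfl⟩
  obtain ⟨q, hq⟩ : ∃ q, q = (((b : ℕ) : ZMod n) * y).val := ⟨_, rfl⟩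
  have hp' : ((p : ℕ) : ZMod n) = ((a : ℕ) : ZMod n) * y := by rw [hp, ZMod.natCast_zmod_val]
  have hq' : ((q : ℕ) : ZMod n) = ((b : ℕ) : ZMod n) * y := by rw [hq, ZMod.natCast_zmod_val]
  rw [← hp, ← hq] at heq'
  have ep := Nat.div_add_mod p L
  have eq := Nat.div_add_mod q L
  have rp := Nat.mod_lt p hL
  have rq := Nat.mod_lt q hL
  rw [heq'] at ep
  have hltn : (a : ℕ) < (b : ℕ) := hlt
  have hbQ : (b : ℕ) ≤ Q := by omega
  obtain ⟨t, ht⟩ : ∃ t, t = (b : ℕ) - (a : ℕ) := ⟨_, rfl⟩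
  have htc : (t : ZMod n) * y = (q : ZMod n) - (p : ZMod n) := by
    rw [ht, Nat.cast_sub hltn.le, hp', hq']; ring
  have hgood := hy t (by omega) (by omega) ((q : ℤ) - p)
  have hge : ¬ |(q : ℤ) - p| < D := fun h => hgood h (by push_cast; exact htc)
  obtain ⟨δ, hδ⟩ : ∃ δ : ℕ, (δ : ℤ) = |(q : ℤ) - p| := ⟨_, Int.natCast_natAbs _⟩
  have hδD : D ≤ δ := by rw [← hδ] at hge; exact_mod_cast not_lt.1 hge
  have hδL : δ < L := by
    have : |(q : ℤ) - p| < L := by rw [abs_lt]; constructor <;> omega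
    omega
  have hδ0 : 0 < δ := by omega
  have hdiv : ∀ v ≤ n, v / δ ≤ n / D := fun v hv => Nat.div_le_div hv hδD (by omega)
  have hxn := ZMod.val_lt x
  obtain ⟨v, hv⟩ : ∃ v, v = x.val := ⟨_, rfl⟩
  have hv' : ((v : ℕ) : ZMod n) = x := by rw [hv, ZMod.natCast_zmod_val]
  rw [← hv] at hxn
  have htQ : t ≤ Q := by omega
  rcases le_total p q with hpq | hpq
  · have h1 : q = p + δ := by rw [abs_of_nonneg (by omega)] at hδ; omega
    refine ⟨t * (v / δ), Nat.mul_le_mul htQ ((hdiv v hxn.le).trans (by omega)), v % δ,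
      (Nat.mod_lt _ hδ0).trans hδL, ?_⟩
    have e := congrArg (Nat.cast (R := ZMod n)) (Nat.div_add_mod v δ)
    rw [h1] at htc
    push_cast at e htc ⊢
    linear_combination -e - hv' - ((v / δ : ℕ) : ZMod n) * htc
  · have h1 : p = q + δ := by rw [abs_of_nonpos (by omega)] at hδ; omega
    obtain ⟨w, hw⟩ : ∃ w, n = v + w := ⟨n - v, by omega⟩
    refine ⟨t * (w / δ + 1), Nat.mul_le_mul htQ
      (Nat.add_le_add_right (hdiv w (by omega)) 1), δ - w % δ,
      by omega, ?_⟩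
    have e := congrArg (Nat.cast (R := ZMod n)) (Nat.div_add_mod w δ)
    have e2 := congrArg (Nat.cast (R := ZMod n)) hw
    rw [ZMod.natCast_self] at e2
    rw [Nat.cast_sub (Nat.mod_lt _ hδ0).le]
    rw [h1] at htc
    push_cast at e e2 htc ⊢
    linear_combination e - hv' - (((w / δ : ℕ) : ZMod n) + 1) * htc - e2

open Classical in
theorem heis_bad_card (n : ℕ) [NeZero n] (Q D : ℕ) (hD : D ≤ n) :
    (Finset.univ.filter (fun y : ZMod n => ¬ HeisGood n Q D y)).card ≤ Q * (2 * D) * (Q + 1) := by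
  have hn : 0 < n := Nat.pos_of_ne_zero (NeZero.ne n)
  have hsub : (Finset.univ.filter (fun y : ZMod n => ¬ HeisGood n Q D y)) ⊆
      ((Finset.Icc 1 Q ×ˢ Finset.Ico (-(D : ℤ)) D) ×ˢ Finset.range (Q + 1)).image
      (fun q => (((q.1.2 + n * (q.2 : ℤ)) / (q.1.1 : ℤ) : ℤ) : ZMod n)) := by
    intro y hy
    have hy := (Finset.mem_filter.1 hy).2
    unfold HeisGood at hy
    push Not at hy
    obtain ⟨t, ht1, htQ, z, hz, heq⟩ := hy
    have hyn := ZMod.val_lt y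
    obtain ⟨v, hv⟩ : ∃ v, v = y.val := ⟨_, rfl⟩
    have hv' : ((v : ℕ) : ZMod n) = y := by rw [hv, ZMod.natCast_zmod_val]
    rw [← hv] at hyn
    have h1 : (((t * v : ℤ)) : ZMod n) = ((z : ℤ) : ZMod n) := by
      push_cast; rw [hv', heq]
    rw [ZMod.intCast_eq_intCast_iff_dvd_sub] at h1
    obtain ⟨c, hc⟩ := h1
    rw [abs_lt] at hz
    have hDn : (D : ℤ) ≤ n := by exact_mod_cast hD
    have hnZ : (0 : ℤ) < n := by exact_mod_cast hn
    have htv : (0 : ℤ) ≤ t * v := by positivity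
    have htv2 : (t : ℤ) * v ≤ Q * n := by
      have : t * v ≤ Q * n := Nat.mul_le_mul htQ hyn.le
      exact_mod_cast this
    have hc0 : 0 ≤ -c := by
      by_contra hcon
      have : (n : ℤ) * 1 ≤ n * c := mul_le_mul_of_nonneg_left (by omega) hnZ.le
      omega
    have hcQ : -c < Q + 1 := by
      by_contra hcon
      have : (n : ℤ) * (Q + 1) ≤ n * (-c) := mul_le_mul_of_nonneg_left (by omega) hnZ.le
      linarith
    obtain ⟨w, hw⟩ := Int.eq_ofNat_of_zero_le hc0
    refine Finset.mem_image.2 ⟨((t, z), w), ?_, ?_⟩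
    · simp only [Finset.mem_product, Finset.mem_Icc, Finset.mem_Ico, Finset.mem_range]
      refine ⟨⟨⟨ht1, htQ⟩, by omega, by omega⟩, by omega⟩
    · simp only
      have : z + n * (w : ℤ) = t * v := by
        rw [show (w : ℤ) = -c from hw.symm]; linarith
      rw [this, Int.mul_ediv_cancel_left _ (by omega)]
      simpa using hv'
  refine (Finset.card_le_card hsub).trans (Finset.card_image_le.trans ?_)
  rw [Finset.card_product, Finset.card_product]
  simp
  have : ((D : ℤ) + D).toNat = 2 * D := by omega
  rw [this]

theorem heis_tiles (n m B Q D : ℕ) [NeZero n] (hm : 0 < m) (hB : 0 < B) (hD : 0 < D)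
    (hBn : B * m^2 ≤ n) (hDn : D ≤ n) (hQ : n < Q * (B * m^2)) :
    ∃ 𝒯 : Finset (ZMod n × ZMod n),
      (∀ b ∈ 𝒯, ∀ b' ∈ 𝒯, ∀ i < m, ∀ i' < m, ∀ j < m, ∀ j' < m, ∀ l < m^2, ∀ l' < m^2,
        ((b.1 + (j : ℕ) * b.2 + (l : ℕ), b.2 + (i : ℕ)) : ZMod n × ZMod n)
          = (b'.1 + (j' : ℕ) * b'.2 + (l' : ℕ), b'.2 + (i' : ℕ)) →
        b = b' ∧ i = i' ∧ j = j' ∧ l = l') ∧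
      (n / m - Q * (2 * D) * (Q + 1)) *
        (n - (B * m^2 * m + 2 * m^2 * (Q * (n / D + 1) + m + 1))) ≤ 𝒯.card * (m * m^2) := by
  classical
  have hM : 0 < m^2 := by positivity
  have hrow : ∀ y : ZMod n, ∃ E : Finset (ZMod n), HeisGood n Q D y →
      (∀ x ∈ E, ∀ x' ∈ E, ∀ j < m, ∀ j' < m, ∀ l < m^2, ∀ l' < m^2,
        x + (j : ℕ) * y + (l : ℕ) = x' + (j' : ℕ) * y + (l' : ℕ) → x = x' ∧ j = j' ∧ l = l') ∧
      n ≤ E.card * (m * m^2) + (B * m^2 * m + 2 * m^2 * (Q * (n / D + 1) + m + 1)) := by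
    intro y
    by_cases hy : HeisGood n Q D y
    · obtain ⟨E, hE⟩ := heis_row n y m (m^2) B (Q * (n / D + 1)) hm hM hBn
        (fun x => heis_hit n y (B * m^2) Q D (by positivity) hD hQ hy x)
      exact ⟨E, fun _ => hE⟩
    · exact ⟨∅, fun h => absurd h hy⟩
  choose E hE using hrow
  let S : Finset ℕ := (Finset.range (n / m)).filter (fun q => HeisGood n Q D ((q * m : ℕ) : ZMod n))
  have hlt : ∀ q < n / m, ∀ i < m, q * m + i < n := by
    intro q hq i hi
    calc q * m + i < q * m + m := by omega
      _ = (q + 1) * m := by ring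
      _ ≤ n / m * m := Nat.mul_le_mul_right _ hq
      _ ≤ n := Nat.div_mul_le_self _ _
  have huniq : ∀ q < n / m, ∀ q' < n / m, ∀ i < m, ∀ i' < m,
      ((q * m : ℕ) : ZMod n) + (i : ZMod n) = ((q' * m : ℕ) : ZMod n) + (i' : ZMod n) →
      q = q' ∧ i = i' := by
    intro q hq q' hq' i hi i' hi' h
    rw [← Nat.cast_add, ← Nat.cast_add, ZMod.natCast_eq_natCast_iff',
      Nat.mod_eq_of_lt (hlt q hq i hi), Nat.mod_eq_of_lt (hlt q' hq' i' hi')] at h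
    have q1 : q = q' := by
      have := congrArg (· / m) h
      simpa [Nat.add_div_of_dvd_right, Nat.div_eq_of_lt hi, Nat.div_eq_of_lt hi', hm] using this
    subst q1
    exact ⟨rfl, by omega⟩
  have hScard : n / m - Q * (2 * D) * (Q + 1) ≤ S.card := by
    have h1 := Finset.card_filter_add_card_filter_not (s := Finset.range (n / m))
      (fun q => HeisGood n Q D ((q * m : ℕ) : ZMod n))
    have h2 : ((Finset.range (n / m)).filter
        (fun q => ¬ HeisGood n Q D ((q * m : ℕ) : ZMod n))).card ≤ Q * (2 * D) * (Q + 1) := by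
      refine le_trans ?_ (heis_bad_card n Q D hDn)
      refine Finset.card_le_card_of_injOn (fun q => ((q * m : ℕ) : ZMod n)) ?_ ?_
      · intro q hq
        have hq := (Finset.mem_filter.1 hq).2
        exact Finset.mem_coe.2 (Finset.mem_filter.2 ⟨Finset.mem_univ _, hq⟩)
      · intro q hq q' hq' h
        have hq := Finset.mem_range.1 (Finset.mem_filter.1 hq).1
        have hq' := Finset.mem_range.1 (Finset.mem_filter.1 hq').1
        exact (huniq q hq q' hq' 0 hm 0 hm (by simpa using h)).1
    rw [Finset.card_range] at h1
    change S.card + _ = _ at h1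
    omega
  let g : (Σ _ : ℕ, ZMod n) → ZMod n × ZMod n := fun s => (s.2, ((s.1 * m : ℕ) : ZMod n))
  let Sg : Finset (Σ _ : ℕ, ZMod n) := S.sigma (fun q => E ((q * m : ℕ) : ZMod n))
  have hg : Set.InjOn g Sg := by
    rintro ⟨q, x⟩ hs ⟨q', x'⟩ hs' h
    have hs := (Finset.mem_sigma.1 (Finset.mem_coe.1 hs)).1
    have hs' := (Finset.mem_sigma.1 (Finset.mem_coe.1 hs')).1
    have hq := Finset.mem_range.1 (Finset.mem_filter.1 hs).1
    have hq' := Finset.mem_range.1 (Finset.mem_filter.1 hs').1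
    simp only [g, Prod.mk.injEq] at h
    obtain ⟨rfl, h2⟩ := h
    obtain rfl := (huniq q hq q' hq' 0 hm 0 hm (by simpa using h2)).1
    rfl
  refine ⟨Sg.image g, ?_, ?_⟩
  · intro b hb b' hb' i hi i' hi' j hj j' hj' l hl l' hl' h
    obtain ⟨⟨q, x⟩, hs, rfl⟩ := Finset.mem_image.1 hb
    obtain ⟨⟨q', x'⟩, hs', rfl⟩ := Finset.mem_image.1 hb'
    obtain ⟨hs, hx⟩ := Finset.mem_sigma.1 hs
    obtain ⟨hs', hx'⟩ := Finset.mem_sigma.1 hs'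
    have hq := Finset.mem_range.1 (Finset.mem_filter.1 hs).1
    have hq' := Finset.mem_range.1 (Finset.mem_filter.1 hs').1
    have hgood := (Finset.mem_filter.1 hs).2
    simp only [g, Prod.mk.injEq] at h hx hx' ⊢
    obtain ⟨rfl, rfl⟩ := huniq q hq q' hq' i hi i' hi' h.2
    obtain ⟨rfl, rfl, rfl⟩ := (hE _ hgood).1 x hx x' hx' j hj j' hj' l hl l' hl' h.1
    exact ⟨⟨rfl, rfl⟩, rfl, rfl, rfl⟩
  · rw [Finset.card_image_of_injOn hg, Finset.card_sigma, Finset.sum_mul]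
    refine (Nat.mul_le_mul_right _ hScard).trans ?_
    rw [← smul_eq_mul]
    refine Finset.card_nsmul_le_sum _ _ _ ?_
    intro q hq
    have := (hE _ (Finset.mem_filter.1 hq).2).2
    omega

set_option maxHeartbeats 1000000 in
/-- **Theorem (Heisenberg version).** For every `ε > 0` and `k ≥ 2` there is an integer `C`
such that for all `n > C` there is a permutation `f` of `(ℤ/nℤ)²` of order dividing `k` whose
coordinate functions satisfy `f₁(x,y+1) = f₁(x,y) + f₂(x,y)` and `f₂(x,y+1) = f₂(x,y)` for at
least `(1-ε)n²` pairs `(x,y)`. -/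
theorem exists_perm_heisenberg (ε : ℝ) (hε : 0 < ε) (k : ℕ) (hk : 2 ≤ k) :
    ∃ C : ℕ, ∀ n : ℕ, n > C →
      ∃ f : Equiv.Perm (ZMod n × ZMod n), f ^ k = 1 ∧
        (1 - ε) * (n : ℝ) ^ 2 ≤
          (({p : ZMod n × ZMod n |
              (f (p.1, p.2 + 1)).1 = (f p).1 + (f p).2 ∧
              (f (p.1, p.2 + 1)).2 = (f p).2}).ncard : ℝ) := by
  obtain ⟨d, rfl⟩ : ∃ d, k = d + 2 := ⟨k - 2, by omega⟩
  obtain ⟨m₀, hm₀⟩ := exists_nat_gt (8 / ε)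
  obtain ⟨m, hmdef⟩ : ∃ m, m = m₀ + 8 := ⟨_, rfl⟩
  have hm8 : 8 ≤ m := by omega
  have hm : 0 < m := by omega
  have hmε : 8 / (m : ℝ) ≤ ε := by
    have h1 : 8 / ε < m := hm₀.trans_le (by exact_mod_cast (by omega : m₀ ≤ m))
    rw [div_lt_iff₀ hε] at h1
    rw [div_le_iff₀ (by positivity)]
    linarith
  obtain ⟨Q, hQ⟩ : ∃ Q, Q = 2 * m^2 := ⟨_, rfl⟩
  obtain ⟨A, hA⟩ : ∃ A, A = 2 * Q * (Q + 1) * m^2 := ⟨_, rfl⟩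
  have hQ0 : 0 < Q := by rw [hQ]; positivity
  have hA0 : 0 < A := by rw [hA]; positivity
  obtain ⟨Z, hZ⟩ : ∃ Z, Z = 2 * m^2 * (Q * (2 * A) + m + 1) := ⟨_, rfl⟩
  refine ⟨m^4 + A + m * Z + m^2 + m^(d+5), fun n hn => ?_⟩
  have : NeZero n := ⟨by omega⟩
  have hn1 : m^4 ≤ n := by omega
  have hn2 : A ≤ n := by omega
  have hn3 : m * Z ≤ n := by omega
  have hn4 : m^2 ≤ n := by omega
  have hn5 : m^(d+5) ≤ n := by omega
  have hn0 : 1 ≤ n := by omega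
  clear hn
  obtain ⟨B, hBd⟩ : ∃ B, B = n / m^4 := ⟨_, rfl⟩
  obtain ⟨D, hDd⟩ : ∃ D, D = n / A := ⟨_, rfl⟩
  have hm4 : 0 < m^4 := by positivity
  have hB : 0 < B := hBd ▸ Nat.div_pos hn1 hm4
  have hD : 0 < D := hDd ▸ Nat.div_pos hn2 hA0
  have hB1 : B * m^4 ≤ n := hBd ▸ Nat.div_mul_le_self _ _
  have hD1 : D * A ≤ n := hDd ▸ Nat.div_mul_le_self _ _
  have hB2 : n < m^4 * (B + 1) := hBd ▸ Nat.lt_mul_div_succ n hm4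
  have hD2 : n < A * (D + 1) := hDd ▸ Nat.lt_mul_div_succ n hA0
  have hBn : B * m^2 ≤ n :=
    (Nat.mul_le_mul_left B (Nat.pow_le_pow_right hm (by norm_num))).trans hB1
  have hDn : D ≤ n := (Nat.le_mul_of_pos_right D hA0).trans hD1
  have hQB : n < Q * (B * m^2) := by
    refine hB2.trans_le ?_
    rw [hQ]
    have : m^4 * (B + 1) ≤ m^4 * (2 * B) := Nat.mul_le_mul_left _ (by omega)
    refine this.trans (le_of_eq (by ring))
  have hnD : n / D + 1 ≤ 2 * A := by
    have : n < 2 * A * D := by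
      refine hD2.trans_le ?_
      have : A * (D + 1) ≤ A * (2 * D) := Nat.mul_le_mul_left _ (by omega)
      refine this.trans (le_of_eq (by ring))
    exact Nat.div_lt_of_lt_mul (by rwa [mul_comm])
  obtain ⟨𝒯, hinj, hcard⟩ := heis_tiles n m B Q D hm hB hD hBn hDn hQB
  obtain ⟨f, hf, hfc⟩ := heis_assemble d m n hm 𝒯 hinj
  refine ⟨f, hf, ?_⟩
  obtain ⟨G, hG⟩ : ∃ G, G = ({p : ZMod n × ZMod n |
              (f (p.1, p.2 + 1)).1 = (f p).1 + (f p).2 ∧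
              (f (p.1, p.2 + 1)).2 = (f p).2}).ncard := ⟨_, rfl⟩
  rw [← hG] at hfc ⊢
  -- real estimates
  have hW : B * m^2 * m + 2 * m^2 * (Q * (n / D + 1) + m + 1) ≤ B * m^3 + Z := by
    rw [hZ]
    have : Q * (n / D + 1) ≤ Q * (2 * A) := Nat.mul_le_mul_left _ hnD
    have : 2 * m^2 * (Q * (n / D + 1) + m + 1) ≤ 2 * m^2 * (Q * (2 * A) + m + 1) :=
      Nat.mul_le_mul_left _ (by omega)
    have h3 : B * m^2 * m = B * m^3 := by ring
    omega
  have hmR : (8 : ℝ) ≤ m := by exact_mod_cast hm8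
  have hm0R : (0 : ℝ) < m := by linarith
  obtain ⟨δ, hδ⟩ : ∃ δ : ℝ, δ = 1 / m := ⟨_, rfl⟩
  have hδm : δ * m = 1 := by rw [hδ]; field_simp
  have hδ0 : 0 < δ := by rw [hδ]; positivity
  have hδ8 : δ ≤ 1 / 8 := by nlinarith
  have hδε : 8 * δ ≤ ε := by rw [hδ]; linarith [show 8 * (1 / (m : ℝ)) = 8 / m by ring]
  have hnR : (1 : ℝ) ≤ n := by exact_mod_cast hn0
  -- W ≤ 2 δ n
  have hWR : ((B * m^3 + Z : ℕ) : ℝ) ≤ 2 * δ * n := by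
    have h1 : ((B * m^3 + Z) * m : ℕ) ≤ 2 * n := by
      have : (B * m^3 + Z) * m = B * m^4 + m * Z := by ring
      omega
    have h2 : (((B * m^3 + Z : ℕ) : ℝ)) * m ≤ 2 * n := by exact_mod_cast h1
    calc ((B * m^3 + Z : ℕ) : ℝ) = (((B * m^3 + Z : ℕ) : ℝ) * m) * δ := by
          rw [mul_assoc, mul_comm (m : ℝ), hδm, mul_one]
      _ ≤ 2 * n * δ := mul_le_mul_of_nonneg_right h2 hδ0.le
      _ = _ := by ring
  -- bad ≤ δ² n
  have hbR : ((Q * (2 * D) * (Q + 1) : ℕ) : ℝ) ≤ δ^2 * n := by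
    have h1 : Q * (2 * D) * (Q + 1) * m^2 ≤ n := by
      refine le_trans (le_of_eq ?_) hD1
      rw [hA]; ring
    have h2 : ((Q * (2 * D) * (Q + 1) : ℕ) : ℝ) * m^2 ≤ n := by exact_mod_cast h1
    calc ((Q * (2 * D) * (Q + 1) : ℕ) : ℝ)
        = (((Q * (2 * D) * (Q + 1) : ℕ) : ℝ) * m^2) * δ^2 := by
          rw [mul_assoc (Nat.cast _), ← mul_pow, mul_comm (m : ℝ), hδm, one_pow, mul_one]
      _ ≤ n * δ^2 := mul_le_mul_of_nonneg_right h2 (by positivity)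
      _ = _ := by ring
  have h1R : 1 ≤ δ^2 * n := by
    have h2 : (m : ℝ)^2 ≤ n := by exact_mod_cast hn4
    calc (1 : ℝ) = δ^2 * m^2 := by rw [← mul_pow, hδm, one_pow]
      _ ≤ _ := mul_le_mul_of_nonneg_left h2 (by positivity)
  have hdivR : δ * n - 1 ≤ ((n / m : ℕ) : ℝ) := by
    have h1 : n < m * (n / m + 1) := Nat.lt_mul_div_succ n hm
    have h2 : (n : ℝ) ≤ m * (((n / m : ℕ) : ℝ) + 1) := by exact_mod_cast h1.le
    have h3 := mul_le_mul_of_nonneg_left h2 hδ0.le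
    rw [← mul_assoc, hδm] at h3
    linarith
  have hT : (1 - 2 * δ)^2 * n^2 ≤ (𝒯.card : ℝ) * m^4 := by
    have e1 : (n / m : ℕ) - (((Q * (2 * D) * (Q + 1)) : ℕ) : ℝ) ≤
        ((n / m - Q * (2 * D) * (Q + 1) : ℕ) : ℝ) := by
      rw [sub_le_iff_le_add]; exact_mod_cast (by omega)
    have e2 : (n : ℝ) - ((B * m^3 + Z : ℕ) : ℝ) ≤
        ((n - (B * m^2 * m + 2 * m^2 * (Q * (n / D + 1) + m + 1)) : ℕ) : ℝ) := by
      rw [sub_le_iff_le_add]; exact_mod_cast (by omega)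
    have e3 : δ * n * (1 - 2 * δ) ≤ ((n / m - Q * (2 * D) * (Q + 1) : ℕ) : ℝ) := by
      refine le_trans ?_ e1
      linarith
    have e4 : (1 - 2 * δ) * n ≤
        ((n - (B * m^2 * m + 2 * m^2 * (Q * (n / D + 1) + m + 1)) : ℕ) : ℝ) := by
      refine le_trans ?_ e2
      linarith
    have e5 : ((n / m - Q * (2 * D) * (Q + 1) : ℕ) : ℝ) *
        ((n - (B * m^2 * m + 2 * m^2 * (Q * (n / D + 1) + m + 1)) : ℕ) : ℝ)
        ≤ (𝒯.card : ℝ) * (m * m^2) := by exact_mod_cast hcard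
    have hp : (0 : ℝ) ≤ (1 - 2 * δ) * n := mul_nonneg (by linarith) (by linarith)
    have e6 := (mul_le_mul e3 e4 hp (Nat.cast_nonneg _)).trans e5
    have e7 := mul_le_mul_of_nonneg_right e6 hm0R.le
    calc (1 - 2 * δ)^2 * n^2 = (δ * m) * ((1 - 2 * δ)^2 * n^2) := by rw [hδm, one_mul]
      _ = δ * n * (1 - 2 * δ) * ((1 - 2 * δ) * n) * m := by ring
      _ ≤ _ := e7
      _ = _ := by ring
  obtain ⟨K, hK⟩ : ∃ K, K = 𝒯.card / m^d := ⟨_, rfl⟩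
  rw [← hK] at hfc
  have hKR : (𝒯.card : ℝ) ≤ m^d * (K + 1) := by
    have : 𝒯.card < m^d * (K + 1) := hK ▸ Nat.lt_mul_div_succ _ (by positivity)
    exact_mod_cast this.le
  have hmn : (m : ℝ)^(d+4) ≤ δ * n^2 := by
    have h1 : (m : ℝ)^(d+5) ≤ n := by exact_mod_cast hn5
    calc (m : ℝ)^(d+4) = (δ * m) * (m : ℝ)^(d+4) := by rw [hδm, one_mul]
      _ = δ * m^(d+5) := by ring
      _ ≤ δ * n^2 := mul_le_mul_of_nonneg_left (by nlinarith) hδ0.le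
  have hKm : (1 - 2 * δ)^2 * n^2 - δ * n^2 ≤ K * (m : ℝ)^(d+4) := by
    have h1 := mul_le_mul_of_nonneg_right hKR (show (0 : ℝ) ≤ m^4 by positivity)
    have h2 : (m : ℝ)^d * (K + 1) * m^4 = K * m^(d+4) + m^(d+4) := by ring
    linarith
  have hGR : K * (m : ℝ)^(d+4) * (1 - 2 * δ) ≤ G := by
    have h1 : (K : ℝ) * (m^(d+2) * m^2) ≤ G + K * (m^(d+1) * m^2 + m^(d+2) * m) := by
      exact_mod_cast hfc
    have h2 : (K : ℝ) * m^(d+4) * (2 * δ) = 2 * (K * m^(d+3)) * (δ * m) := by ring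
    rw [hδm] at h2
    have h3 : (K : ℝ) * (m^(d+2) * m^2) = K * m^(d+4) := by ring
    have h4 : (K : ℝ) * (m^(d+1) * m^2 + m^(d+2) * m) = 2 * (K * m^(d+3)) := by ring
    linarith
  have hfin := (mul_le_mul_of_nonneg_right hKm (show 0 ≤ 1 - 2 * δ by linarith)).trans hGR
  refine le_trans ?_ hfin
  have : (1 - ε) ≤ ((1 - 2 * δ)^2 - δ) * (1 - 2 * δ) := by
    have e1 : ((1 - 2 * δ)^2 - δ) * (1 - 2 * δ) = 1 - 7 * δ + δ^2 * (14 - 8 * δ) := by ring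
    have e2 : 0 ≤ δ^2 * (14 - 8 * δ) := mul_nonneg (sq_nonneg δ) (by linarith)
    linarith
  calc (1 - ε) * (n : ℝ)^2 ≤ ((1 - 2 * δ)^2 - δ) * (1 - 2 * δ) * n^2 :=
        mul_le_mul_of_nonneg_right this (by positivity)
    _ = _ := by ring
end

section
/- For every ε > 0 and every integer k ≥ 2 there exists an integer C such that for every integer n > C there exists a permutation f of (ℤ/nℤ)² with f^k = id whose coordinate functions f₁, f₂: (ℤ/nℤ)² → ℤ/nℤ, defined by f(x,y) = (f₁(x,y), f₂(x,y)), satisfy both f₁(x−1, y) = f₁(x,y) + f₂(x,y) and f₂(x−1, y) = f₂(x,y) for at least (1−ε)n² pairs (x,y) ∈ (ℤ/nℤ)². -/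
lemma heis_model_s16 {X : Type*} [Fintype X] (T S : X → X) (hTS : ∀ x, S (T x) = T (S x))
    (m k : ℕ) (hm : 1 ≤ m) (B : Finset X)
    (hinj : ∀ p ∈ B, ∀ p' ∈ B, ∀ a < m, ∀ b < m, ∀ a' < m, ∀ b' < m,
      T^[a] (S^[b] p) = T^[a'] (S^[b'] p') → p = p' ∧ a = a' ∧ b = b') :
    ∃ f : Equiv.Perm X, f ^ (k + 2) = 1 ∧
      (m - 1) * m * B.card ≤ ({p : X | f (T p) = S (f p)}).ncard + m ^ (k + 2) := by
  classical
  set M := B.card / m ^ k with hM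
  have hmk : 0 < m ^ k := by positivity
  obtain ⟨base⟩ : Nonempty (Fin M × (Fin k → Fin m) ↪ B) := by
    apply Function.Embedding.nonempty_of_card_le
    simp only [Fintype.card_prod, Fintype.card_fin, Fintype.card_fun, Fintype.card_coe]
    exact Nat.div_mul_le_self _ _
  let φ0 : Fin M × (Fin (k + 2) → Fin m) → X := fun w =>
    T^[(w.2 0 : ℕ)] (S^[(w.2 1 : ℕ)] (base (w.1, fun j => w.2 j.succ.succ) : X))
  have hφ0 : Function.Injective φ0 := by
    rintro ⟨i, v⟩ ⟨i', v'⟩ h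
    obtain ⟨h1, h2, h3⟩ := hinj _ (base (i, fun j => v j.succ.succ)).2 _
      (base (i', fun j => v' j.succ.succ)).2 _ (v 0).2 _ (v 1).2 _ (v' 0).2 _ (v' 1).2 h
    have h4 := base.injective (Subtype.ext h1)
    simp only [Prod.mk.injEq] at h4 ⊢
    refine ⟨h4.1, ?_⟩
    funext j
    refine Fin.cases (Fin.ext h2) (fun j => ?_) j
    refine Fin.cases (Fin.ext h3) (fun j => ?_) j
    exact congrFun h4.2 j
  let φ : Fin M × (Fin (k + 2) → Fin m) ↪ X := ⟨φ0, hφ0⟩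
  let f0 : Equiv.Perm (Fin M × (Fin (k + 2) → Fin m)) :=
    Equiv.prodCongr (Equiv.refl _) (Equiv.arrowCongr (Equiv.addRight 1) (Equiv.refl _))
  have hf0 : ∀ i v, f0 (i, v) = (i, fun j => v (j - 1)) := by
    intro i v
    simp only [f0, Equiv.prodCongr_apply, Prod.map, Equiv.refl_apply]
    congr 1
    funext j
    simp [Equiv.arrowCongr, sub_eq_add_neg]
  have hpow : ∀ N : ℕ, ∀ i v, (f0 ^ N) (i, v) = (i, fun j => v (j - N • (1 : Fin (k + 2)))) := by
    intro N
    induction N with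
    | zero => intro i v; simp
    | succ N ih =>
      intro i v
      rw [pow_succ, Equiv.Perm.mul_apply, hf0, ih]
      simp only [succ_nsmul, sub_sub]
  have hf0k : f0 ^ (k + 2) = 1 := by
    ext1 ⟨i, v⟩
    rw [hpow]
    have h : (k + 2) • (1 : Fin (k + 2)) = 0 := by
      have := card_nsmul_eq_zero (x := (1 : Fin (k + 2)))
      rwa [Fintype.card_fin] at this
    rw [h]
    simp
  have hφ : ∀ i v, φ (i, v) =
    T^[(v 0 : ℕ)] (S^[(v 1 : ℕ)] (base (i, fun j => v j.succ.succ) : X)) := fun _ _ => rfl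
  have hcomm : ∀ (a : ℕ) x, S (T^[a] x) = T^[a] (S x) := by
    intro a
    induction a with
    | zero => intro x; rfl
    | succ a ih => intro x; rw [Function.iterate_succ_apply, ih, hTS, Function.iterate_succ_apply]
  refine ⟨Equiv.Perm.viaEmbeddingHom φ f0, by rw [← map_pow, hf0k, map_one], ?_⟩
  have hgood : ∀ i v, (v 0 : ℕ) + 1 < m →
      Equiv.Perm.viaEmbeddingHom φ f0 (T (φ (i, v))) =
        S (Equiv.Perm.viaEmbeddingHom φ f0 (φ (i, v))) := by
    intro i v hv
    have h1 : T (φ (i, v)) = φ (i, Function.update v 0 ⟨v 0 + 1, hv⟩) := by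
      rw [hφ, hφ]
      have e1 : Function.update v 0 ⟨v 0 + 1, hv⟩ 1 = v 1 :=
        Function.update_of_ne (by simp) _ _
      have e2 : (fun j : Fin k => Function.update v 0 ⟨v 0 + 1, hv⟩ j.succ.succ) =
          fun j => v j.succ.succ := by
        funext j
        exact Function.update_of_ne (Fin.succ_ne_zero _) _ _
      rw [e1, e2, Function.update_self, Function.iterate_succ_apply']
    rw [h1]
    simp only [Equiv.Perm.viaEmbeddingHom_apply, Equiv.Perm.viaEmbedding_apply, hf0]
    rw [hφ, hφ, hcomm, ← Function.iterate_succ_apply' S]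
    have e0 : Function.update v 0 ⟨v 0 + 1, hv⟩ (0 - 1) = v (0 - 1) :=
      Function.update_of_ne (by simp) _ _
    have e2 : (fun j : Fin k => Function.update v 0 ⟨v 0 + 1, hv⟩ (j.succ.succ - 1)) =
        fun j => v (j.succ.succ - 1) := by
      funext j
      refine Function.update_of_ne ?_ _ _
      rw [sub_ne_zero]
      intro h
      have := congrArg Fin.val h
      simp at this
    rw [e0, e2, sub_self, Function.update_self]
  let V : Finset (Fin (k + 2) → Fin m) := Fintype.piFinset
    (fun i => if i = 0 then Finset.univ.filter (fun t : Fin m => (t : ℕ) + 1 < m) else Finset.univ)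
  have hV0 : ∀ v ∈ V, (v 0 : ℕ) + 1 < m := by
    intro v hv
    have := Fintype.mem_piFinset.1 hv 0
    simpa using this
  have hfil : m - 1 ≤ (Finset.univ.filter (fun t : Fin m => (t : ℕ) + 1 < m)).card := by
    have : ((Finset.univ : Finset (Fin (m - 1))).image
        (fun t : Fin (m - 1) => (⟨(t : ℕ), by omega⟩ : Fin m))).card = m - 1 := by
      rw [Finset.card_image_of_injective, Finset.card_univ, Fintype.card_fin]
      intro a b h
      simpa [Fin.ext_iff] using h
    rw [← this]
    apply Finset.card_le_card
    intro t ht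
    obtain ⟨s, -, rfl⟩ := Finset.mem_image.1 ht
    simp only [Finset.mem_filter, Finset.mem_univ, true_and]
    omega
  have hVcard : (m - 1) * m ^ (k + 1) ≤ V.card := by
    rw [Fintype.card_piFinset, Fin.prod_univ_succ]
    simp only [if_true, Fin.succ_ne_zero, if_false, Finset.prod_const, Finset.card_univ,
      Fintype.card_fin]
    gcongr
  have hsub : ((((Finset.univ : Finset (Fin M)) ×ˢ V).map φ : Finset X) : Set X) ⊆
      {p : X | Equiv.Perm.viaEmbeddingHom φ f0 (T p) = S (Equiv.Perm.viaEmbeddingHom φ f0 p)} := by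
    intro p hp
    obtain ⟨⟨i, v⟩, hw, rfl⟩ := Finset.mem_map.1 hp
    exact hgood i v (hV0 v (Finset.mem_product.1 hw).2)
  have hcard := Set.ncard_le_ncard hsub (Set.toFinite _)
  rw [Set.ncard_coe_finset, Finset.card_map, Finset.card_product, Finset.card_univ,
    Fintype.card_fin] at hcard
  have hB : B.card ≤ M * m ^ k + m ^ k := by
    have := Nat.div_add_mod B.card (m ^ k)
    have h2 := Nat.mod_lt B.card hmk
    rw [← hM, mul_comm] at this
    omega
  calc (m - 1) * m * B.card ≤ (m - 1) * m * (M * m ^ k + m ^ k) := by gcongr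
    _ = M * ((m - 1) * m ^ (k + 1)) + (m - 1) * m ^ (k + 1) := by ring
    _ ≤ M * V.card + m * m ^ (k + 1) := by
        gcongr
        omega
    _ ≤ _ := by
        have : m * m ^ (k + 1) = m ^ (k + 2) := by ring
        rw [this]
        omega

lemma heis_row_s16 (n : ℕ) [NeZero n] (y : ZMod n) (m q0 G : ℕ) (hm : 1 ≤ m)
    (hd : ∀ x : ZMod n, ∃ b < q0, ∃ a < G, x = (b : ZMod n) * y + (a : ZMod n)) :
    ∃ B : Finset (ZMod n),
      (∀ p ∈ B, ∀ p' ∈ B, ∀ a < m, ∀ b < m, ∀ a' < m, ∀ b' < m,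
        p + (a : ZMod n) + (b : ZMod n) * y = p' + (a' : ZMod n) + (b' : ZMod n) * y →
          p = p' ∧ a = a' ∧ b = b') ∧
      n ≤ m * m * B.card + 3 * m * G + q0 * m := by
  classical
  have hex : ∃ q : ℕ, ∀ x : ZMod n, ∃ b < q, ∃ a < G, x = (b : ZMod n) * y + (a : ZMod n) := ⟨q0, hd⟩
  obtain ⟨q, hq, hqmin, hqle⟩ : ∃ q : ℕ, (∀ x : ZMod n, ∃ b < q, ∃ a < G,
      x = (b : ZMod n) * y + (a : ZMod n)) ∧ (∀ q' : ℕ, q' < q → ¬ ∀ x : ZMod n, ∃ b < q', ∃ a < G,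
      x = (b : ZMod n) * y + (a : ZMod n)) ∧ q ≤ q0 :=
    ⟨Nat.find hex, Nat.find_spec hex, fun q' h => Nat.find_min hex h, Nat.find_min' hex hd⟩
  have hq0 : 0 < q := by
    obtain ⟨b, hb, -⟩ := hq 0
    omega
  -- distinctness of the points
  have hdist0 : ∀ b b' : ℕ, b < b' → b' < q → (b : ZMod n) * y ≠ (b' : ZMod n) * y := by
    intro b b' hbb hb' h
    apply hqmin (q - 1) (by omega)
    intro x
    obtain ⟨c, hc, a, ha, rfl⟩ := hq x
    by_cases hcq : c < q - 1
    · exact ⟨c, hcq, a, ha, rfl⟩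
    · refine ⟨c - b' + b, by omega, a, ha, ?_⟩
      congr 1
      have h1 : c = (c - b') + b' := by omega
      conv_lhs => rw [h1]
      push_cast
      rw [add_mul, add_mul, h]
  have hdist : ∀ b : ℕ, b < q → ∀ b' : ℕ, b' < q → (b : ZMod n) * y = (b' : ZMod n) * y → b = b' := by
    intro b hb b' hb' h
    rcases lt_trichotomy b b' with h1 | h1 | h1
    · exact absurd h (hdist0 _ _ h1 hb')
    · exact h1
    · exact absurd h.symm (hdist0 _ _ h1 hb)
  have hgex : ∀ b : ℕ, ∃ a : ℕ, 0 < a ∧ ∃ b' < q, (b : ZMod n) * y + (a : ZMod n) = (b' : ZMod n) * y := by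
    intro b
    obtain ⟨b', hb', a, ha, h⟩ := hq ((b : ZMod n) * y + (G : ZMod n))
    refine ⟨G - a, by omega, b', hb', ?_⟩
    rw [Nat.cast_sub ha.le, ← add_sub_assoc, h]
    ring
  have hgex2 : ∀ b : ℕ, ∃ a : ℕ, a ≤ G ∧ 0 < a ∧ ∃ b' < q, (b : ZMod n) * y + (a : ZMod n) = (b' : ZMod n) * y := by
    intro b
    obtain ⟨b', hb', a, ha, h⟩ := hq ((b : ZMod n) * y + (G : ZMod n))
    refine ⟨G - a, by omega, by omega, b', hb', ?_⟩
    rw [Nat.cast_sub ha.le, ← add_sub_assoc, h]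
    ring
  obtain ⟨g, hg0, hgG, hgn, hgmin⟩ : ∃ g : ℕ → ℕ, (∀ b, 0 < g b) ∧ (∀ b, g b ≤ G) ∧
      (∀ b : ℕ, ∃ b' < q, (b : ZMod n) * y + (g b : ZMod n) = (b' : ZMod n) * y) ∧
      (∀ b a : ℕ, 0 < a → (∃ b' < q, (b : ZMod n) * y + (a : ZMod n) = (b' : ZMod n) * y) →
        g b ≤ a) := by
    refine ⟨fun b => Nat.find (hgex b), fun b => (Nat.find_spec (hgex b)).1, fun b => ?_,
      fun b => (Nat.find_spec (hgex b)).2, fun b a ha h => Nat.find_min' (hgex b) ⟨ha, h⟩⟩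
    obtain ⟨a, ha, h⟩ := hgex2 b
    exact (Nat.find_min' (hgex b) h).trans ha
  choose nx hnx hnxe using hgn
  -- uniqueness of representation
  have huniq0 : ∀ b : ℕ, b < q → ∀ b' : ℕ, b' < q → ∀ a a' : ℕ, a ≤ a' → a' < g b' →
      (b : ZMod n) * y + (a : ZMod n) = (b' : ZMod n) * y + (a' : ZMod n) → b = b' ∧ a = a' := by
    intro b hb b' hb' a a' haa ha' h
    have h1 : (b' : ZMod n) * y + ((a' - a : ℕ) : ZMod n) = (b : ZMod n) * y := by
      rw [Nat.cast_sub haa, ← add_sub_assoc, ← h]; ring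
    have h2 : a' - a = 0 := by
      by_contra h3
      have := hgmin b' (a' - a) (by omega) ⟨b, hb, h1⟩
      omega
    have h3 : a = a' := by omega
    subst h3
    exact ⟨hdist _ hb _ hb' (add_right_cancel h), rfl⟩
  have huniq : ∀ b : ℕ, b < q → ∀ b' : ℕ, b' < q → ∀ a a' : ℕ, a < g b → a' < g b' →
      (b : ZMod n) * y + (a : ZMod n) = (b' : ZMod n) * y + (a' : ZMod n) → b = b' ∧ a = a' := by
    intro b hb b' hb' a a' ha ha' h
    rcases le_total a a' with h1 | h1
    · exact huniq0 b hb b' hb' a a' h1 ha' h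
    · obtain ⟨h2, h3⟩ := huniq0 b' hb' b hb a' a h1 ha h.symm
      exact ⟨h2.symm, h3.symm⟩
  have hsurj : ∀ x : ZMod n, ∃ b < q, ∃ a < g b, x = (b : ZMod n) * y + (a : ZMod n) := by
    intro x
    have he : ∃ a : ℕ, ∃ b < q, x = (b : ZMod n) * y + (a : ZMod n) := by
      obtain ⟨b, hb, a, ha, h⟩ := hq x
      exact ⟨a, b, hb, h⟩
    obtain ⟨b, hb, h⟩ := Nat.find_spec he
    refine ⟨b, hb, Nat.find he, ?_, h⟩
    by_contra hlt
    push Not at hlt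
    have := Nat.find_min' he (m := Nat.find he - g b) ⟨nx b, hnx b, by
      rw [Nat.cast_sub hlt, ← hnxe b]
      conv_lhs => rw [h]
      ring⟩
    have := hg0 b
    omega
  have hnxinj : ∀ b < q, ∀ b' < q, nx b = nx b' → b = b' := by
    have key : ∀ b < q, ∀ b' < q, g b ≤ g b' → nx b = nx b' → b = b' := by
      intro b hb b' hb' hle h
      have h1 : (b : ZMod n) * y + (0 : ℕ) = (b' : ZMod n) * y + ((g b' - g b : ℕ) : ZMod n) := by
        rw [Nat.cast_sub hle, ← add_sub_assoc, hnxe b', ← h, ← hnxe b]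
        push_cast; ring
      have := hg0 b
      have := hg0 b'
      exact (huniq b hb b' hb' 0 (g b' - g b) (by omega) (by omega) h1).1
    intro b hb b' hb' h
    rcases le_total (g b) (g b') with h1 | h1
    · exact key b hb b' hb' h1 h
    · exact (key b' hb' b hb h1 h.symm).symm
  -- changes of g
  have hchange : ∀ b, b + 1 < q → g b ≠ g (b + 1) → nx b = q - 1 ∨ nx (b + 1) = 0 := by
    intro b hb hne
    by_contra hcon
    push Not at hcon
    apply hne
    apply le_antisymm
    · apply hgmin _ _ (hg0 _)
      refine ⟨nx (b + 1) - 1, ?_, ?_⟩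
      · have := hnx (b + 1); omega
      · have h1 := hnxe (b + 1)
        rw [Nat.cast_sub (by omega)]
        push_cast at h1 ⊢
        linear_combination h1
    · apply hgmin _ _ (hg0 _)
      refine ⟨nx b + 1, ?_, ?_⟩
      · have := hnx b; omega
      · have h1 := hnxe b
        push_cast at h1 ⊢
        linear_combination h1
  obtain ⟨β₁, hβ₁⟩ : ∃ β, ∀ b < q, nx b = q - 1 → b = β := by
    by_cases h : ∃ b < q, nx b = q - 1
    · obtain ⟨β, hβ, h1⟩ := h
      exact ⟨β, fun b hb h2 => hnxinj b hb β hβ (h2.trans h1.symm)⟩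
    · exact ⟨0, fun b hb h2 => absurd ⟨b, hb, h2⟩ h⟩
  obtain ⟨β₂, hβ₂⟩ : ∃ β, ∀ b, b + 1 < q → nx (b + 1) = 0 → b = β := by
    by_cases h : ∃ b, b + 1 < q ∧ nx (b + 1) = 0
    · obtain ⟨β, hβ, h1⟩ := h
      exact ⟨β, fun b hb h2 => by
        have := hnxinj (b + 1) hb (β + 1) hβ (h2.trans h1.symm); omega⟩
    · exact ⟨0, fun b hb h2 => absurd ⟨b, hb, h2⟩ h⟩
  let I : Finset ℕ := {q / m, β₁ / m, β₂ / m}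
  have hIcard : I.card ≤ 3 := Finset.card_le_three
  have hconst : ∀ i, i ∉ I → m * i < q → m * i + m ≤ q ∧ ∀ t < m, g (m * i + t) = g (m * i) := by
    intro i hi hiq
    simp only [I, Finset.mem_insert, Finset.mem_singleton, not_or] at hi
    obtain ⟨hi1, hi2, hi3⟩ := hi
    have h1 : m * i + m ≤ q := by
      by_contra h
      apply hi1
      symm
      apply Nat.div_eq_of_lt_le
      · rw [mul_comm]; omega
      · rw [add_mul, mul_comm]; omega
    refine ⟨h1, ?_⟩
    intro t
    induction t with
    | zero => intro _; rfl
    | succ t ih =>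
      intro ht
      rw [← ih (by omega)]
      by_contra hne
      have hdiv : (m * i + t) / m = i := by
        rw [Nat.mul_add_div (by omega), Nat.div_eq_of_lt (by omega), add_zero]
      rcases hchange (m * i + t) (by omega) (fun h => hne h.symm) with h | h
      · apply hi2; rw [← hβ₁ _ (by omega) h, hdiv]
      · apply hi3; rw [← hβ₂ _ (by omega) h, hdiv]
  -- the index set of boxes
  let J : Finset (ℕ × ℕ) := (Finset.range q ×ˢ Finset.range G).filter
    (fun ij => ij.1 ∉ I ∧ m * ij.1 < q ∧ m * ij.2 + m ≤ g (m * ij.1))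
  let ψ : ℕ × ℕ → ZMod n := fun ij => ((m * ij.1 : ℕ) : ZMod n) * y + ((m * ij.2 : ℕ) : ZMod n)
  refine ⟨J.image ψ, ?_, ?_⟩
  · intro p hp p' hp' a ha b hb a' ha' b' hb' h
    obtain ⟨⟨i, j⟩, hij, rfl⟩ := Finset.mem_image.1 hp
    obtain ⟨⟨i', j'⟩, hij', rfl⟩ := Finset.mem_image.1 hp'
    simp only [J, Finset.mem_filter] at hij hij'
    obtain ⟨-, hi, hiq, hj⟩ := hij
    obtain ⟨-, hi', hiq', hj'⟩ := hij'
    obtain ⟨h1, h2⟩ := hconst i hi hiq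
    obtain ⟨h1', h2'⟩ := hconst i' hi' hiq'
    obtain ⟨h3, h4⟩ := huniq (m * i + b) (by omega) (m * i' + b') (by omega)
      (m * j + a) (m * j' + a') (by rw [h2 b hb]; omega) (by rw [h2' b' hb']; omega) (by
        simp only [ψ] at h
        push_cast at h ⊢
        linear_combination h)
    have hb2 : b = b' := by
      have := congrArg (· % m) h3
      simpa [Nat.mul_add_mod, Nat.mod_eq_of_lt hb, Nat.mod_eq_of_lt hb'] using this
    have ha2 : a = a' := by
      have := congrArg (· % m) h4
      simpa [Nat.mul_add_mod, Nat.mod_eq_of_lt ha, Nat.mod_eq_of_lt ha'] using this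
    subst hb2 ha2
    refine ⟨?_, rfl, rfl⟩
    simp only [ψ]
    rw [add_right_cancel h3, add_right_cancel h4]
  · let C1 : Finset (ZMod n) := (J.image ψ ×ˢ (Finset.range m ×ˢ Finset.range m)).image
      (fun w => w.1 + (w.2.1 : ZMod n) + (w.2.2 : ZMod n) * y)
    let C2 : Finset (ZMod n) := ((I ×ˢ Finset.range m) ×ˢ Finset.range G).image
      (fun w => ((m * w.1.1 + w.1.2 : ℕ) : ZMod n) * y + (w.2 : ZMod n))
    let C3 : Finset (ZMod n) := (Finset.range q ×ˢ Finset.range m).image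
      (fun w => (w.1 : ZMod n) * y + ((m * (g w.1 / m) + w.2 : ℕ) : ZMod n))
    have hcov : (Finset.univ : Finset (ZMod n)) ⊆ C1 ∪ C2 ∪ C3 := by
      intro x _
      obtain ⟨b, hb, a, ha, rfl⟩ := hsurj x
      have hbm : m * (b / m) + b % m = b := Nat.div_add_mod b m
      have ham : m * (a / m) + a % m = a := Nat.div_add_mod a m
      have hbl : b % m < m := Nat.mod_lt _ hm
      have hal : a % m < m := Nat.mod_lt _ hm
      have haG := hgG b
      rw [Finset.mem_union, Finset.mem_union]
      by_cases hbI : b / m ∈ I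
      · left; right
        refine Finset.mem_image.2 ⟨((b / m, b % m), a), ?_, ?_⟩
        · simp only [Finset.mem_product, Finset.mem_range]
          exact ⟨⟨hbI, hbl⟩, by omega⟩
        · simp only [hbm]
      · obtain ⟨h1, h2⟩ := hconst (b / m) hbI (by omega)
        have h3 := h2 (b % m) hbl
        rw [hbm] at h3
        by_cases hja : m * (a / m) + m ≤ g b
        · left; left
          refine Finset.mem_image.2 ⟨(ψ (b / m, a / m), (a % m, b % m)), ?_, ?_⟩
          · simp only [Finset.mem_product, Finset.mem_range]
            refine ⟨Finset.mem_image_of_mem _ ?_, hal, hbl⟩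
            simp only [J, Finset.mem_filter, Finset.mem_product, Finset.mem_range]
            have := Nat.div_le_self b m
            have := Nat.div_le_self a m
            refine ⟨⟨by omega, by omega⟩, hbI, by omega, by omega⟩
          · simp only [ψ]
            conv_rhs => rw [← hbm, ← ham]
            push_cast
            ring
        · right
          have hdiv : g b / m = a / m := by
            apply Nat.div_eq_of_lt_le
            · rw [mul_comm]; omega
            · rw [add_mul, mul_comm]; omega
          refine Finset.mem_image.2 ⟨(b, a % m), ?_, ?_⟩
          · simp only [Finset.mem_product, Finset.mem_range]
            exact ⟨hb, hal⟩
          · simp only [hdiv, ham]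
    have h0 := Finset.card_le_card hcov
    rw [Finset.card_univ, ZMod.card] at h0
    have hC1 : C1.card ≤ m * m * (J.image ψ).card := by
      refine Finset.card_image_le.trans ?_
      simp only [Finset.card_product, Finset.card_range]
      exact le_of_eq (mul_comm _ _)
    have hC2 : C2.card ≤ 3 * m * G := by
      refine Finset.card_image_le.trans ?_
      simp only [Finset.card_product, Finset.card_range]
      gcongr
    have hC3 : C3.card ≤ q0 * m := by
      refine Finset.card_image_le.trans ?_
      simp only [Finset.card_product, Finset.card_range]
      gcongr
    have := Finset.card_union_le (C1 ∪ C2) C3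
    have := Finset.card_union_le C1 C2
    omega

lemma heis_dense (Q R : ℕ) (hQ : 1 ≤ Q) (hR : 1 ≤ R) :
    ∃ K : ℕ, ∀ n : ℕ, ∀ _ : NeZero n, R ≤ n → ∃ Bad : Finset (ZMod n), Bad.card ≤ K ∧
      ∀ y ∉ Bad, ∀ x : ZMod n, ∃ b < Q * (n / R + 1) + 1, ∃ a < n / Q + 1,
        x = (b : ZMod n) * y + (a : ZMod n) := by
  classical
  let W : Finset (ℤ × ℤ × ℤ) :=
    Finset.Icc 1 (Q : ℤ) ×ˢ Finset.Icc (-1 : ℤ) Q ×ˢ Finset.Ioo (-(R : ℤ)) R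
  refine ⟨W.card, ?_⟩
  intro n _ hRn
  have hn : 0 < n := Nat.pos_of_ne_zero (NeZero.ne n)
  refine ⟨W.image (fun w => ((((n : ℤ) * w.2.1 + w.2.2) / w.1 : ℤ) : ZMod n)),
    Finset.card_image_le, ?_⟩
  intro y hy x
  obtain ⟨j, c, hc0, hcQ, hjc⟩ := Real.exists_int_int_abs_mul_sub_le ((y.val : ℝ) / n) (n := Q) hQ
  have hyn : (y.val : ℤ) < n := by exact_mod_cast ZMod.val_lt y
  have hy0 : (0 : ℤ) ≤ y.val := by positivity
  set r : ℤ := c * y.val - n * j with hr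
  have hrQ : |r| * (Q + 1) ≤ n := by
    have hn' : (0 : ℝ) < n := by exact_mod_cast hn
    have h1 : ((c : ℝ) * (y.val / n) - j) = (r : ℝ) / n := by
      rw [hr]; push_cast; field_simp
    rw [h1, abs_div, abs_of_pos hn', div_le_div_iff₀ hn' (by positivity)] at hjc
    have : ((|r| * (Q + 1) : ℤ) : ℝ) ≤ ((n : ℤ) : ℝ) := by push_cast; linarith
    exact_mod_cast this
  have hrR : (R : ℤ) ≤ |r| := by
    by_contra hlt
    push Not at hlt
    rw [abs_lt] at hlt
    apply hy
    refine Finset.mem_image.2 ⟨(c, j, r), ?_, ?_⟩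
    · simp only [W, Finset.mem_product, Finset.mem_Icc, Finset.mem_Ioo]
      have hRn' : (R : ℤ) ≤ n := by exact_mod_cast hRn
      have hn' : (0 : ℤ) < n := by exact_mod_cast hn
      refine ⟨⟨by omega, hcQ⟩, ⟨?_, ?_⟩, hlt⟩
      · by_contra h
        have : j ≤ -2 := by omega
        nlinarith
      · by_contra h
        have : (Q : ℤ) + 1 ≤ j := by omega
        nlinarith
    · simp only
      have : (n : ℤ) * j + r = c * y.val := by rw [hr]; ring
      rw [this, Int.mul_ediv_cancel_left _ (by omega)]
      simp
  have hR' : (0 : ℤ) < R := by exact_mod_cast hR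
  have hcast : (c : ZMod n) * y = (r : ZMod n) := by
    rw [hr]; push_cast; simp
  have hxn : (x.val : ℤ) < n := by exact_mod_cast ZMod.val_lt x
  have hx0 : (0 : ℤ) ≤ x.val := by positivity
  have hr0 : r ≠ 0 := by
    intro h; rw [h] at hrR; simp at hrR; omega
  obtain ⟨z, hzx, hzq, hzn⟩ : ∃ z : ℤ, (z : ZMod n) = x ∧ 0 ≤ z / r ∧ z / r ≤ n / R + 1 := by
    have hnd : (n : ℤ) < R * (n / R + 1) := by
      have := Int.lt_ediv_add_one_mul_self (n : ℤ) hR'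
      linarith
    have hnd0 : (0 : ℤ) ≤ n / R := by positivity
    rcases lt_or_gt_of_ne hr0 with h | h
    · refine ⟨x.val - n, by simp, ?_, ?_⟩
      · exact Int.ediv_nonneg_of_nonpos_of_nonpos (by omega) h.le
      · rw [abs_of_neg h] at hrR
        by_contra hcon
        push Not at hcon
        have h1 := Int.mul_ediv_add_emod (x.val - n) r
        have h2 := Int.emod_lt_abs (x.val - n) hr0
        rw [abs_of_neg h] at h2
        have h3 : (n / R + 2 : ℤ) ≤ (x.val - n) / r := by omega
        nlinarith
    · refine ⟨x.val, by simp, ?_, ?_⟩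
      · exact Int.ediv_nonneg hx0 h.le
      · rw [abs_of_pos h] at hrR
        by_contra hcon
        push Not at hcon
        have h1 := Int.mul_ediv_add_emod x.val r
        have h2 := Int.emod_nonneg x.val hr0
        have h3 : (n / R + 2 : ℤ) ≤ x.val / r := by omega
        nlinarith
  have hmod := Int.mul_ediv_add_emod z r
  have hm0 := Int.emod_nonneg z hr0
  have hm1 := Int.emod_lt_abs z hr0
  refine ⟨(c * (z / r)).toNat, ?_, (z % r).toNat, ?_, ?_⟩
  · have h1 : c * (z / r) ≤ Q * (n / R + 1) := by gcongr
    have h2 : (0 : ℤ) ≤ c * (z / r) := by positivity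
    zify
    rw [Int.toNat_of_nonneg h2]
    omega
  · have h1 : |r| ≤ n / Q := by
      rw [Int.le_ediv_iff_mul_le (by omega)]
      nlinarith [abs_nonneg r]
    zify
    rw [Int.toNat_of_nonneg hm0]
    omega
  · have h2 : (0 : ℤ) ≤ c * (z / r) := by positivity
    have e1 : (((c * (z / r)).toNat : ℕ) : ZMod n) = ((c * (z / r) : ℤ) : ZMod n) := by
      rw [← Int.cast_natCast, Int.toNat_of_nonneg h2]
    have e2 : (((z % r).toNat : ℕ) : ZMod n) = ((z % r : ℤ) : ZMod n) := by
      rw [← Int.cast_natCast, Int.toNat_of_nonneg hm0]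
    rw [e1, e2, ← hzx]
    conv_lhs => rw [← hmod]
    push_cast
    rw [← hcast]
    ring

set_option maxHeartbeats 2000000 in
/-- **Theorem (second Heisenberg version).** For every `ε > 0` and `k ≥ 2` there is an integer
`C` such that for all `n > C` there is a permutation `f` of `(ℤ/nℤ)²` of order dividing `k`
whose coordinate functions satisfy `f₁(x-1,y) = f₁(x,y) + f₂(x,y)` and `f₂(x-1,y) = f₂(x,y)`
for at least `(1-ε)n²` pairs `(x,y)`. -/
theorem exists_perm_heisenberg' (ε : ℝ) (hε : 0 < ε) (k : ℕ) (hk : 2 ≤ k) :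
    ∃ C : ℕ, ∀ n : ℕ, n > C →
      ∃ f : Equiv.Perm (ZMod n × ZMod n), f ^ k = 1 ∧
        (1 - ε) * (n : ℝ) ^ 2 ≤
          (({p : ZMod n × ZMod n |
              (f (p.1 - 1, p.2)).1 = (f p).1 + (f p).2 ∧
              (f (p.1 - 1, p.2)).2 = (f p).2}).ncard : ℝ) := by
  classical
  obtain ⟨k, rfl⟩ : ∃ k', k = k' + 2 := ⟨k - 2, by omega⟩
  set δ : ℝ := min (ε / 4) (1 / 2) with hδ
  have hδ0 : 0 < δ := by positivity
  have hδε : δ ≤ ε / 4 := min_le_left _ _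
  have hδ1 : δ ≤ 1 / 2 := min_le_right _ _
  obtain ⟨m, hm⟩ := exists_nat_ge (1 / δ)
  have hm1 : 1 ≤ m := by
    have : (0 : ℝ) < m := lt_of_lt_of_le (by positivity) hm
    exact_mod_cast this
  obtain ⟨Q, hQ⟩ := exists_nat_ge (9 * m / δ)
  have hmR : (1 : ℝ) ≤ m := by exact_mod_cast hm1
  have hQ1 : 1 ≤ Q := by
    have : (0 : ℝ) < Q := lt_of_lt_of_le (by positivity) hQ
    exact_mod_cast this
  have hQR : (1 : ℝ) ≤ Q := by exact_mod_cast hQ1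
  obtain ⟨R, hR⟩ := exists_nat_ge (3 * Q * m / δ)
  have hR1 : 1 ≤ R := by
    have : (0 : ℝ) < R := lt_of_lt_of_le (by positivity) hR
    exact_mod_cast this
  have hRR : (1 : ℝ) ≤ R := by exact_mod_cast hR1
  obtain ⟨K, hK⟩ := heis_dense Q R hQ1 hR1
  obtain ⟨C1, hC1⟩ := exists_nat_ge (3 * (4 * m + Q * m) / δ)
  obtain ⟨C2, hC2⟩ := exists_nat_ge (K / δ)
  obtain ⟨C3, hC3⟩ := exists_nat_ge ((m : ℝ) ^ (k + 2) / δ)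
  refine ⟨R + C1 + C2 + C3, ?_⟩
  intro n hn
  have hn0 : n ≠ 0 := by omega
  have : NeZero n := ⟨hn0⟩
  obtain ⟨Bad, hBadcard, hBad⟩ := hK n inferInstance (by omega)
  set L : ℕ := 3 * m * (n / Q + 1) + (Q * (n / R + 1) + 1) * m with hL
  have hrow : ∀ y : ZMod n, ∃ B : Finset (ZMod n),
      (∀ p ∈ B, ∀ p' ∈ B, ∀ a < m, ∀ b < m, ∀ a' < m, ∀ b' < m,
        p + (a : ZMod n) + (b : ZMod n) * y = p' + (a' : ZMod n) + (b' : ZMod n) * y →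
          p = p' ∧ a = a' ∧ b = b') ∧ (y ∉ Bad → n ≤ m * m * B.card + L) := by
    intro y
    by_cases hy : y ∈ Bad
    · exact ⟨∅, by simp, fun h => absurd hy h⟩
    · obtain ⟨B, h1, h2⟩ := heis_row_s16 n y m _ _ hm1 (hBad y hy)
      exact ⟨B, h1, fun _ => by omega⟩
  choose B hBinj hBcard using hrow
  let T : ZMod n × ZMod n → ZMod n × ZMod n := fun p => (p.1 - 1, p.2)
  let S : ZMod n × ZMod n → ZMod n × ZMod n := fun p => (p.1 + p.2, p.2)
  have hTi : ∀ (a : ℕ) p, T^[a] p = (p.1 - (a : ZMod n), p.2) := by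
    intro a
    induction a with
    | zero => intro p; simp
    | succ a ih =>
      intro p
      rw [Function.iterate_succ_apply, ih]
      simp only [T]
      push_cast
      congr 1
      ring
  have hSi : ∀ (b : ℕ) p, S^[b] p = (p.1 + (b : ZMod n) * p.2, p.2) := by
    intro b
    induction b with
    | zero => intro p; simp
    | succ b ih =>
      intro p
      rw [Function.iterate_succ_apply, ih]
      simp only [S]
      push_cast
      congr 1
      ring
  let ι : (Σ _ : ZMod n, ZMod n) ↪ ZMod n × ZMod n :=
    ⟨fun w => (w.2 + ((m - 1 : ℕ) : ZMod n), w.1), by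
      rintro ⟨y, p⟩ ⟨y', p'⟩ h
      simp only [Prod.mk.injEq, add_left_inj] at h
      obtain ⟨rfl, rfl⟩ := h
      rfl⟩
  have hι : ∀ y p, ι ⟨y, p⟩ = (p + ((m - 1 : ℕ) : ZMod n), y) := fun _ _ => rfl
  let BB : Finset (ZMod n × ZMod n) := ((Finset.univ : Finset (ZMod n)).sigma B).map ι
  have hBB : BB.card = ∑ y, (B y).card := by
    rw [Finset.card_map, Finset.card_sigma]
  obtain ⟨f, hf, hcard⟩ := heis_model_s16 T S (fun x => by simp only [T, S]; congr 1; ring) m k hm1 BB (by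
    intro p hp p' hp' a ha b hb a' ha' b' hb' h
    obtain ⟨⟨y, x⟩, hx, rfl⟩ := Finset.mem_map.1 hp
    obtain ⟨⟨y', x'⟩, hx', rfl⟩ := Finset.mem_map.1 hp'
    rw [Finset.mem_sigma] at hx hx'
    simp only [hι, hTi, hSi, Prod.mk.injEq] at h
    obtain ⟨h1, h2⟩ := h
    subst h2
    obtain ⟨h3, h4, h5⟩ := hBinj y x hx.2 x' hx'.2 (m - 1 - a) (by omega) b hb
      (m - 1 - a') (by omega) b' hb' (by
        rw [Nat.cast_sub (by omega : a ≤ m - 1), Nat.cast_sub (by omega : a' ≤ m - 1)]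
        linear_combination h1)
    subst h3
    exact ⟨rfl, by omega, h5⟩)
  refine ⟨f, hf, ?_⟩
  have hset : {p : ZMod n × ZMod n |
              (f (p.1 - 1, p.2)).1 = (f p).1 + (f p).2 ∧
              (f (p.1 - 1, p.2)).2 = (f p).2} = {p | f (T p) = S (f p)} := by
    ext p
    simp only [Set.mem_ofPred_eq, T, S, Prod.ext_iff]
  rw [hset]
  set g : ℕ := ({p : ZMod n × ZMod n | f (T p) = S (f p)}).ncard with hg
  -- numerical estimates
  have hnR : (1 : ℝ) ≤ n := by exact_mod_cast Nat.one_le_iff_ne_zero.2 hn0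
  have hnC : ((R + C1 + C2 + C3 : ℕ) : ℝ) ≤ n := by exact_mod_cast hn.le
  push_cast at hnC
  have hC1p : (0 : ℝ) ≤ C1 := by positivity
  have hC2p : (0 : ℝ) ≤ C2 := by positivity
  have hC3p : (0 : ℝ) ≤ C3 := by positivity
  rw [div_le_iff₀ hδ0] at hm hQ hR hC1 hC2 hC3
  have hn1 : 3 * (4 * m + Q * m) ≤ n * δ :=
    hC1.trans (mul_le_mul_of_nonneg_right (by linarith) hδ0.le)
  have hn2 : (K : ℝ) ≤ n * δ :=
    hC2.trans (mul_le_mul_of_nonneg_right (by linarith) hδ0.le)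
  have hn3 : (m : ℝ) ^ (k + 2) ≤ n * δ :=
    hC3.trans (mul_le_mul_of_nonneg_right (by linarith) hδ0.le)
  have hLR : (L : ℝ) ≤ n * δ := by
    have h1 : ((n / Q : ℕ) : ℝ) ≤ (n : ℝ) / Q := Nat.cast_div_le
    have h2 : ((n / R : ℕ) : ℝ) ≤ (n : ℝ) / R := Nat.cast_div_le
    have h3 : 3 * (m : ℝ) * (n / Q) ≤ n * δ / 3 := by
      rw [← mul_div_assoc, div_le_iff₀ (by linarith)]
      nlinarith
    have h4 : (Q : ℝ) * m * (n / R) ≤ n * δ / 3 := by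
      rw [← mul_div_assoc, div_le_iff₀ (by linarith)]
      nlinarith
    have h5 : 3 * (m : ℝ) * ((n / Q : ℕ) : ℝ) ≤ 3 * (m : ℝ) * (n / Q) := by gcongr
    have h6 : (Q : ℝ) * m * ((n / R : ℕ) : ℝ) ≤ (Q : ℝ) * m * (n / R) := by gcongr
    rw [hL]
    push_cast at h5 h6 ⊢
    nlinarith
  have hsum : ((n : ℝ) - K) * (n - L) ≤ (m : ℝ) * m * BB.card := by
    have hLn : (0 : ℝ) ≤ n - L := by nlinarith
    have h1 : ((n : ℝ) - K) ≤ ((Badᶜ).card : ℝ) := by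
      rw [Finset.card_compl, ZMod.card, Nat.cast_sub (by
        have := Finset.card_le_univ Bad
        rwa [ZMod.card] at this)]
      have : (Bad.card : ℝ) ≤ K := by exact_mod_cast hBadcard
      linarith
    calc ((n : ℝ) - K) * (n - L) ≤ ((Badᶜ).card : ℝ) * (n - L) := by gcongr
      _ = ∑ y ∈ Badᶜ, ((n : ℝ) - L) := by rw [Finset.sum_const, nsmul_eq_mul]
      _ ≤ ∑ y ∈ Badᶜ, (m : ℝ) * m * (B y).card := by
          apply Finset.sum_le_sum
          intro y hy
          have := hBcard y (Finset.mem_compl.1 hy)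
          have : (n : ℝ) ≤ m * m * (B y).card + L := by exact_mod_cast this
          linarith
      _ ≤ ∑ y, (m : ℝ) * m * (B y).card := by
          apply Finset.sum_le_sum_of_subset_of_nonneg (Finset.subset_univ _)
          intros; positivity
      _ = (m : ℝ) * m * BB.card := by
          rw [hBB, ← Finset.mul_sum]
          push_cast
          rfl
  have hcardR : ((m : ℝ) - 1) * m * BB.card ≤ g + (m : ℝ) ^ (k + 2) := by
    have : (((m - 1) * m * BB.card : ℕ) : ℝ) ≤ ((g + m ^ (k + 2) : ℕ) : ℝ) := by
      exact_mod_cast hcard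
    push_cast [Nat.cast_sub hm1] at this
    exact this
  have hA : (n : ℝ) ^ 2 * (1 - δ) ^ 2 ≤ (m : ℝ) * m * BB.card := by
    refine le_trans ?_ hsum
    have h1 : (n : ℝ) * (1 - δ) ≤ n - K := by linarith
    have h2 : (n : ℝ) * (1 - δ) ≤ n - L := by linarith
    have h3 : (0 : ℝ) ≤ n * (1 - δ) := mul_nonneg (by linarith) (by linarith)
    calc (n : ℝ) ^ 2 * (1 - δ) ^ 2 = (n * (1 - δ)) * (n * (1 - δ)) := by ring
      _ ≤ _ := mul_le_mul h1 h2 h3 (h3.trans h1)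
  have hBBm : (1 - δ) * ((m : ℝ) * m * BB.card) ≤ ((m : ℝ) - 1) * m * BB.card := by
    have : 0 ≤ (m : ℝ) * BB.card := by positivity
    nlinarith
  have hfin : (n : ℝ) ^ 2 * (1 - δ) ^ 3 ≤ g + (m : ℝ) ^ (k + 2) := by
    have := mul_le_mul_of_nonneg_left hA (by linarith : (0 : ℝ) ≤ 1 - δ)
    calc (n : ℝ) ^ 2 * (1 - δ) ^ 3 = (1 - δ) * ((n : ℝ) ^ 2 * (1 - δ) ^ 2) := by ring
      _ ≤ _ := this.trans (hBBm.trans hcardR)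
  have h4 : (n : ℝ) * δ ≤ n ^ 2 * δ := by
    apply mul_le_mul_of_nonneg_right _ hδ0.le
    nlinarith
  have h5 : 1 - 3 * δ ≤ (1 - δ) ^ 3 := by
    nlinarith [mul_nonneg (sq_nonneg δ) (by linarith : (0 : ℝ) ≤ 3 - δ)]
  have h6 : (n : ℝ) ^ 2 * (1 - 3 * δ) ≤ (n : ℝ) ^ 2 * (1 - δ) ^ 3 := by gcongr
  have h7 : (n : ℝ) ^ 2 * (4 * δ) ≤ n ^ 2 * ε := by
    gcongr
    linarith
  linarith
end

section
/- For every ε > 0 and every integer k ≥ 3 there exists C such that for all integers m and n with n positive, gcd(m,n) = 1, |m| > C and n > |m|^C, there exists a permutation f of ℤ/nℤ with f^k = id and f(x+1) = m·f(x) for at least (1−ε)n elements x ∈ ℤ/nℤ. -/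
/-- The tile. -/
abbrev WT (L : ℕ) := (Fin L → Fin L) × Fin L

/-- Lamp generator. -/
def lamW {L : ℕ} [NeZero L] (x : WT L) : WT L := (x.1 + Pi.single x.2 1, x.2)

/-- Shift generator. -/
def sigW {L : ℕ} [NeZero L] (x : WT L) : WT L := (x.1, x.2 - 1)

/-- Rotation. -/
def rotX (k : ℕ) (V : Type) : Equiv.Perm (ZMod k → V) where
  toFun x := fun i => x (i - 1)
  invFun x := fun i => x (i + 1)
  left_inv x := by funext i; simp
  right_inv x := by funext i; simp

lemma rotX_pow (k : ℕ) (V : Type) (j : ℕ) (x : ZMod k → V) (i : ZMod k) :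
    ((rotX k V) ^ j) x i = x (i - j) := by
  induction j generalizing i with
  | zero => simp
  | succ j ih =>
    rw [pow_succ', Equiv.Perm.mul_apply]
    show ((rotX k V) ^ j) x (i - 1) = _
    rw [ih]; congr 1; push_cast; ring

/-- The straightening map. -/
def psiX {L : ℕ} [NeZero L] {k : ℕ} (x : ZMod k → WT L) : ZMod k → WT L := fun i =>
  if i = -1 then ((x i).1, (x i).2 + ∑ j, (x 0).1 j)
  else if i = 1 then ((x i).1 + Pi.single (x i).2 (x 0).2, (x i).2)
  else x i

/-- The inverse straightening map. -/
def psiXinv {L : ℕ} [NeZero L] {k : ℕ} (x : ZMod k → WT L) : ZMod k → WT L := fun i =>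
  if i = -1 then ((x i).1, (x i).2 - ∑ j, (x 0).1 j)
  else if i = 1 then ((x i).1 - Pi.single (x i).2 (x 0).2, (x i).2)
  else x i

theorem model_exists (L : ℕ) [NeZero L] (k : ℕ) (hk : 3 ≤ k) :
    ∃ t : Equiv.Perm (ZMod k → WT L), t ^ k = 1 ∧
      ∀ x, t (Function.update x 0 (lamW (x 0))) = Function.update (t x) 0 (sigW (t x 0)) := by
  have : Fact (1 < k) := ⟨by omega⟩
  have : Fact (2 < k) := ⟨by omega⟩
  have h01 : (0 : ZMod k) ≠ 1 := zero_ne_one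
  have h0m : (0 : ZMod k) ≠ -1 := by
    intro h; apply h01; have := congrArg Neg.neg h; simp at this
  have h1m : (1 : ZMod k) ≠ -1 := (ZMod.neg_one_ne_one).symm
  let P : Equiv.Perm (ZMod k → WT L) :=
    { toFun := psiX
      invFun := psiXinv
      left_inv := by
        intro x; funext i
        by_cases hi : i = -1
        · simp [psiX, psiXinv, hi, h0m, h01]
        · by_cases hi' : i = 1
          · simp [psiX, psiXinv, hi', h1m, h0m, h01]
          · simp [psiX, psiXinv, hi', hi]
      right_inv := by
        intro x; funext i
        by_cases hi : i = -1
        · simp [psiX, psiXinv, hi, h0m, h01]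
        · by_cases hi' : i = 1
          · simp [psiX, psiXinv, hi', h1m, h0m, h01]
          · simp [psiX, psiXinv, hi', hi] }
  have hP : ∀ x, P x = psiX x := fun _ => rfl
  let T := rotX k (WT L)
  have hT : ∀ x i, T x i = x (i - 1) := fun _ _ => rfl
  -- the generators upstairs
  let a : (ZMod k → WT L) → (ZMod k → WT L) := fun x i =>
    if i = 0 then lamW (x 0) else if i = -1 then sigW (x (-1)) else x i
  let b : (ZMod k → WT L) → (ZMod k → WT L) := fun x i =>
    if i = 1 then lamW (x 1) else if i = 0 then sigW (x 0) else x i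
  have hTa : ∀ x, T (a x) = b (T x) := by
    intro x; funext i
    rw [hT]
    simp only [a, b, hT]
    by_cases hi : i = 1
    · simp [hi]
    · by_cases hi' : i = 0
      · simp [hi', h0m.symm, h01]
      · have h1 : i - 1 ≠ 0 := sub_ne_zero.mpr hi
        have h2 : i - 1 ≠ -1 := by intro h; apply hi'; linear_combination h
        simp [hi, hi', h1, h2]
  have hPa : ∀ x, P (a x) = Function.update (P x) 0 (lamW (P x 0)) := by
    intro x; funext i
    simp only [hP]
    by_cases hi : i = 0
    · subst hi; simp [psiX, a, h0m, h01]
    · rw [Function.update_of_ne hi]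
      by_cases hi' : i = -1
      · subst hi'
        simp [psiX, a, h0m.symm, lamW, sigW, Finset.sum_add_distrib]
      · by_cases hi2 : i = 1
        · subst hi2; simp [psiX, a, h1m, h01.symm, lamW]
        · simp [psiX, a, hi, hi', hi2]
  have hPb : ∀ x, P (b x) = Function.update (P x) 0 (sigW (P x 0)) := by
    intro x; funext i
    simp only [hP]
    by_cases hi : i = 0
    · subst hi; simp [psiX, b, h0m, h01]
    · rw [Function.update_of_ne hi]
      by_cases hi' : i = -1
      · subst hi'
        simp [psiX, b, h0m.symm, h1m.symm, h01, lamW, sigW]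
      · by_cases hi2 : i = 1
        · subst hi2
          simp [psiX, b, h1m, h01, lamW, sigW]
          rw [add_assoc, ← Pi.single_add]; simp
        · simp [psiX, b, hi, hi', hi2]
  refine ⟨P * T * P⁻¹, ?_, ?_⟩
  · have : T ^ k = 1 := by
      ext1 x; funext i; rw [rotX_pow]; simp
    rw [conj_pow, this]; simp
  · intro x
    obtain ⟨y, rfl⟩ := P.surjective x
    rw [← hPa]
    have hinv : ∀ x, P⁻¹ (P x) = x := P.symm_apply_apply
    simp only [Equiv.Perm.mul_apply, hinv]
    rw [hTa, hPb]

lemma digits_mem (n M w : ℕ) (hM : 0 < M) (H : ℕ) :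
    ∃ G : Finset ℕ, G.card ≤ (M - w) ^ H ∧ ∀ x < n,
      (∀ i < H, w ≤ (M ^ (i + 1) * x / n) % M) → M ^ H * x / n ∈ G := by
  induction H with
  | zero =>
    refine ⟨{0}, by simp, ?_⟩
    intro x hx _
    simp [Nat.div_eq_of_lt hx]
  | succ H ih =>
    obtain ⟨G, hG, hmem⟩ := ih
    refine ⟨(G ×ˢ Finset.Ico w M).image (fun p => M * p.1 + p.2), ?_, ?_⟩
    · refine Finset.card_image_le.trans ?_
      rw [Finset.card_product, Nat.card_Ico, pow_succ]
      exact Nat.mul_le_mul_right _ hG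
    · intro x hx h
      have h1 := hmem x hx (fun i hi => h i (by omega))
      rw [Finset.mem_image]
      refine ⟨(M ^ H * x / n, (M ^ (H + 1) * x / n) % M), ?_, ?_⟩
      · rw [Finset.mem_product, Finset.mem_Ico]
        exact ⟨h1, h H (by omega), Nat.mod_lt _ hM⟩
      · have : M ^ (H + 1) * x / n / M = M ^ H * x / n := by
          rw [Nat.div_div_eq_div_mul, pow_succ, mul_comm n M,
            show M ^ H * M * x = M * (M ^ H * x) by ring, Nat.mul_div_mul_left _ _ hM]
        simp only
        rw [← this]
        exact Nat.div_add_mod _ _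

lemma fiber_card (n N y : ℕ) (hn : 0 < n) (hN : 0 < N) :
    ((Finset.range n).filter (fun x => N * x / n = y)).card ≤ n / N + 1 := by
  by_cases h : ((Finset.range n).filter (fun x => N * x / n = y)).Nonempty
  · set F := (Finset.range n).filter (fun x => N * x / n = y) with hF
    set x0 := F.min' h with hx0
    have hm := F.min'_mem h
    have : F ⊆ Finset.Icc x0 (x0 + n / N) := by
      intro x hx
      have h1 : x0 ≤ x := F.min'_le _ hx
      rw [Finset.mem_Icc]
      refine ⟨h1, ?_⟩
      have e1 : N * x / n = y := (Finset.mem_filter.mp hx).2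
      have e2 : N * x0 / n = y := (Finset.mem_filter.mp hm).2
      have l1 : N * x < n * (y + 1) := by
        rw [← e1]; exact Nat.lt_mul_div_succ _ hn
      have l2 : n * y ≤ N * x0 := by rw [← e2]; exact Nat.mul_div_le _ _
      have : x - x0 ≤ n / N := by
        rw [Nat.le_div_iff_mul_le hN]
        obtain ⟨d, rfl⟩ := Nat.exists_eq_add_of_le h1
        simp only [Nat.add_sub_cancel_left]
        nlinarith
      omega
    refine (Finset.card_le_card this).trans ?_
    simp; omega
  · rw [Finset.not_nonempty_iff_eq_empty] at h
    rw [h]; simp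

lemma hit_count (n M K H : ℕ) (hn : 0 < n) (hM : 0 < M) (hK : 0 < K) :
    ((Finset.range n).filter (fun x => ∀ i < H, n < K * ((M ^ i * x) % n))).card
      ≤ (M - M / K) ^ H * (n / M ^ H + 1) := by
  obtain ⟨G, hG, hmem⟩ := digits_mem n M (M / K) hM H
  have hsub : (Finset.range n).filter (fun x => ∀ i < H, n < K * ((M ^ i * x) % n)) ⊆
      G.biUnion (fun y => (Finset.range n).filter (fun x => M ^ H * x / n = y)) := by
    intro x hx
    rw [Finset.mem_filter, Finset.mem_range] at hx
    rw [Finset.mem_biUnion]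
    refine ⟨_, hmem x hx.1 ?_, by simp [hx.1]⟩
    intro i hi
    by_contra hlt
    push Not at hlt
    have h2 := hx.2 i hi
    set r := (M ^ i * x) % n with hr
    have e : M ^ (i + 1) * x / n % M = M * r / n := by
      have : M ^ (i + 1) * x = n * (M * (M ^ i * x / n)) + M * r := by
        have := Nat.div_add_mod (M ^ i * x) n
        rw [← hr] at this
        calc M ^ (i + 1) * x = M * (M ^ i * x) := by ring
          _ = M * (n * (M ^ i * x / n) + r) := by rw [this]
          _ = _ := by ring
      rw [this, Nat.mul_add_div hn, Nat.mul_add_mod]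
      apply Nat.mod_eq_of_lt
      rw [Nat.div_lt_iff_lt_mul hn]
      exact Nat.mul_lt_mul_of_pos_left (Nat.mod_lt _ hn) hM
    rw [e, Nat.div_lt_iff_lt_mul hn] at hlt
    have h3 : M / K * K ≤ M := Nat.div_mul_le_self _ _
    have : M * (K * r) < M * n := by
      calc M * (K * r) = K * (M * r) := by ring
        _ < K * (M / K * n) := Nat.mul_lt_mul_of_pos_left hlt hK
        _ = (M / K * K) * n := by ring
        _ ≤ M * n := Nat.mul_le_mul_right _ h3
    have := Nat.lt_of_mul_lt_mul_left this
    omega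
  refine (Finset.card_le_card hsub).trans (Finset.card_biUnion_le.trans ?_)
  refine (Finset.sum_le_card_nsmul _ _ _ (fun y _ => fiber_card n (M ^ H) y hn (by positivity))).trans ?_
  rw [smul_eq_mul]
  exact Nat.mul_le_mul_right _ hG

/-- The marker interval. -/
def mkA (n R : ℕ) : Set (ZMod n) := {x | ∃ z : ℤ, (z : ZMod n) = x ∧ |z| ≤ R}

lemma mkA_neg {n R : ℕ} {x : ZMod n} (h : x ∈ mkA n R) : -x ∈ mkA n R := by
  obtain ⟨z, rfl, hz⟩ := h
  exact ⟨-z, by simp, by simpa using hz⟩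

lemma mkA_card (n R : ℕ) : (mkA n R).ncard ≤ 2 * R + 1 := by
  have : mkA n R ⊆ ((Finset.Icc (-(R : ℤ)) R).image (fun z : ℤ => (z : ZMod n)) : Finset (ZMod n)) := by
    rintro x ⟨z, rfl, hz⟩
    rw [abs_le] at hz
    simp only [Finset.coe_image, Finset.coe_Icc]
    exact ⟨z, hz, rfl⟩
  refine (Set.ncard_le_ncard this (Finset.finite_toSet _)).trans ?_
  rw [Set.ncard_coe_finset]
  refine Finset.card_image_le.trans ?_
  simp; omega

lemma mkA_bdry (n R : ℕ) (s : ℤ) :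
    ({x : ZMod n | x ∈ mkA n R ∧ x + s ∉ mkA n R}).ncard ≤ 2 * s.natAbs := by
  have : {x : ZMod n | x ∈ mkA n R ∧ x + s ∉ mkA n R} ⊆
      ((Finset.Ioc ((R : ℤ) - |s|) R ∪ Finset.Ico (-(R : ℤ)) (-R + |s|)).image
        (fun z : ℤ => (z : ZMod n)) : Finset (ZMod n)) := by
    rintro x ⟨⟨z, rfl, hz⟩, h2⟩
    simp only [Finset.coe_image]
    refine ⟨z, ?_, rfl⟩
    have h3 : ¬ |z + s| ≤ R := fun h => h2 ⟨z + s, by push_cast; rfl, h⟩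
    simp only [Finset.coe_union, Finset.coe_Ioc, Finset.coe_Ico, Set.mem_union, Set.mem_Ioc, Set.mem_Ico]
    grind
  refine (Set.ncard_le_ncard this (Finset.finite_toSet _)).trans ?_
  rw [Set.ncard_coe_finset]
  refine Finset.card_image_le.trans ((Finset.card_union_le _ _).trans ?_)
  simp only [Int.card_Ioc, Int.card_Ico, Int.abs_eq_natAbs]
  omega

lemma mkA_bdry_unit (n R : ℕ) (hn : 0 < n) (s : ℤ) (i : ℕ) (m : ℤ) (u : (ZMod n)ˣ) (hu : (u : ZMod n) = m) :
    ({x : ZMod n | ¬ ((m : ZMod n) ^ i * x ∈ mkA n R ↔ (m : ZMod n) ^ i * (x + s) ∈ mkA n R)}).ncard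
      ≤ 4 * (m.natAbs ^ i * s.natAbs) := by
  have : NeZero n := ⟨by omega⟩
  set s' : ℤ := m ^ i * s with hs'
  have hinj : Function.Injective (fun x : ZMod n => (m : ZMod n) ^ i * x) := by
    intro x y h
    simp only [← hu, ← Units.val_pow_eq_pow_val] at h
    exact (Units.mul_right_inj _).mp h
  have hinj2 : Function.Injective (fun x : ZMod n => (m : ZMod n) ^ i * (x + s)) := by
    intro x y h
    exact add_right_cancel (hinj h)
  have hsub : {x : ZMod n | ¬ ((m : ZMod n) ^ i * x ∈ mkA n R ↔ (m : ZMod n) ^ i * (x + s) ∈ mkA n R)} ⊆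
     (fun x : ZMod n => (m : ZMod n) ^ i * x) ⁻¹' {x : ZMod n | x ∈ mkA n R ∧ x + s' ∉ mkA n R} ∪
     (fun x : ZMod n => (m : ZMod n) ^ i * (x + s)) ⁻¹' {x : ZMod n | x ∈ mkA n R ∧ x + (-s' : ℤ) ∉ mkA n R} := by
    intro x hx
    simp only [Set.mem_ofPred_eq] at hx
    simp only [Set.mem_union, Set.mem_preimage, Set.mem_ofPred_eq, hs']
    push_cast
    have e1 : (m : ZMod n) ^ i * x + m ^ i * s = m ^ i * (x + s) := by ring
    have e2 : (m : ZMod n) ^ i * (x + s) + -(m ^ i * s) = m ^ i * x := by ring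
    rw [e1, e2]
    tauto
  have hp : ∀ (g : ZMod n → ZMod n), Function.Injective g → ∀ T : Set (ZMod n), (g ⁻¹' T).ncard ≤ T.ncard := by
    intro g hg T
    rw [← Set.ncard_image_of_injective _ hg]
    exact Set.ncard_le_ncard (Set.image_preimage_subset _ _) (Set.toFinite _)
  have h1 := (hp _ hinj _).trans (mkA_bdry n R s')
  have h2 := (hp _ hinj2 _).trans (mkA_bdry n R (-s'))
  have h3 : s'.natAbs = m.natAbs ^ i * s.natAbs := by rw [hs', Int.natAbs_mul, Int.natAbs_pow]
  rw [Int.natAbs_neg] at h2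
  rw [h3] at h1 h2
  refine (Set.ncard_le_ncard hsub (Set.toFinite _)).trans ((Set.ncard_union_le _ _).trans ?_)
  omega

lemma unhit_card (n K H : ℕ) (m : ℤ) (hn : 0 < n) (hm : 0 < m.natAbs) (hK : 0 < K) :
    ({x : ZMod n | ∀ i < H, (m : ZMod n) ^ i * x ∉ mkA n (n / K)}).ncard
      ≤ (m.natAbs - m.natAbs / K) ^ H * (n / m.natAbs ^ H + 1) := by
  have : NeZero n := ⟨by omega⟩
  refine le_trans ?_ (hit_count n m.natAbs K H hn hm hK)
  rw [← Set.ncard_coe_finset, ← Set.ncard_image_of_injective _ (ZMod.val_injective n)]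
  apply Set.ncard_le_ncard _ (Finset.finite_toSet _)
  rintro _ ⟨x, hx, rfl⟩
  simp only [Set.mem_ofPred_eq] at hx
  simp only [Finset.coe_filter, Finset.mem_range, Set.mem_ofPred_eq]
  refine ⟨ZMod.val_lt x, ?_⟩
  intro i hi
  by_contra hle
  push Not at hle
  apply hx i hi
  set r := m.natAbs ^ i * x.val % n with hr
  have hrA : ((r : ℕ) : ZMod n) ∈ mkA n (n / K) := by
    refine ⟨r, by simp, ?_⟩
    rw [Nat.abs_cast]
    exact_mod_cast (Nat.le_div_iff_mul_le hK).mpr (by rw [mul_comm]; exact hle)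
  have hre : ((r : ℕ) : ZMod n) = (m.natAbs : ZMod n) ^ i * x := by
    rw [hr, ZMod.natCast_mod]; push_cast; simp
  rw [hre] at hrA
  rcases Int.natAbs_eq m with h | h
  · have : (m : ZMod n) = (m.natAbs : ZMod n) := by
      conv_lhs => rw [h]
      simp only [Int.cast_natCast]
    rw [this]; exact hrA
  · have : (m : ZMod n) = -(m.natAbs : ZMod n) := by
      conv_lhs => rw [h]
      simp only [Int.cast_neg, Int.cast_natCast]
    rw [this]
    rcases Nat.even_or_odd i with he | ho
    · rw [he.neg_pow]; exact hrA
    · rw [ho.neg_pow, neg_mul]; exact mkA_neg hrA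

lemma boxing (L M n : ℕ) (m : ℤ) (hL : 0 < L) (hM : m.natAbs = M) (hM0 : 0 < M) :
    ∃ base : Fin (n / M ^ L) × (Fin L → Fin (M / L)) → ℤ,
      Function.Injective (fun p : (Fin (n / M ^ L) × (Fin L → Fin (M / L))) × (Fin L → Fin L) =>
        ((base p.1 + ∑ j, ((p.2 j : ℕ) : ℤ) * m ^ (j : ℕ) : ℤ) : ZMod n)) := by
  classical
  let r : Fin L → Fin L → ℕ := fun j c => if 0 ≤ m ^ (j : ℕ) then (c : ℕ) else L - 1 - c
  have hr : ∀ j c, r j c < L := by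
    intro j c; have := c.2; simp only [r]; split_ifs <;> omega
  have hrinj : ∀ j c c', r j c = r j c' → c = c' := by
    intro j c c' h
    have := c.2; have := c'.2
    simp only [r] at h
    ext
    split_ifs at h <;> omega
  have hv : ∀ (d : Fin L → Fin (M / L)) (c : Fin L → Fin L) (j : Fin L), L * (d j : ℕ) + r j (c j) < M := by
    intro d c j
    have h1 := hr j (c j)
    have h2 : (d j : ℕ) + 1 ≤ M / L := (d j).2
    have h3 : L * ((d j : ℕ) + 1) ≤ L * (M / L) := Nat.mul_le_mul_left _ h2
    have h4 := Nat.mul_div_le M L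
    rw [mul_add] at h3
    omega
  let v : (Fin L → Fin (M / L)) → (Fin L → Fin L) → Fin L → Fin M := fun d c j => ⟨_, hv d c j⟩
  let N : (Fin (n / M ^ L) × (Fin L → Fin (M / L))) × (Fin L → Fin L) → ℕ := fun p =>
    M ^ L * (p.1.1 : ℕ) + (finFunctionFinEquiv (v p.1.2 p.2) : ℕ)
  have hN : ∀ p, N p < n := by
    intro p
    have h1 := (finFunctionFinEquiv (v p.1.2 p.2)).2
    have h2 : (p.1.1 : ℕ) + 1 ≤ n / M ^ L := p.1.1.2
    have h3 := Nat.mul_le_mul_left (M ^ L) h2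
    have h4 := Nat.mul_div_le n (M ^ L)
    simp only [N]
    rw [mul_add] at h3
    omega
  have hNinj : Function.Injective N := by
    rintro ⟨⟨h, d⟩, c⟩ ⟨⟨h', d'⟩, c'⟩ he
    simp only [N] at he
    have hp : 0 < M ^ L := by positivity
    have l1 := (finFunctionFinEquiv (v d c)).2
    have l2 := (finFunctionFinEquiv (v d' c')).2
    have e1 : (h : ℕ) = h' := by
      generalize ((finFunctionFinEquiv (v d c) : Fin (M ^ L)) : ℕ) = X at he l1
      generalize ((finFunctionFinEquiv (v d' c') : Fin (M ^ L)) : ℕ) = Y at he l2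
      have := congrArg (· / M ^ L) he
      simpa [Nat.mul_add_div hp, Nat.div_eq_of_lt l1, Nat.div_eq_of_lt l2] using this
    have e2 : finFunctionFinEquiv (v d c) = finFunctionFinEquiv (v d' c') := by
      ext; rw [e1] at he; omega
    have e3 := finFunctionFinEquiv.injective e2
    have e4 : ∀ j, L * (d j : ℕ) + r j (c j) = L * (d' j : ℕ) + r j (c' j) := by
      intro j; exact congrArg Fin.val (congrFun e3 j)
    have e5 : ∀ j, (d j : ℕ) = d' j := by
      intro j
      have := congrArg (· / L) (e4 j)
      simpa [Nat.mul_add_div hL, Nat.div_eq_of_lt (hr _ _)] using this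
    have e6 : c = c' := by
      funext j; apply hrinj j; have := e4 j; rw [e5 j] at this; omega
    have e7 : d = d' := by funext j; ext; exact e5 j
    have e8 : h = h' := by ext; exact e1
    rw [e6, e7, e8]
  refine ⟨fun b => (M : ℤ) ^ L * (b.1 : ℕ) +
    ∑ j, ((L : ℤ) * (b.2 j : ℕ) + if 0 ≤ m ^ (j : ℕ) then 0 else (L : ℤ) - 1) * (M : ℤ) ^ (j : ℕ), ?_⟩
  have key : ∀ p : (Fin (n / M ^ L) × (Fin L → Fin (M / L))) × (Fin L → Fin L),
      ((M : ℤ) ^ L * (p.1.1 : ℕ) +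
    ∑ j, ((L : ℤ) * (p.1.2 j : ℕ) + if 0 ≤ m ^ (j : ℕ) then 0 else (L : ℤ) - 1) * (M : ℤ) ^ (j : ℕ))
      + ∑ j, ((p.2 j : ℕ) : ℤ) * m ^ (j : ℕ) = (N p : ℤ) := by
    intro p
    simp only [N, finFunctionFinEquiv_apply]
    push_cast
    rw [add_assoc, ← Finset.sum_add_distrib]
    congr 1
    apply Finset.sum_congr rfl
    intro j _
    have hpow : (M : ℤ) ^ (j : ℕ) = |m ^ (j : ℕ)| := by
      rw [abs_pow, Int.abs_eq_natAbs, hM]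
    have hc := (p.2 j).2
    simp only [v, r]
    rw [hpow]
    split_ifs with h0
    · rw [abs_of_nonneg h0]; push_cast; ring
    · rw [abs_of_neg (not_le.mp h0)]
      rw [Nat.cast_add, Nat.cast_sub (by omega), Nat.cast_sub (by omega)]
      push_cast; ring
  intro p p' h
  simp only [key] at h
  apply hNinj
  simp only [Int.cast_natCast] at h
  rw [ZMod.natCast_eq_natCast_iff'] at h
  rwa [Nat.mod_eq_of_lt (hN _), Nat.mod_eq_of_lt (hN _)] at h

lemma boxing' (L M n : ℕ) (m : ℤ) (hL : 0 < L) (hM : m.natAbs = M) (hM0 : 0 < M) :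
    ∃ (β : Type) (_ : Fintype β) (base : β → ℤ), Nat.card β = n / M ^ L * (M / L) ^ L ∧
      Function.Injective (fun p : β × (Fin L → Fin L) =>
        ((base p.1 + ∑ j, ((p.2 j : ℕ) : ℤ) * m ^ (j : ℕ) : ℤ) : ZMod n)) := by
  obtain ⟨base, hb⟩ := boxing L M n m hL hM hM0
  exact ⟨_, inferInstance, base, by simp, hb⟩

lemma ncard_iUnion_le_mul {α ι : Type*} [Fintype ι] [Finite α] (s : ι → Set α) (B : ℕ)
    (h : ∀ i, (s i).ncard ≤ B) : (⋃ i, s i).ncard ≤ Fintype.card ι * B := by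
  classical
  have := Fintype.ofFinite α
  have e : (⋃ i, s i) = ((Finset.univ.biUnion (fun i => (s i).toFinset) : Finset α) : Set α) := by
    ext x; simp
  rw [e, Set.ncard_coe_finset]
  refine Finset.card_biUnion_le.trans ?_
  refine (Finset.sum_le_card_nsmul _ _ B (fun i _ => ?_)).trans ?_
  · rw [← Set.ncard_eq_toFinset_card']; exact h i
  · simp

/-- Points whose first hitting time of the marker is `< H` and divisible by `L`. -/
def hitS (n R L H : ℕ) (m : ℤ) : Set (ZMod n) :=
  {x | ∃ i < H, L ∣ i ∧ (m : ZMod n) ^ i * x ∈ mkA n R ∧ ∀ j < i, (m : ZMod n) ^ j * x ∉ mkA n R}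

lemma hitS_congr {n R L H : ℕ} {m : ℤ} {x y : ZMod n} (hx : x ∈ hitS n R L H m)
    (h : ∀ i < H, ((m : ZMod n) ^ i * x ∈ mkA n R ↔ (m : ZMod n) ^ i * y ∈ mkA n R)) :
    y ∈ hitS n R L H m := by
  obtain ⟨i, hi, hd, h1, h2⟩ := hx
  exact ⟨i, hi, hd, (h i hi).mp h1, fun j hj hy => h2 j hj ((h j (hj.trans hi)).mpr hy)⟩

lemma hitS_card (n K L H : ℕ) (m : ℤ) (u : (ZMod n)ˣ) (hu : (u : ZMod n) = m) (hn : 0 < n)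
    (hm : 0 < m.natAbs) (hK : 0 < K) (hL : 0 < L) :
    n ≤ (m.natAbs - m.natAbs / K) ^ H * (n / m.natAbs ^ H + 1)
      + L * (hitS n (n / K) L H m).ncard := by
  classical
  have : NeZero n := ⟨by omega⟩
  set A := mkA n (n / K) with hA
  have hsub : (Set.univ : Set (ZMod n)) ⊆ {x : ZMod n | ∀ i < H, (m : ZMod n) ^ i * x ∉ A} ∪
      ⋃ i : Fin L, (fun x : ZMod n => (m : ZMod n) ^ (i : ℕ) * x) ⁻¹' (hitS n (n / K) L H m) := by
    intro x _
    by_cases h : ∀ i < H, (m : ZMod n) ^ i * x ∉ A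
    · left; exact h
    · right
      push Not at h
      have hex : ∃ i, i < H ∧ (m : ZMod n) ^ i * x ∈ A := h
      set p := Nat.find hex with hp
      obtain ⟨hp1, hp2⟩ := Nat.find_spec hex
      rw [← hp] at hp1 hp2
      rw [Set.mem_iUnion]
      refine ⟨⟨p % L, Nat.mod_lt _ hL⟩, ?_⟩
      have hdm := Nat.div_add_mod p L
      refine ⟨L * (p / L), by omega, Dvd.intro _ rfl, ?_, ?_⟩
      · simp only
        rw [← mul_assoc, ← pow_add, hdm]; exact hp2
      · intro j hj hc
        simp only at hc
        rw [← mul_assoc, ← pow_add] at hc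
        exact Nat.find_min hex (m := j + p % L) (by omega) ⟨by omega, hc⟩
  have hinj : ∀ i : ℕ, Function.Injective (fun x : ZMod n => (m : ZMod n) ^ i * x) := by
    intro i x y h
    simp only [← hu, ← Units.val_pow_eq_pow_val] at h
    exact (Units.mul_right_inj _).mp h
  have hle := (Set.ncard_le_ncard hsub (Set.toFinite _)).trans (Set.ncard_union_le _ _)
  rw [Set.ncard_univ, Nat.card_zmod] at hle
  have h1 := unhit_card n K H m hn hm hK
  rw [← hA] at h1
  have h2 := ncard_iUnion_le_mul
    (fun i : Fin L => (fun x : ZMod n => (m : ZMod n) ^ (i : ℕ) * x) ⁻¹' (hitS n (n / K) L H m))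
    (hitS n (n / K) L H m).ncard (by
      intro i
      rw [← Set.ncard_image_of_injective _ (hinj i)]
      exact Set.ncard_le_ncard (Set.image_preimage_subset _ _) (Set.toFinite _))
  rw [Fintype.card_fin] at h2
  omega

theorem tile_core (L K H n : ℕ) [NeZero L] (m : ℤ) (u : (ZMod n)ˣ) (hu : (u : ZMod n) = m)
    (hn : 0 < n) (hm : 0 < m.natAbs) (hK : 0 < K) :
    ∃ (q : ℕ) (ψ : Fin q × WT L → ZMod n), Function.Injective ψ ∧
      (∀ b w, ((w.1 w.2 : Fin L) : ℕ) + 1 < L → ψ (b, lamW w) = ψ (b, w) + 1) ∧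
      (∀ b w, w.2 ≠ 0 → ψ (b, sigW w) = m * ψ (b, w)) ∧
      n ≤ q * (L ^ L * L) + (m.natAbs - m.natAbs / K) ^ H * (n / m.natAbs ^ H + 1)
        + L * ((n - (n / m.natAbs ^ L * (m.natAbs / L) ^ L) * L ^ L)
          + (L ^ L * L ^ L) * (H * (4 * (m.natAbs ^ H * (L * (L * m.natAbs ^ L)))))
          + (L ^ L * L ^ L) * (L * (2 * (n / K) + 1))) := by
  classical
  have hL : 0 < L := Nat.pos_of_ne_zero (NeZero.ne L)
  have : NeZero n := ⟨by omega⟩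
  set M := m.natAbs with hMdef
  set A := mkA n (n / K) with hA
  set S := hitS n (n / K) L H m with hS
  obtain ⟨β, hfin, base, hβ, hbase⟩ := boxing' L M n m hL rfl hm
  let Φ : β × (Fin L → Fin L) → ZMod n := fun p =>
    ((base p.1 + ∑ j, ((p.2 j : ℕ) : ℤ) * m ^ (j : ℕ) : ℤ) : ZMod n)
  have hΦ : Function.Injective Φ := hbase
  let Δ : (Fin L → Fin L) → (Fin L → Fin L) → ℤ := fun c c' =>
    ∑ j, (((c' j : ℕ) : ℤ) - ((c j : ℕ) : ℤ)) * m ^ (j : ℕ)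
  have hΔ : ∀ b c c', Φ (b, c') = Φ (b, c) + (Δ c c' : ℤ) := by
    intro b c c'
    simp only [Φ, Δ]
    rw [← Int.cast_add]
    congr 1
    rw [add_assoc, ← Finset.sum_add_distrib]
    congr 1
    apply Finset.sum_congr rfl
    intro j _; ring
  have hΔb : ∀ c c', (Δ c c').natAbs ≤ L * (L * M ^ L) := by
    intro c c'
    simp only [Δ]
    refine (Int.natAbs_sum_le _ _).trans ?_
    refine (Finset.sum_le_card_nsmul _ _ (L * M ^ L) (fun j _ => ?_)).trans ?_
    · rw [Int.natAbs_mul, Int.natAbs_pow]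
      have := (c j).2
      have := (c' j).2
      exact Nat.mul_le_mul (by omega) (Nat.pow_le_pow_right hm j.2.le)
    · simp
  let good : Set (ZMod n) := {z | z ∈ S ∧ ∀ i < L, 1 ≤ i → ((u⁻¹ ^ i : (ZMod n)ˣ) : ZMod n) * z ∉ A}
  let 𝓑 : Set β := {b | ∀ c, Φ (b, c) ∈ good}
  let e : Fin (Nat.card 𝓑) ≃ 𝓑 := (Finite.equivFin 𝓑).symm
  let ψ : Fin (Nat.card 𝓑) × WT L → ZMod n := fun p =>
    ((u⁻¹ ^ (p.2.2 : ℕ) : (ZMod n)ˣ) : ZMod n) * Φ ((e p.1 : β), p.2.1)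
  have hgood : ∀ z z', z ∈ good → z' ∈ good → ∀ i < L, ∀ i' < L, i < i' →
      ((u⁻¹ ^ i : (ZMod n)ˣ) : ZMod n) * z = ((u⁻¹ ^ i' : (ZMod n)ˣ) : ZMod n) * z' → False := by
    intro z z' hz hz' i hi i' hi' hlt h
    obtain ⟨d, rfl⟩ := Nat.exists_eq_add_of_lt hlt
    have hz2 : z = ((u⁻¹ ^ (d + 1) : (ZMod n)ˣ) : ZMod n) * z' := by
      rw [add_assoc, pow_add, Units.val_mul, mul_assoc] at h
      exact (Units.mul_right_inj _).mp h
    obtain ⟨⟨p', hp', hdv', hA', hmin'⟩, hno'⟩ := hz'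
    obtain ⟨⟨p, hp, hdv, hAp, hmin⟩, hno⟩ := hz
    -- relation of the orbits
    have rel1 : ∀ j, (m : ZMod n) ^ (j + (d + 1)) * z = (m : ZMod n) ^ j * z' := by
      intro j
      rw [hz2, ← hu, pow_add, ← mul_assoc, mul_assoc ((u : ZMod n) ^ j), ← Units.val_pow_eq_pow_val u (d + 1),
        ← Units.val_mul, ← mul_pow]
      simp
    have rel2 : ∀ j, j < d + 1 → (m : ZMod n) ^ j * z = ((u⁻¹ ^ (d + 1 - j) : (ZMod n)ˣ) : ZMod n) * z' := by
      intro j hj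
      obtain ⟨r, hr⟩ := Nat.exists_eq_add_of_lt hj
      have : d + 1 - j = r + 1 := by omega
      rw [this, hz2, hr, ← hu, ← Units.val_pow_eq_pow_val, ← mul_assoc, ← Units.val_mul, add_assoc, pow_add,
        ← mul_assoc, ← mul_pow]
      simp
    have hpge : d + 1 ≤ p := by
      by_contra hcon
      push Not at hcon
      rw [rel2 p hcon] at hAp
      exact hno' _ (by omega) (by omega) hAp
    obtain ⟨r, rfl⟩ := Nat.exists_eq_add_of_le' hpge
    rw [rel1] at hAp
    have hrp : r = p' := by
      rcases lt_trichotomy r p' with h1 | h1 | h1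
      · exact absurd hAp (hmin' r h1)
      · exact h1
      · exfalso
        apply hmin (p' + (d + 1)) (by omega)
        rw [rel1]; exact hA'
    subst hrp
    have := (Nat.dvd_add_right hdv').mp hdv
    have := Nat.le_of_dvd (by omega) this
    omega
  refine ⟨Nat.card 𝓑, ψ, ?_, ?_, ?_, ?_⟩
  · rintro ⟨b, c, p⟩ ⟨b', c', p'⟩ h
    have g1 : Φ ((e b : β), c) ∈ good := (e b).2 c
    have g2 : Φ ((e b' : β), c') ∈ good := (e b').2 c'
    simp only [ψ] at h
    have hpp : p = p' := by
      rcases lt_trichotomy (p : ℕ) p' with h1 | h1 | h1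
      · exact (hgood _ _ g1 g2 _ p.2 _ p'.2 h1 h).elim
      · ext; exact h1
      · exact (hgood _ _ g2 g1 _ p'.2 _ p.2 h1 h.symm).elim
    subst hpp
    have h2 := hΦ ((Units.mul_right_inj _).mp h)
    rw [Prod.mk.injEq] at h2
    have h3 := e.injective (Subtype.ext h2.1)
    rw [h3, h2.2]
  · rintro b ⟨c, p⟩ hlt
    simp only at hlt
    simp only [ψ, lamW]
    rw [hΔ _ c]
    have hd : Δ c (c + Pi.single p 1) = m ^ (p : ℕ) := by
      simp only [Δ]
      rw [Finset.sum_eq_single p]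
      · have : (c + Pi.single p 1 : Fin L → Fin L) p = c p + 1 := by simp
        rw [this]
        have : ((c p + 1 : Fin L) : ℕ) = c p + 1 := by
          rw [Fin.val_add_eq_of_add_lt]
          · congr 1
            rw [Fin.val_one']; exact Nat.mod_eq_of_lt (by omega)
          · rw [Fin.val_one', Nat.mod_eq_of_lt (by omega)]; exact hlt
        rw [this]; push_cast; ring
      · intro j _ hj
        simp [hj]
      · simp
    rw [hd, mul_add]
    congr 1
    push_cast
    rw [← hu, ← Units.val_pow_eq_pow_val, ← Units.val_pow_eq_pow_val, ← Units.val_mul]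
    simp
  · rintro b ⟨c, p⟩ hp
    simp only at hp
    simp only [ψ, sigW]
    have hp0 : (p : ℕ) ≠ 0 := fun h => hp (Fin.ext (by simpa using h))
    have : ((p - 1 : Fin L) : ℕ) = p - 1 := by
      have hp2 := p.2
      have h1 : ((1 : Fin L) : ℕ) = 1 := by rw [Fin.val_one']; exact Nat.mod_eq_of_lt (by omega)
      rw [Fin.sub_val_of_le (Fin.le_def.mpr (by omega)), h1]
    rw [this]
    obtain ⟨r, hr⟩ := Nat.exists_eq_succ_of_ne_zero hp0
    rw [hr, ← hu, ← mul_assoc, ← Units.val_mul, Nat.succ_sub_one, pow_succ']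
    simp
  · have hc := hitS_card n K L H m u hu hn hm hK hL
    rw [← hMdef, ← hS] at hc
    have hsub : S ⊆ (Φ '' (𝓑 ×ˢ Set.univ) ∪ (Set.range Φ)ᶜ) ∪
        ((⋃ cc : (Fin L → Fin L) × (Fin L → Fin L), ⋃ i : Fin H,
          {x : ZMod n | ¬ ((m : ZMod n) ^ (i : ℕ) * x ∈ A ↔ (m : ZMod n) ^ (i : ℕ) * (x + (Δ cc.1 cc.2 : ℤ)) ∈ A)}) ∪
        (⋃ cc : (Fin L → Fin L) × (Fin L → Fin L), ⋃ i : Fin L,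
          (fun x : ZMod n => ((u⁻¹ ^ (i : ℕ) : (ZMod n)ˣ) : ZMod n) * (x + (Δ cc.1 cc.2 : ℤ))) ⁻¹' A)) := by
      intro z hz
      by_cases hr : z ∈ Set.range Φ
      · obtain ⟨⟨b, c⟩, rfl⟩ := hr
        by_cases hb : b ∈ 𝓑
        · left; left; exact ⟨(b, c), ⟨hb, trivial⟩, rfl⟩
        · right
          have hb' : ∃ c', Φ (b, c') ∉ good := by
            by_contra hcon; push Not at hcon; exact hb hcon
          obtain ⟨c', hc'⟩ := hb'
          by_cases hS' : Φ (b, c') ∈ S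
          · right
            have : ∃ i < L, 1 ≤ i ∧ ((u⁻¹ ^ i : (ZMod n)ˣ) : ZMod n) * Φ (b, c') ∈ A := by
              by_contra hcon; push Not at hcon; exact hc' ⟨hS', hcon⟩
            obtain ⟨i, hi, -, hiA⟩ := this
            rw [hΔ b c c'] at hiA
            exact Set.mem_iUnion.mpr ⟨(c, c'), Set.mem_iUnion.mpr ⟨⟨i, hi⟩, hiA⟩⟩
          · left
            have : ∃ i < H, ¬ ((m : ZMod n) ^ i * Φ (b, c) ∈ A ↔ (m : ZMod n) ^ i * Φ (b, c') ∈ A) := by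
              by_contra hcon; push Not at hcon; exact hS' (hitS_congr hz hcon)
            obtain ⟨i, hi, hiA⟩ := this
            rw [hΔ b c c'] at hiA
            exact Set.mem_iUnion.mpr ⟨(c, c'), Set.mem_iUnion.mpr ⟨⟨i, hi⟩, hiA⟩⟩
      · left; right; exact hr
    have hle := (Set.ncard_le_ncard hsub (Set.toFinite _)).trans (Set.ncard_union_le _ _)
    have hle1 := Set.ncard_union_le (Φ '' (𝓑 ×ˢ Set.univ)) (Set.range Φ)ᶜ
    have c1 : (Φ '' (𝓑 ×ˢ Set.univ)).ncard = Nat.card 𝓑 * L ^ L := by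
      rw [Set.ncard_image_of_injective _ hΦ, Set.ncard_prod, Set.ncard_univ, Nat.card_coe_set_eq]
      simp
    have c2 : ((Set.range Φ)ᶜ).ncard = n - (n / M ^ L * (M / L) ^ L) * L ^ L := by
      rw [Set.ncard_compl, Nat.card_zmod, ← Set.image_univ, Set.ncard_image_of_injective _ hΦ, Set.ncard_univ]
      rw [Nat.card_prod, hβ]; simp
    have c3 := ncard_iUnion_le_mul (fun cc : (Fin L → Fin L) × (Fin L → Fin L) => ⋃ i : Fin H,
          {x : ZMod n | ¬ ((m : ZMod n) ^ (i : ℕ) * x ∈ A ↔ (m : ZMod n) ^ (i : ℕ) * (x + (Δ cc.1 cc.2 : ℤ)) ∈ A)})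
          (H * (4 * (M ^ H * (L * (L * M ^ L))))) (by
      intro cc
      refine (ncard_iUnion_le_mul _ (4 * (M ^ H * (L * (L * M ^ L)))) ?_).trans_eq (by rw [Fintype.card_fin])
      intro i
      refine (mkA_bdry_unit n (n / K) hn _ i m u hu).trans ?_
      have := hΔb cc.1 cc.2
      have h2 : M ^ (i : ℕ) ≤ M ^ H := Nat.pow_le_pow_right hm i.2.le
      exact Nat.mul_le_mul_left _ (Nat.mul_le_mul h2 this))
    have c4 := ncard_iUnion_le_mul (fun cc : (Fin L → Fin L) × (Fin L → Fin L) => ⋃ i : Fin L,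
          (fun x : ZMod n => ((u⁻¹ ^ (i : ℕ) : (ZMod n)ˣ) : ZMod n) * (x + (Δ cc.1 cc.2 : ℤ))) ⁻¹' A)
          (L * (2 * (n / K) + 1)) (by
      intro cc
      refine (ncard_iUnion_le_mul _ (2 * (n / K) + 1) ?_).trans_eq (by rw [Fintype.card_fin])
      intro i
      refine le_trans ?_ (mkA_card n (n / K))
      have hinj : Function.Injective (fun x : ZMod n => ((u⁻¹ ^ (i : ℕ) : (ZMod n)ˣ) : ZMod n) * (x + (Δ cc.1 cc.2 : ℤ))) := by
        intro x y h
        exact add_right_cancel ((Units.mul_right_inj _).mp h)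
      rw [← Set.ncard_image_of_injective _ hinj]
      exact Set.ncard_le_ncard (Set.image_preimage_subset _ _) (Set.toFinite _))
    have hcard : Fintype.card ((Fin L → Fin L) × (Fin L → Fin L)) = L ^ L * L ^ L := by simp
    rw [hcard] at c3 c4
    have c5 := hle.trans (add_le_add hle1 ((Set.ncard_union_le _ _).trans (add_le_add c3 c4)))
    rw [c1, c2] at c5
    have c6 := Nat.mul_le_mul_left L c5
    refine hc.trans ((Nat.add_le_add_left c6 _).trans (le_of_eq ?_))
    ring

lemma err_one (n M K H : ℕ) (hM : 0 < M) (hK : 0 < K) (hKM : K ≤ M) (hH : M ^ H ≤ n) :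
    (((M - M / K) ^ H * (n / M ^ H + 1) : ℕ) : ℝ) ≤ 2 * (1 - 1 / (2 * K : ℝ)) ^ H * n := by
  have hMr : (0 : ℝ) < M := by exact_mod_cast hM
  have hKr : (0 : ℝ) < K := by exact_mod_cast hK
  have h1 : (M : ℝ) / (2 * K) ≤ ((M / K : ℕ) : ℝ) := by
    have a1 : 1 ≤ M / K := Nat.div_pos hKM hK
    have a2 : M < K * (M / K + 1) := Nat.lt_mul_div_succ _ hK
    have a3 : (M : ℝ) < K * (((M / K : ℕ) : ℝ) + 1) := by exact_mod_cast a2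
    have a4 : (1 : ℝ) ≤ ((M / K : ℕ) : ℝ) := by exact_mod_cast a1
    rw [div_le_iff₀ (by positivity)]
    nlinarith
  have h2 : ((M - M / K : ℕ) : ℝ) ≤ M * (1 - 1 / (2 * K : ℝ)) := by
    rw [Nat.cast_sub (Nat.div_le_self _ _)]
    have : (M : ℝ) * (1 - 1 / (2 * K : ℝ)) = M - M / (2 * K) := by ring
    rw [this]; linarith
  have h3 : ((M - M / K : ℕ) : ℝ) ^ H ≤ (M : ℝ) ^ H * (1 - 1 / (2 * K : ℝ)) ^ H := by
    rw [← mul_pow]; exact pow_le_pow_left₀ (by positivity) h2 H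
  have h0 : (0 : ℝ) ≤ 1 - 1 / (2 * K : ℝ) := by
    have : (1 : ℝ) ≤ K := by exact_mod_cast hK
    rw [sub_nonneg, div_le_one (by positivity)]; linarith
  have h4 : (((n / M ^ H + 1 : ℕ)) : ℝ) * (M : ℝ) ^ H ≤ 2 * n := by
    have : (n / M ^ H + 1) * M ^ H ≤ 2 * n := by
      have := Nat.div_mul_le_self n (M ^ H)
      rw [add_mul]; omega
    exact_mod_cast this
  push_cast at h4 ⊢
  calc ((M - M / K : ℕ) : ℝ) ^ H * (((n / M ^ H : ℕ) : ℝ) + 1)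
      ≤ ((M : ℝ) ^ H * (1 - 1 / (2 * K : ℝ)) ^ H) * (((n / M ^ H : ℕ) : ℝ) + 1) :=
        mul_le_mul_of_nonneg_right h3 (by positivity)
    _ = (1 - 1 / (2 * K : ℝ)) ^ H * ((((n / M ^ H : ℕ) : ℝ) + 1) * (M : ℝ) ^ H) := by ring
    _ ≤ (1 - 1 / (2 * K : ℝ)) ^ H * (2 * n) := mul_le_mul_of_nonneg_left h4 (pow_nonneg h0 _)
    _ = _ := by ring

lemma err_two (n M L : ℕ) (hL : 0 < L) (hLM : L ≤ M) :
    ((n - (n / M ^ L * (M / L) ^ L) * L ^ L : ℕ) : ℝ) ≤ (M : ℝ) ^ L + n * (L ^ 2 / M) := by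
  have hM : 0 < M := by omega
  have hMr : (0 : ℝ) < M := by exact_mod_cast hM
  have hLr : (L : ℝ) ≤ M := by exact_mod_cast hLM
  have hbL : M / L * L ≤ M := Nat.div_mul_le_self _ _
  have e : n / M ^ L * (M / L) ^ L * L ^ L = n / M ^ L * (M / L * L) ^ L := by rw [mul_pow]; ring
  rw [e]
  have hle : n / M ^ L * (M / L * L) ^ L ≤ n :=
    (Nat.mul_le_mul_left _ (Nat.pow_le_pow_left hbL L)).trans (Nat.div_mul_le_self _ _)
  rw [Nat.cast_sub hle]
  push_cast
  set a : ℝ := ((n / M ^ L : ℕ) : ℝ) with ha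
  have ha0 : 0 ≤ a := by positivity
  have ha1 : a * (M : ℝ) ^ L ≤ n := by rw [ha]; exact_mod_cast Nat.div_mul_le_self n (M ^ L)
  have ha2 : (n : ℝ) - (M : ℝ) ^ L ≤ a * (M : ℝ) ^ L := by
    have : n ≤ M ^ L * (n / M ^ L + 1) := (Nat.lt_mul_div_succ n (by positivity)).le
    have : (n : ℝ) ≤ (M : ℝ) ^ L * (a + 1) := by rw [ha]; exact_mod_cast this
    linarith
  have hb : (M : ℝ) - L ≤ ((M / L : ℕ) : ℝ) * L := by
    have : M ≤ L * (M / L + 1) := (Nat.lt_mul_div_succ M hL).le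
    have : (M : ℝ) ≤ (L : ℝ) * (((M / L : ℕ) : ℝ) + 1) := by exact_mod_cast this
    linarith
  have hp : (M : ℝ) ^ L * (1 - L ^ 2 / M) ≤ (((M / L : ℕ) : ℝ) * L) ^ L := by
    have h1 : ((M : ℝ) - L) ^ L ≤ (((M / L : ℕ) : ℝ) * L) ^ L :=
      pow_le_pow_left₀ (by linarith) hb L
    have h2 : (1 : ℝ) + (L : ℝ) * (-(L / M)) ≤ (1 + -(L / M : ℝ)) ^ L :=
      one_add_mul_le_pow (by
        have : (L : ℝ) / M ≤ 1 := by rw [div_le_one hMr]; exact hLr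
        linarith) L
    have h3 : (M : ℝ) - L = M * (1 + -(L / M : ℝ)) := by field_simp; ring
    rw [h3, mul_pow] at h1
    refine le_trans (mul_le_mul_of_nonneg_left ?_ (by positivity)) h1
    refine le_trans (le_of_eq ?_) h2
    ring
  have h5 := mul_le_mul_of_nonneg_left hp ha0
  have h6 : a * (M : ℝ) ^ L * (L ^ 2 / M) ≤ n * (L ^ 2 / M) :=
    mul_le_mul_of_nonneg_right ha1 (by positivity)
  nlinarith

theorem tile_exists (L : ℕ) [NeZero L] (η : ℝ) (hη : 0 < η) :
    ∃ C : ℕ, ∀ (m : ℤ) (n : ℕ), 0 < n → Int.gcd m n = 1 →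
      (C : ℤ) < |m| → |m| ^ C < (n : ℤ) →
    ∃ (q : ℕ) (ψ : Fin q × WT L → ZMod n), Function.Injective ψ ∧
      (∀ b w, ((w.1 w.2 : Fin L) : ℕ) + 1 < L → ψ (b, lamW w) = ψ (b, w) + 1) ∧
      (∀ b w, w.2 ≠ 0 → ψ (b, sigW w) = m * ψ (b, w)) ∧
      (1 - η) * n ≤ ((q * (L ^ L * L) : ℕ) : ℝ) := by
  have hL : 0 < L := Nat.pos_of_ne_zero (NeZero.ne L)
  have hLr : (0 : ℝ) < L := by exact_mod_cast hL
  set P : ℝ := (L : ℝ) ^ L with hP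
  have hP0 : 0 < P := by positivity
  obtain ⟨K, hK⟩ := exists_nat_gt (max 1 (2 * L ^ 2 * P ^ 2 * (4 / η)))
  have hK1 : (1 : ℝ) < K := lt_of_le_of_lt (le_max_left _ _) hK
  have hK2 : 2 * L ^ 2 * P ^ 2 * (4 / η) < K := lt_of_le_of_lt (le_max_right _ _) hK
  have hK0 : 0 < K := by
    have : (0 : ℝ) < K := by linarith
    exact_mod_cast this
  have hθ0 : (0 : ℝ) ≤ 1 - 1 / (2 * K : ℝ) := by
    rw [sub_nonneg, div_le_one (by positivity)]; linarith
  have hθ1 : 1 - 1 / (2 * K : ℝ) < 1 := by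
    have : 0 < 1 / (2 * K : ℝ) := by positivity
    linarith
  obtain ⟨H, hH⟩ := exists_pow_lt_of_lt_one (show (0 : ℝ) < η / 8 by positivity) hθ1
  obtain ⟨C0, hC0⟩ := exists_nat_gt ((2 * L ^ 3 + 4 * L ^ 3 * P ^ 2 * H + L ^ 2 * P ^ 2) * (4 / η))
  refine ⟨C0 + K + H + L + 1, ?_⟩
  intro m n hn hg hm1 hm2
  set M := m.natAbs with hM
  rw [Int.abs_eq_natAbs, ← hM] at hm1 hm2
  have hm1' : C0 + K + H + L + 1 < M := by exact_mod_cast hm1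
  have hm2' : M ^ (C0 + K + H + L + 1) < n := by exact_mod_cast hm2
  have hM0 : 0 < M := by omega
  have hMr : (0 : ℝ) < M := by exact_mod_cast hM0
  have hu : IsUnit (m : ZMod n) := by
    have : IsCoprime m n := Int.isCoprime_iff_gcd_eq_one.mpr hg
    obtain ⟨a, b, hab⟩ := this
    have h := congrArg (Int.cast : ℤ → ZMod n) hab
    push_cast at h
    rw [ZMod.natCast_self, mul_zero, add_zero] at h
    exact IsUnit.of_mul_eq_one_right _ h
  obtain ⟨u, hu⟩ := hu
  obtain ⟨q, ψ, h1, h2, h3, h4⟩ := tile_core L K H n m u hu hn hM0 hK0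
  refine ⟨q, ψ, h1, h2, h3, ?_⟩
  rw [← hM] at h4
  have hpow : ∀ r, r ≤ H + L + 1 → M ^ r ≤ n := fun r hr =>
    (Nat.pow_le_pow_right hM0 (by omega)).trans hm2'.le
  have t1 := err_one n M K H hM0 hK0 (by omega) (hpow H (by omega))
  have t2 := err_two n M L hL (by omega)
  have hnr : (0 : ℝ) < n := by exact_mod_cast hn
  have p1 : (M : ℝ) ^ L ≤ n / M := by
    rw [le_div_iff₀ hMr, ← pow_succ]; exact_mod_cast hpow (L + 1) (by omega)
  have p2 : (M : ℝ) ^ H * (M : ℝ) ^ L ≤ n / M := by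
    rw [le_div_iff₀ hMr, ← pow_add, ← pow_succ]; exact_mod_cast hpow (H + L + 1) (by omega)
  have p3 : (1 : ℝ) ≤ n / M := by
    rw [le_div_iff₀ hMr, one_mul]; exact_mod_cast (by simpa using hpow 1 (by omega))
  have h4r : (n : ℝ) ≤ ((q * (L ^ L * L) : ℕ) : ℝ) + (((M - M / K) ^ H * (n / M ^ H + 1) : ℕ) : ℝ)
        + L * (((n - (n / M ^ L * (M / L) ^ L) * L ^ L : ℕ) : ℝ)
          + (P * P) * (H * (4 * ((M : ℝ) ^ H * (L * (L * (M : ℝ) ^ L)))))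
          + (P * P) * (L * (2 * ((n / K : ℕ) : ℝ) + 1))) := by
    rw [hP]; exact_mod_cast h4
  have hnK : ((n / K : ℕ) : ℝ) ≤ n / K := Nat.cast_div_le
  have q1 : 2 * (1 - 1 / (2 * K : ℝ)) ^ H * n ≤ η / 4 * n := by
    apply mul_le_mul_of_nonneg_right _ hnr.le; linarith
  have q3 : L * ((P * P) * (H * (4 * ((M : ℝ) ^ H * (L * (L * (M : ℝ) ^ L)))))) ≤
      4 * L ^ 3 * P ^ 2 * H * (n / M) := by
    calc _ = 4 * L ^ 3 * P ^ 2 * H * ((M : ℝ) ^ H * (M : ℝ) ^ L) := by ring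
      _ ≤ _ := mul_le_mul_of_nonneg_left p2 (by positivity)
  have q4 : L * ((P * P) * (L * (2 * ((n / K : ℕ) : ℝ) + 1))) ≤
      2 * L ^ 2 * P ^ 2 * (n / K) + L ^ 2 * P ^ 2 * (n / M) := by
    calc _ = L ^ 2 * P ^ 2 * (2 * ((n / K : ℕ) : ℝ) + 1) := by ring
      _ ≤ L ^ 2 * P ^ 2 * (2 * (n / K) + n / M) := by
        apply mul_le_mul_of_nonneg_left _ (by positivity); linarith
      _ = _ := by ring
  have q2 : L * ((n - (n / M ^ L * (M / L) ^ L) * L ^ L : ℕ) : ℝ) ≤ 2 * L ^ 3 * (n / M) := by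
    have hL1 : (1 : ℝ) ≤ L := by exact_mod_cast hL
    have hx : 0 ≤ (n / M : ℝ) := by positivity
    have e : (n : ℝ) * (L ^ 2 / M) = L ^ 2 * (n / M) := by ring
    rw [e] at t2
    have hL2 : (1 : ℝ) ≤ L ^ 2 := one_le_pow₀ hL1
    calc _ ≤ (L : ℝ) * (n / M + L ^ 2 * (n / M)) := by
            apply mul_le_mul_of_nonneg_left _ hLr.le; linarith
      _ ≤ (L : ℝ) * (L ^ 2 * (n / M) + L ^ 2 * (n / M)) := by
            apply mul_le_mul_of_nonneg_left _ hLr.le; nlinarith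
      _ = _ := by ring
  have r1 : 2 * L ^ 2 * P ^ 2 * (n / K) ≤ η / 4 * n := by
    have : 2 * L ^ 2 * P ^ 2 ≤ η / 4 * K := by
      have := mul_le_mul_of_nonneg_left hK2.le (show 0 ≤ η / 4 by positivity)
      refine le_trans (le_of_eq ?_) this
      field_simp
    rw [← mul_div_assoc, div_le_iff₀ (by positivity)]
    have h' := mul_le_mul_of_nonneg_right this hnr.le
    refine h'.trans (le_of_eq ?_)
    ring
  have r2 : (2 * L ^ 3 + 4 * L ^ 3 * P ^ 2 * H + L ^ 2 * P ^ 2) * (n / M) ≤ η / 4 * n := by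
    have : (2 * L ^ 3 + 4 * L ^ 3 * P ^ 2 * H + L ^ 2 * P ^ 2) ≤ η / 4 * M := by
      have hCM : (C0 : ℝ) ≤ M := by exact_mod_cast (by omega : C0 ≤ M)
      have := mul_le_mul_of_nonneg_left (hC0.le.trans hCM) (show 0 ≤ η / 4 by positivity)
      refine le_trans (le_of_eq ?_) this
      field_simp
    rw [← mul_div_assoc, div_le_iff₀ (by positivity)]
    have h' := mul_le_mul_of_nonneg_right this hnr.le
    refine h'.trans (le_of_eq ?_)
    ring
  have hηn : 0 ≤ η * n := by positivity
  rw [mul_add (L : ℝ), mul_add (L : ℝ)] at h4r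
  rw [add_mul, add_mul] at r2
  rw [sub_mul, one_mul]
  linarith

lemma count_slice {Y : Type} [Finite Y] (L : ℕ) [NeZero L] (v : Y → Fin L) (r : Fin L → Y → Y)
    (hr : ∀ s, Function.Injective (r s)) (hv : ∀ s y, v (r s y) = v y + s) (c : Fin L) :
    L * ({y | v y = c} : Set Y).ncard ≤ Nat.card Y := by
  have hinj : Function.Injective (fun p : Fin L × ({y | v y = c} : Set Y) => r p.1 p.2.1) := by
    rintro ⟨s, y, hy⟩ ⟨s', y', hy'⟩ h
    simp only at h
    have h1 := congrArg v h
    rw [hv, hv, show v y = c from hy, show v y' = c from hy'] at h1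
    have h2 := add_left_cancel h1
    subst h2
    have := hr _ h
    subst this
    rfl
  have := Nat.card_le_card_of_injective _ hinj
  rw [Nat.card_prod, Nat.card_fin, Nat.card_coe_set_eq] at this
  exact this

lemma update_inj {ι V : Type} [DecidableEq ι] (i0 : ι) (r : V → V) (hr : Function.Injective r) :
    Function.Injective (fun x : ι → V => Function.update x i0 (r (x i0))) := by
  intro x y h
  funext i
  have h1 := congrFun h i
  by_cases hi : i = i0
  · subst hi; simp only [Function.update_self] at h1; exact hr h1
  · simpa [Function.update_of_ne hi] using h1

theorem exists_perm_wreath (ε : ℝ) (hε : 0 < ε) (k : ℕ) (hk : 3 ≤ k) :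
    ∃ C : ℕ, ∀ (m : ℤ) (n : ℕ), 0 < n → Int.gcd m n = 1 →
      (C : ℤ) < |m| → |m| ^ C < (n : ℤ) →
      ∃ f : Equiv.Perm (ZMod n), f ^ k = 1 ∧
        (1 - ε) * n ≤ (({x : ZMod n | f (x + 1) = (m : ZMod n) * f x}).ncard : ℝ) := by
  classical
  obtain ⟨L, hLε⟩ := exists_nat_gt (8 / ε)
  have hL0r : (0 : ℝ) < L := lt_trans (by positivity) hLε
  have hL0 : 0 < L := by exact_mod_cast hL0r
  have : NeZero L := ⟨by omega⟩
  have : NeZero k := ⟨by omega⟩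
  obtain ⟨t, htk, ht⟩ := model_exists L k hk
  let I := {j : ZMod k // j ≠ 0} → WT L
  set Q := Fintype.card I with hQ
  have hQ0 : 0 < Q := Fintype.card_pos
  obtain ⟨C1, hC1⟩ := tile_exists L (ε / 4) (by positivity)
  obtain ⟨C2, hC2⟩ := exists_nat_gt (((Q * (L ^ L * L) : ℕ) : ℝ) * (4 / ε))
  refine ⟨C1 + C2 + 1, ?_⟩
  intro m n hn hg hm1 hm2
  have : NeZero n := ⟨by omega⟩
  have hmpos : (1 : ℤ) ≤ |m| := by push_cast at hm1; omega
  obtain ⟨q, ψ, hψ, hlam, hsig, hq⟩ := hC1 m n hn hg (by push_cast at hm1; omega)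
    (lt_of_le_of_lt (pow_le_pow_right₀ hmpos (by omega)) hm2)
  have hCn : (C2 : ℝ) ≤ n := by
    have h1 : |m| ^ 1 ≤ |m| ^ (C1 + C2 + 1) := pow_le_pow_right₀ hmpos (by omega)
    have : (C2 : ℤ) ≤ n := by push_cast at hm1; rw [pow_one] at h1; omega
    exact_mod_cast this
  set g := q / Q with hgdef
  have hemb : Nonempty (Fin g × I ↪ Fin q) := by
    apply Function.Embedding.nonempty_of_card_le
    rw [Fintype.card_prod, Fintype.card_fin, Fintype.card_fin]
    exact Nat.div_mul_le_self q Q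
  obtain ⟨emb⟩ := hemb
  let X := ZMod k → WT L
  let Y := Fin g × X
  let φ : Y → ZMod n := fun y => ψ (emb (y.1, (fun j => y.2 j.1)), y.2 0)
  have hφ : Function.Injective φ := by
    rintro ⟨i, x⟩ ⟨i', x'⟩ h
    have h1 := hψ h
    rw [Prod.mk.injEq] at h1
    have h2 := emb.injective h1.1
    rw [Prod.mk.injEq] at h2
    have h3 : x = x' := by
      funext j
      by_cases hj : j = 0
      · rw [hj]; exact h1.2
      · exact congrFun h2.2 ⟨j, hj⟩
    simp only at h2
    rw [h3, h2.1]
  let τ : Equiv.Perm Y := Equiv.prodCongr (Equiv.refl _) t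
  have hτ : ∀ i x, τ (i, x) = (i, t x) := fun _ _ => rfl
  have hτk : τ ^ k = 1 := by
    have : ∀ (j : ℕ) (i : Fin g) (x : X), (τ ^ j) (i, x) = (i, (t ^ j) x) := by
      intro j
      induction j with
      | zero => intro i x; rfl
      | succ j ih =>
        intro i x
        rw [pow_succ', Equiv.Perm.mul_apply, ih, hτ, pow_succ', Equiv.Perm.mul_apply]
    ext1 ⟨i, x⟩
    rw [this, htk]; rfl
  let Φ : Y ↪ ZMod n := ⟨φ, hφ⟩
  let f : Equiv.Perm (ZMod n) := τ.viaEmbedding Φ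
  have hf : ∀ y, f (φ y) = φ (τ y) := fun y => Equiv.Perm.viaEmbedding_apply τ Φ y
  refine ⟨f, ?_, ?_⟩
  · have h1 : f = Equiv.Perm.viaEmbeddingHom Φ τ := rfl
    rw [h1, ← map_pow, hτk, map_one]
  · let l1 : Fin L := ⟨L - 1, by omega⟩
    let Ba : Set Y := {y | (y.2 0).1 (y.2 0).2 = l1}
    let Bb : Set Y := {y | ((τ y).2 0).2 = 0}
    have hgood : φ '' (Ba ∪ Bb)ᶜ ⊆ {x : ZMod n | f (x + 1) = (m : ZMod n) * f x} := by
      rintro _ ⟨⟨i, x⟩, hy, rfl⟩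
      rw [Set.mem_compl_iff, Set.mem_union, not_or] at hy
      obtain ⟨ha, hb⟩ := hy
      have ha' : (((x 0).1 (x 0).2 : Fin L) : ℕ) + 1 < L := by
        have h1 := ((x 0).1 (x 0).2).2
        have h2 : (((x 0).1 (x 0).2 : Fin L) : ℕ) ≠ L - 1 := fun h => ha (Fin.ext h)
        omega
      have hb' : (t x 0).2 ≠ 0 := hb
      have e1 : φ (i, x) + 1 = φ (i, Function.update x 0 (lamW (x 0))) := by
        simp only [φ]
        rw [← hlam _ _ ha', Function.update_self]
        congr 4
        funext j
        rw [Function.update_of_ne j.2]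
      have e2 : (m : ZMod n) * φ (i, t x) = φ (i, Function.update (t x) 0 (sigW (t x 0))) := by
        simp only [φ]
        rw [← hsig _ _ hb', Function.update_self]
        congr 4
        funext j
        rw [Function.update_of_ne j.2]
      show f (φ (i, x) + 1) = (m : ZMod n) * f (φ (i, x))
      rw [e1, hf, hf, hτ, hτ, e2, ht]
    have hcY : Nat.card Y = g * Q * (L ^ L * L) := by
      have e : X ≃ WT L × I := Equiv.funSplitAt (0 : ZMod k) (WT L)
      have : Nat.card X = L ^ L * L * Q := by
        rw [Nat.card_congr e, Nat.card_prod, hQ, ← Nat.card_eq_fintype_card (α := I)]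
        congr 1
        simp
      rw [Nat.card_prod, this, Nat.card_fin]; ring
    have hYn : Nat.card Y ≤ n := by
      have := Nat.card_le_card_of_injective φ hφ
      rwa [Nat.card_zmod] at this
    have hBa : L * Ba.ncard ≤ Nat.card Y := by
      refine count_slice L (fun y : Y => (y.2 0).1 (y.2 0).2)
        (fun s y => (y.1, Function.update y.2 0 ((y.2 0).1 + Pi.single (y.2 0).2 s, (y.2 0).2))) ?_ ?_ l1
      · rintro s ⟨i, x⟩ ⟨i', x'⟩ h
        rw [Prod.mk.injEq] at h
        have := update_inj (0 : ZMod k) (fun w : WT L => (w.1 + Pi.single w.2 s, w.2)) (by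
          rintro ⟨c, p⟩ ⟨c', p'⟩ h
          rw [Prod.mk.injEq] at h
          obtain ⟨h1, h2⟩ := h
          simp only at h1 h2
          subst h2
          rw [add_right_cancel h1]) h.2
        exact Prod.ext h.1 this
      · intro s y; simp
    have hB0 : L * Bb.ncard ≤ Nat.card Y := by
      refine count_slice L (fun y : Y => ((τ y).2 0).2)
        (fun s y => τ.symm ((τ y).1, Function.update (τ y).2 0 (((τ y).2 0).1, ((τ y).2 0).2 + s))) ?_ ?_ 0
      · intro s y y' h
        have h := τ.symm.injective h
        rw [Prod.mk.injEq] at h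
        have := update_inj (0 : ZMod k) (fun w : WT L => (w.1, w.2 + s)) (by
          rintro ⟨c, p⟩ ⟨c', p'⟩ h
          rw [Prod.mk.injEq] at h
          obtain ⟨h1, h2⟩ := h
          simp only at h1 h2
          subst h1
          rw [add_right_cancel h2]) h.2
        exact τ.injective (Prod.ext h.1 this)
      · intro s y; simp
    have hcount : Nat.card Y ≤ ({x : ZMod n | f (x + 1) = (m : ZMod n) * f x}).ncard + (Ba.ncard + Bb.ncard) := by
      have h1 := Set.ncard_le_ncard hgood (Set.toFinite _)
      rw [Set.ncard_image_of_injective _ hφ] at h1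
      have h2 := Set.ncard_add_ncard_compl (Ba ∪ Bb)
      have h3 := Set.ncard_union_le Ba Bb
      omega
    have hq2 : q * (L ^ L * L) ≤ Nat.card Y + Q * (L ^ L * L) := by
      rw [hcY, ← add_mul]
      apply Nat.mul_le_mul_right
      have := (Nat.lt_mul_div_succ q hQ0).le
      rw [← hgdef] at this
      linarith
    have hq2r : ((q * (L ^ L * L) : ℕ) : ℝ) ≤ (Nat.card Y : ℝ) + ((Q * (L ^ L * L) : ℕ) : ℝ) := by
      exact_mod_cast hq2
    have hD : ((Q * (L ^ L * L) : ℕ) : ℝ) ≤ ε / 4 * n := by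
      have := mul_le_mul_of_nonneg_left (hC2.le.trans hCn) (show 0 ≤ ε / 4 by positivity)
      refine le_trans (le_of_eq ?_) this
      field_simp
    have hsl : ∀ B : ℕ, L * B ≤ Nat.card Y → (B : ℝ) ≤ ε / 8 * n := by
      intro B hB
      have h1 : (L : ℝ) * B ≤ n := by exact_mod_cast hB.trans hYn
      have h2 : 8 / ε * B ≤ n := le_trans (mul_le_mul_of_nonneg_right hLε.le (by positivity)) h1
      have := mul_le_mul_of_nonneg_left h2 (show 0 ≤ ε / 8 by positivity)
      refine le_trans (le_of_eq ?_) this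
      field_simp
    have b1 := hsl _ hBa
    have b2 := hsl _ hB0
    have hcr : (Nat.card Y : ℝ) ≤ (({x : ZMod n | f (x + 1) = (m : ZMod n) * f x}).ncard : ℝ)
        + ((Ba.ncard : ℝ) + Bb.ncard) := by exact_mod_cast hcount
    have hεn : 0 ≤ ε * n := by positivity
    rw [sub_mul, one_mul] at hq ⊢
    linarith
end
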